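/- (Doubling inequality for the σ₂ equation.) Let u ∈ C⁴(B₄(0)) be a 2-convex solution of σ₂(λ(D²u)) = ψ(x,u,∇u) in B₄(0) ⊂ ℝⁿ, with ψ positive and of class C¹. Suppose that at every point λ_min(D²u)/Δu ≥ −c_n, where c_n = (√(3n²+1) − n + 1)/(2n) and λ_min denotes the smallest eigenvalue of D²u. Then sup_{B₂(0)} Δu ≤ C(1 + sup_{B₁(0)} Δu), where C depends only on n, ‖ψ‖_{C¹}, ‖1/ψ‖_{L^∞} and ‖u‖_{C¹(B₃(0))}. -/

import Mathlib

open Metric Set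

/-- The Hessian matrix of `u : ℝⁿ → ℝ` at `x`, with entries the second partial derivatives. -/
noncomputable def hessian (n : ℕ) (u : (Fin n → ℝ) → ℝ) (x : Fin n → ℝ) :
    Matrix (Fin n) (Fin n) ℝ :=
  fun i j => iteratedFDeriv ℝ 2 u x ![Pi.single i 1, Pi.single j 1]

/-- `Δu = σ₁(λ(D²u))`: the trace of the Hessian. -/
noncomputable def lapl (n : ℕ) (u : (Fin n → ℝ) → ℝ) (x : Fin n → ℝ) : ℝ :=
  ∑ i, hessian n u x i i

/-- `σ₂(λ(D²u)) = ((tr D²u)² − tr((D²u)²))/2`, the second elementary symmetric function of the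
eigenvalues of the (symmetric) Hessian. -/
noncomputable def sigma2 (n : ℕ) (u : (Fin n → ℝ) → ℝ) (x : Fin n → ℝ) : ℝ :=
  ((lapl n u x) ^ 2 - ∑ i, ∑ j, hessian n u x i j * hessian n u x j i) / 2

/-- The gradient vector `∇u(x)` of `u : ℝⁿ → ℝ`. -/
noncomputable def gradvec (n : ℕ) (u : (Fin n → ℝ) → ℝ) (x : Fin n → ℝ) : Fin n → ℝ :=
  fun i => fderiv ℝ u x (Pi.single i 1)

/-- The inequality `(1 + (1 + ε) x) (3 (n - 1) - 4 (n - 1) x + 2 n x²) ≤ 3 (n - 1 + 2 x²)` holds for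
`ε = 0` below the critical value `1 + c_n`. -/
lemma jacobi_poly_critical {n : ℝ} (hn : 2 ≤ n) {x : ℝ} (hx : 0 ≤ x)
    (hx1 : x ≤ 1 + (Real.sqrt (3 * n ^ 2 + 1) - n + 1) / (2 * n)) :
    (1 + (1 + 0) * x) * (3 * (n - 1) - 4 * (n - 1) * x + 2 * n * x ^ 2)
      ≤ 3 * (n - 1 + 2 * x ^ 2) ∧ x ≤ 2 := by
  set s := Real.sqrt (3 * n ^ 2 + 1)
  have hs : s ^ 2 = 3 * n ^ 2 + 1 := Real.sq_sqrt (by positivity)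
  have hs0 : 0 ≤ s := Real.sqrt_nonneg _
  have h1 : 2 * n * x ≤ s + n + 1 := by
    have : 1 + (s - n + 1) / (2 * n) = (s + n + 1) / (2 * n) := by field_simp; ring
    rw [this, le_div_iff₀ (by positivity)] at hx1
    linarith
  have hs2 : s ≤ 2 * n := by nlinarith
  have hsn : n + 1 ≤ s := by nlinarith
  have h2 : 2 * n * x ^ 2 - 2 * (n + 1) * x - (n - 1) ≤ 0 := by
    have : 2 * n * (2 * n * x ^ 2 - 2 * (n + 1) * x - (n - 1))
        = (2 * n * x - (s + n + 1)) * (2 * n * x + (s - n - 1)) := by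
      nlinarith
    have h3 : (2 * n * x - (s + n + 1)) * (2 * n * x + (s - n - 1)) ≤ 0 :=
      mul_nonpos_of_nonpos_of_nonneg (by linarith) (by nlinarith)
    by_contra h
    push Not at h
    have : 0 < 2 * n * (2 * n * x ^ 2 - 2 * (n + 1) * x - (n - 1)) := by positivity
    linarith
  refine ⟨?_, by nlinarith⟩
  have := mul_nonpos_of_nonneg_of_nonpos hx h2
  nlinarith

lemma jacobi_poly_tenth {n : ℝ} (hn : 2 ≤ n) {x : ℝ} (hx : 0 ≤ x) (hx1 : x ≤ 11 / 10) :
    (1 + (1 + 1 / 10) * x) * (3 * (n - 1) - 4 * (n - 1) * x + 2 * n * x ^ 2)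
      ≤ 3 * (n - 1 + 2 * x ^ 2) := by
  have h1 : x * (-(7 / 10) - (24 / 10) * x + (22 / 10) * x ^ 2) ≤ 0 :=
    mul_nonpos_of_nonneg_of_nonpos hx (by nlinarith)
  have h2 : x ^ 2 * ((22 / 10) * x - 4) ≤ 0 :=
    mul_nonpos_of_nonneg_of_nonpos (sq_nonneg x) (by linarith)
  have h3 := mul_nonpos_of_nonneg_of_nonpos (by linarith : 0 ≤ n - 1) h1
  nlinarith

/-- The entries of a symmetric 3-tensor with at least two equal indices. -/
lemma sum_sq_repeated_le {n : ℕ} (T : Fin n → Fin n → Fin n → ℝ)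
    (h1 : ∀ i j k, T i j k = T j i k) (h2 : ∀ i j k, T i j k = T i k j) :
    ∑ i, (3 * ∑ j, T j j i ^ 2 - 2 * T i i i ^ 2) ≤ ∑ i, ∑ j, ∑ k, T i j k ^ 2 := by
  have e1 : ∑ i, ∑ j, T j j i ^ 2 = ∑ i, ∑ j, ∑ k, (if i = j then T i j k ^ 2 else 0) := by
    simp_rw [Finset.sum_comm (s := Finset.univ) (t := Finset.univ)
      (f := fun j k => if _ = j then T _ j k ^ 2 else 0)]
    simp only [Finset.sum_ite_eq, Finset.mem_univ, if_true]
    rw [Finset.sum_comm]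
  have e2 : ∑ i, ∑ j, T j j i ^ 2 = ∑ i, ∑ j, ∑ k, (if i = k then T i j k ^ 2 else 0) := by
    simp only [Finset.sum_ite_eq, Finset.mem_univ, if_true]
    rw [Finset.sum_comm]
    refine Finset.sum_congr rfl fun i _ => Finset.sum_congr rfl fun j _ => ?_
    rw [h2]
  have e3 : ∑ i, ∑ j, T j j i ^ 2 = ∑ i, ∑ j, ∑ k, (if j = k then T i j k ^ 2 else 0) := by
    simp only [Finset.sum_ite_eq, Finset.mem_univ, if_true]
    refine Finset.sum_congr rfl fun i _ => Finset.sum_congr rfl fun j _ => ?_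
    rw [h2, h1]
  have e4 : ∑ i, T i i i ^ 2
      = ∑ i, ∑ j, ∑ k, (if i = j then (if i = k then T i j k ^ 2 else 0) else 0) := by
    refine Finset.sum_congr rfl fun i _ => ?_
    rw [Finset.sum_eq_single i]
    · simp
    · intro b _ hb
      simp [hb.symm]
    · simp
  have : ∑ i, (3 * ∑ j, T j j i ^ 2 - 2 * T i i i ^ 2)
      = ∑ i, ∑ j, T j j i ^ 2 + ∑ i, ∑ j, T j j i ^ 2 + ∑ i, ∑ j, T j j i ^ 2
        - 2 * ∑ i, T i i i ^ 2 := by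
    rw [Finset.sum_sub_distrib, ← Finset.mul_sum, ← Finset.mul_sum]; ring
  rw [this]
  nth_rewrite 1 [e1]
  nth_rewrite 1 [e2]
  rw [e3, e4, Finset.mul_sum, ← Finset.sum_add_distrib, ← Finset.sum_add_distrib,
    ← Finset.sum_sub_distrib]
  refine Finset.sum_le_sum fun i _ => ?_
  rw [Finset.mul_sum, ← Finset.sum_add_distrib, ← Finset.sum_add_distrib,
    ← Finset.sum_sub_distrib]
  refine Finset.sum_le_sum fun j _ => ?_
  rw [Finset.mul_sum, ← Finset.sum_add_distrib, ← Finset.sum_add_distrib,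
    ← Finset.sum_sub_distrib]
  refine Finset.sum_le_sum fun k _ => ?_
  have := sq_nonneg (T i j k)
  by_cases ha : i = j <;> by_cases hb : i = k <;> by_cases hc : j = k <;> simp_all
  all_goals linarith

set_option maxHeartbeats 1000000 in
/-- One row of the Jacobi inequality in an eigenframe. -/
lemma jacobi_row {n : ℕ} (hn : 2 ≤ n) (F b : Fin n → ℝ) (L ε : ℝ) (hL : 0 < L)
    (hF1 : ∑ j, F j = (n - 1) * L) (hF2 : ∑ j, F j ^ 2 ≤ (n - 1) * L ^ 2) (i : Fin n)
    (hε : 0 ≤ ε) (hε1 : ε ≤ 1) (hx : 0 < F i) (hx2 : F i ≤ 2 * L)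
    (hp : (1 + (1 + ε) * (F i / L))
        * (3 * ((n : ℝ) - 1) - 4 * (n - 1) * (F i / L) + 2 * n * (F i / L) ^ 2)
      ≤ 3 * (n - 1 + 2 * (F i / L) ^ 2)) :
    (1 + (1 + ε) * (F i / L)) * (∑ j, b j) ^ 2 - 50 / L * |∑ j, b j| * |∑ j, F j * b j|
      ≤ 3 * ∑ j, b j ^ 2 - 2 * b i ^ 2 := by
  have hn' : (2 : ℝ) ≤ n := by exact_mod_cast hn
  set x := F i / L with hxdef
  have hx0 : 0 < x := by positivity
  have hx2' : x ≤ 2 := by rw [hxdef, div_le_iff₀ hL]; exact hx2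
  have hFi : F i = x * L := by rw [hxdef]; field_simp
  set D : ℝ := n - 1 + 2 * x ^ 2 with hD
  have hDpos : 0 < D := by rw [hD]; nlinarith [sq_nonneg x]
  set s : ℝ := (n - 1 + 2 * x) / D with hs
  have hsD : s * D = n - 1 + 2 * x := by rw [hs]; field_simp
  have hs0 : 0 ≤ s := by rw [hs]; apply div_nonneg _ hDpos.le; linarith
  have hs5 : s ≤ 5 := by
    rw [hs, div_le_iff₀ hDpos, hD]; nlinarith [sq_nonneg x]
  set r := s / L with hr
  have hrL : r * L = s := by rw [hr]; field_simp
  set κ : Fin n → ℝ := fun j => if j = i then 1 else 3 with hκ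
  have hκpos : ∀ j, 0 < κ j := by intro j; simp only [hκ]; split_ifs <;> norm_num
  set τ := ∑ j, b j with hτ
  set g := ∑ j, F j * b j with hg
  have hN : ∑ j, κ j * b j ^ 2 = 3 * ∑ j, b j ^ 2 - 2 * b i ^ 2 := by
    have : ∀ j, κ j * b j ^ 2 = 3 * b j ^ 2 - (if j = i then 2 * b j ^ 2 else 0) := by
      intro j; simp only [hκ]; split_ifs <;> ring
    simp_rw [this]
    rw [Finset.sum_sub_distrib, ← Finset.mul_sum]
    simp
  have hCS : (τ - r * g) ^ 2 ≤ (∑ j, (1 - r * F j) ^ 2 / κ j) * ∑ j, κ j * b j ^ 2 := by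
    have e : τ - r * g = ∑ j, (1 - r * F j) * b j := by
      rw [hτ, hg, Finset.mul_sum, ← Finset.sum_sub_distrib]
      exact Finset.sum_congr rfl fun j _ => by ring
    rw [e]
    apply Finset.sum_sq_le_sum_mul_sum_of_sq_le_mul
    · intro j _; have := hκpos j; positivity
    · intro j _; have := hκpos j; positivity
    · intro j _; have := hκpos j; apply le_of_eq; field_simp
  have hm : 3 * D * ∑ j, (1 - r * F j) ^ 2 / κ j
      ≤ 3 * ((n : ℝ) - 1) - 4 * (n - 1) * x + 2 * n * x ^ 2 := by
    have e : ∀ j, (1 - r * F j) ^ 2 / κ j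
        = 1 / 3 * (1 - 2 * r * F j + r ^ 2 * F j ^ 2)
          + (if j = i then 2 / 3 * (1 - r * F j) ^ 2 else 0) := by
      intro j; simp only [hκ]; split_ifs <;> ring
    have e2 : ∑ j, (1 - r * F j) ^ 2 / κ j
        = 1 / 3 * (n - 2 * r * ((n - 1) * L) + r ^ 2 * ∑ j, F j ^ 2)
          + 2 / 3 * (1 - r * F i) ^ 2 := by
      simp_rw [e]
      rw [Finset.sum_add_distrib, ← Finset.mul_sum, Finset.sum_add_distrib,
        Finset.sum_sub_distrib, ← Finset.mul_sum, ← Finset.mul_sum, hF1]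
      simp
    have e3 : r ^ 2 * ∑ j, F j ^ 2 ≤ (n - 1) * s ^ 2 := by
      have := mul_le_mul_of_nonneg_left hF2 (sq_nonneg r)
      calc _ ≤ _ := this
        _ = _ := by rw [← hrL]; ring
    have e4 : ∑ j, (1 - r * F j) ^ 2 / κ j ≤
        1 / 3 * (n + 2 - 2 * s * (n - 1 + 2 * x) + s ^ 2 * D) := by
      rw [e2, hFi, show r * (x * L) = s * x by rw [← hrL]; ring,
        show 2 * r * ((n - 1) * L) = 2 * s * (n - 1) by rw [← hrL]; ring, hD]
      nlinarith
    have e5 : 3 * D * (1 / 3 * (n + 2 - 2 * s * (n - 1 + 2 * x) + s ^ 2 * D))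
        = 3 * ((n : ℝ) - 1) - 4 * (n - 1) * x + 2 * n * x ^ 2 := by
      have : 3 * D * (1 / 3 * (n + 2 - 2 * s * (n - 1 + 2 * x) + s ^ 2 * D))
        = (n + 2) * D - 2 * (s * D) * (n - 1 + 2 * x) + (s * D) ^ 2 := by ring
      rw [this, hsD, hD]; ring
    rw [← e5]
    exact mul_le_mul_of_nonneg_left e4 (by positivity)
  set c := 1 + (1 + ε) * x with hc
  have hc0 : 0 < c := by positivity
  have hc5 : c ≤ 5 := by rw [hc]; nlinarith
  have hm1 : c * ∑ j, (1 - r * F j) ^ 2 / κ j ≤ 1 := by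
    have h1 := mul_le_mul_of_nonneg_left hm hc0.le
    have h2 : 3 * D * (c * ∑ j, (1 - r * F j) ^ 2 / κ j) ≤ 3 * D * 1 := by
      calc _ = c * (3 * D * ∑ j, (1 - r * F j) ^ 2 / κ j) := by ring
        _ ≤ _ := h1.trans (by linarith)
    exact le_of_mul_le_mul_left h2 (by positivity)
  have hN0 : 0 ≤ ∑ j, κ j * b j ^ 2 :=
    Finset.sum_nonneg fun j _ => mul_nonneg (hκpos j).le (sq_nonneg _)
  have hfin : c * (τ - r * g) ^ 2 ≤ ∑ j, κ j * b j ^ 2 := by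
    calc _ ≤ c * ((∑ j, (1 - r * F j) ^ 2 / κ j) * ∑ j, κ j * b j ^ 2) :=
          mul_le_mul_of_nonneg_left hCS hc0.le
      _ = (c * ∑ j, (1 - r * F j) ^ 2 / κ j) * ∑ j, κ j * b j ^ 2 := by ring
      _ ≤ 1 * _ := mul_le_mul_of_nonneg_right hm1 hN0
      _ = _ := one_mul _
  rw [← hN]
  refine le_trans ?_ hfin
  have hcr : 2 * c * r ≤ 50 / L := by
    rw [hr, le_div_iff₀ hL]
    calc 2 * c * (s / L) * L = 2 * c * s := by field_simp
      _ ≤ 2 * 5 * 5 := by gcongr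
      _ = 50 := by norm_num
  have h3 : τ * g ≤ |τ| * |g| := by rw [← abs_mul]; exact le_abs_self _
  have h4 : 2 * c * r * (τ * g) ≤ 50 / L * (|τ| * |g|) := by
    calc _ ≤ 2 * c * r * (|τ| * |g|) := mul_le_mul_of_nonneg_left h3 (by positivity)
      _ ≤ _ := mul_le_mul_of_nonneg_right hcr (by positivity)
  nlinarith [mul_nonneg hc0.le (sq_nonneg (r * g))]

/-- The Jacobi inequality in an eigenframe. -/
lemma jacobi_diag {n : ℕ} (hn : 2 ≤ n) (lam : Fin n → ℝ) (T : Fin n → Fin n → Fin n → ℝ)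
    (h1 : ∀ i j k, T i j k = T j i k) (h2 : ∀ i j k, T i j k = T i k j)
    (L f K ε δ : ℝ) (hL : 0 < L) (hlam : ∑ i, lam i = L) (hf : 2 * f = L ^ 2 - ∑ i, lam i ^ 2)
    (hK : 0 < K) (hfK : 1 / K ≤ f) (hε : 0 ≤ ε) (hε1 : ε ≤ 1) (hδ : 0 < δ)
    (hx2 : ∀ i, L - lam i ≤ 2 * L)
    (hp : ∀ i, 0 ≤ (L - lam i) / L → (1 + (1 + ε) * ((L - lam i) / L))
        * (3 * ((n : ℝ) - 1) - 4 * (n - 1) * ((L - lam i) / L) + 2 * n * ((L - lam i) / L) ^ 2)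
      ≤ 3 * (n - 1 + 2 * ((L - lam i) / L) ^ 2)) :
    ∑ i, (∑ j, T j j i) ^ 2 + (1 + ε - δ) * (∑ i, (L - lam i) * (∑ j, T j j i) ^ 2) / L
        - 625 * K / δ * ∑ i, (∑ j, (L - lam j) * T j j i) ^ 2
      ≤ ∑ i, ∑ j, ∑ k, T i j k ^ 2 := by
  have hfpos : 0 < f := lt_of_lt_of_le (by positivity) hfK
  have hFL : ∀ i, f ≤ (L - lam i) * L := by
    intro i
    have : lam i ^ 2 ≤ ∑ i, lam i ^ 2 :=
      Finset.single_le_sum (f := fun i => lam i ^ 2) (fun j _ => sq_nonneg _) (Finset.mem_univ i)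
    nlinarith [sq_nonneg (L - lam i)]
  have hFpos : ∀ i, 0 < L - lam i := fun i =>
    pos_of_mul_pos_left (lt_of_lt_of_le hfpos (hFL i)) hL.le
  refine le_trans ?_ (sum_sq_repeated_le T h1 h2)
  have hrow : ∀ i, (1 + (1 + ε) * ((L - lam i) / L)) * (∑ j, T j j i) ^ 2
      - 50 / L * |∑ j, T j j i| * |∑ j, (L - lam j) * T j j i|
      ≤ 3 * ∑ j, T j j i ^ 2 - 2 * T i i i ^ 2 := by
    intro i
    refine jacobi_row hn (fun j => L - lam j) (fun j => T j j i) L ε hL ?_ ?_ i hε hε1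
      (hFpos i) (hx2 i) (hp i (div_nonneg (hFpos i).le hL.le))
    · rw [Finset.sum_sub_distrib, hlam]; simp; ring
    · have : ∑ j, (L - lam j) ^ 2 = n * L ^ 2 - 2 * L * L + ∑ j, lam j ^ 2 := by
        have e : ∀ j, (L - lam j) ^ 2 = L ^ 2 - 2 * L * lam j + lam j ^ 2 := fun j => by ring
        simp_rw [e]
        rw [Finset.sum_add_distrib, Finset.sum_sub_distrib, ← Finset.mul_sum, hlam]; simp
      rw [this]; nlinarith
  rw [Finset.mul_sum, Finset.mul_sum, Finset.sum_div, ← Finset.sum_add_distrib,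
    ← Finset.sum_sub_distrib]
  refine Finset.sum_le_sum fun i _ => le_trans ?_ (hrow i)
  set τ := ∑ j, T j j i
  set g := ∑ j, (L - lam j) * T j j i
  set F := L - lam i with hF
  have hFp : 0 < F := hFpos i
  have key : 50 / L * |τ| * |g| ≤ δ * F * τ ^ 2 / L + 625 * K / δ * g ^ 2 := by
    have h3 : 50 / L * |τ| * |g| ≤ δ * F * τ ^ 2 / L + 625 / (δ * F * L) * g ^ 2 := by
      have e : δ * F * τ ^ 2 / L + 625 / (δ * F * L) * g ^ 2 - 50 / L * |τ| * |g|
          = (δ * F * |τ| - 25 * |g|) ^ 2 / (δ * F * L) := by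
        rw [← sq_abs τ, ← sq_abs g]; field_simp; ring
      have : 0 ≤ (δ * F * |τ| - 25 * |g|) ^ 2 / (δ * F * L) := by positivity
      linarith
    have h4 : 625 / (δ * F * L) ≤ 625 * K / δ := by
      have h5 : 1 ≤ K * (F * L) := by
        have := mul_le_mul_of_nonneg_left (hfK.trans (hFL i)) hK.le
        rwa [mul_one_div_cancel hK.ne'] at this
      rw [div_le_div_iff₀ (by positivity) hδ]
      nlinarith [mul_le_mul_of_nonneg_left h5 hδ.le]
    have := mul_le_mul_of_nonneg_right h4 (sq_nonneg g)
    linarith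
  have e : (1 + (1 + ε) * (F / L)) * τ ^ 2
      = τ ^ 2 + (1 + ε - δ) * (F * τ ^ 2) / L + δ * F * τ ^ 2 / L := by field_simp; ring
  rw [e]; linarith

/-- The linearized operator `Λ I - A` of `σ₂` at a symmetric matrix `A`, as a bilinear form. -/
def linForm {n : ℕ} (A : Fin n → Fin n → ℝ) (x y : Fin n → ℝ) : ℝ :=
  (∑ i, A i i) * ∑ i, x i * y i - ∑ i, ∑ j, x i * A i j * y j

/-- The trace of `(Λ I - A) A²`. -/
def linTrace {n : ℕ} (A : Fin n → Fin n → ℝ) : ℝ :=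
  ∑ i, ∑ j, ((if i = j then ∑ k, A k k else 0) - A i j) * ∑ k, A j k * A k i

/-- An orthonormal eigenframe `U` with eigenvalues `lam` of a symmetric matrix. -/
structure EigenFrame {n : ℕ} (A : Fin n → Fin n → ℝ) (U : Fin n → Fin n → ℝ)
    (lam : Fin n → ℝ) : Prop where
  rows : ∀ i j, ∑ a, U i a * U j a = if i = j then 1 else 0
  cols : ∀ a b, ∑ i, U i a * U i b = if a = b then 1 else 0
  diag : ∀ i j, A i j = ∑ a, lam a * (U i a * U j a)

lemma exists_eigenFrame {n : ℕ} (A : Fin n → Fin n → ℝ) (hA : ∀ i j, A i j = A j i) :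
    ∃ U lam, EigenFrame A U lam := by
  have hH : (Matrix.of A).IsHermitian := by
    ext i j; simp [Matrix.conjTranspose_apply, hA i j]
  have hs := hH.spectral_theorem
  set V : Matrix (Fin n) (Fin n) ℝ := (hH.eigenvectorUnitary : Matrix (Fin n) (Fin n) ℝ) with hV
  have hu := (Matrix.mem_unitaryGroup_iff (A := V)).1 hH.eigenvectorUnitary.2
  have hu' := (Matrix.mem_unitaryGroup_iff' (A := V)).1 hH.eigenvectorUnitary.2
  refine ⟨V, hH.eigenvalues, ?_, ?_, ?_⟩
  · intro i j
    have := congrFun (congrFun hu i) j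
    simpa [Matrix.mul_apply, Matrix.one_apply, Matrix.star_apply] using this
  · intro a b
    have := congrFun (congrFun hu' a) b
    simpa [Matrix.mul_apply, Matrix.one_apply, Matrix.star_apply] using this
  · intro i j
    have := congrFun (congrFun hs i) j
    rw [Unitary.conjStarAlgAut_apply] at this
    simp only [Matrix.of_apply] at this
    rw [this]
    simp only [Matrix.mul_apply, Matrix.diagonal_apply, Matrix.star_apply, Function.comp]
    refine Finset.sum_congr rfl fun a _ => ?_
    simp [hV]
    ring

namespace EigenFrame

variable {n : ℕ} {A U : Fin n → Fin n → ℝ} {lam : Fin n → ℝ}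

lemma sum_rot (h : EigenFrame A U lam) (x y : Fin n → ℝ) :
    ∑ a, (∑ i, U i a * x i) * (∑ i, U i a * y i) = ∑ i, x i * y i := by
  calc ∑ a, (∑ i, U i a * x i) * (∑ i, U i a * y i)
      = ∑ a, ∑ i, ∑ j, (U i a * U j a) * (x i * y j) := by
        refine Finset.sum_congr rfl fun a _ => ?_
        rw [Finset.sum_mul_sum]
        exact Finset.sum_congr rfl fun i _ => Finset.sum_congr rfl fun j _ => by ring
    _ = ∑ i, ∑ j, (∑ a, U i a * U j a) * (x i * y j) := by
        rw [Finset.sum_comm]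
        refine Finset.sum_congr rfl fun i _ => ?_
        rw [Finset.sum_comm]
        exact Finset.sum_congr rfl fun j _ => by rw [Finset.sum_mul]
    _ = _ := by simp [h.rows]

lemma sum_rot_sq (h : EigenFrame A U lam) (x : Fin n → ℝ) :
    ∑ a, (∑ i, U i a * x i) ^ 2 = ∑ i, x i ^ 2 := by
  simpa [sq] using h.sum_rot x x

lemma rot_mul (h : EigenFrame A U lam) (x : Fin n → ℝ) (a : Fin n) :
    ∑ i, U i a * ∑ j, A i j * x j = lam a * ∑ i, U i a * x i := by
  calc ∑ i, U i a * ∑ j, A i j * x j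
      = ∑ i, ∑ j, ∑ b, (U i a * U i b) * (lam b * (U j b * x j)) := by
        refine Finset.sum_congr rfl fun i _ => ?_
        rw [Finset.mul_sum]
        refine Finset.sum_congr rfl fun j _ => ?_
        rw [h.diag i j, Finset.sum_mul, Finset.mul_sum]
        exact Finset.sum_congr rfl fun b _ => by ring
    _ = ∑ b, ∑ j, (∑ i, U i a * U i b) * (lam b * (U j b * x j)) := by
        rw [Finset.sum_comm]
        simp_rw [Finset.sum_mul]
        rw [Finset.sum_comm]
        rw [Finset.sum_congr rfl fun i _ => Finset.sum_comm]
        rw [Finset.sum_comm]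
        refine Finset.sum_congr rfl fun b _ => ?_
        rw [Finset.sum_comm]
    _ = _ := by
        simp [h.cols, Finset.mul_sum]

lemma sum_lam (h : EigenFrame A U lam) : ∑ a, lam a = ∑ i, A i i := by
  simp_rw [h.diag]
  rw [Finset.sum_comm]
  refine Finset.sum_congr rfl fun a _ => ?_
  rw [← Finset.mul_sum, h.cols]; simp

lemma sum_quad (h : EigenFrame A U lam) (x y : Fin n → ℝ) :
    ∑ i, ∑ j, x i * A i j * y j = ∑ a, lam a * ((∑ i, U i a * x i) * ∑ i, U i a * y i) := by
  have : ∑ i, ∑ j, x i * A i j * y j = ∑ i, x i * ∑ j, A i j * y j := by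
    refine Finset.sum_congr rfl fun i _ => ?_
    rw [Finset.mul_sum]
    exact Finset.sum_congr rfl fun j _ => by ring
  rw [this, ← h.sum_rot]
  refine Finset.sum_congr rfl fun a _ => ?_
  rw [h.rot_mul]; ring

lemma linForm_eq (h : EigenFrame A U lam) (x y : Fin n → ℝ) :
    linForm A x y
      = ∑ a, ((∑ i, A i i) - lam a) * ((∑ i, U i a * x i) * ∑ i, U i a * y i) := by
  rw [linForm, h.sum_quad, ← h.sum_rot x y, Finset.mul_sum, ← Finset.sum_sub_distrib]
  exact Finset.sum_congr rfl fun a _ => by ring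

lemma sum_mul_eq (h : EigenFrame A U lam) (B : Fin n → Fin n → ℝ) :
    ∑ i, ∑ j, A i j * B i j = ∑ a, lam a * ∑ i, ∑ j, U i a * U j a * B i j := by
  simp_rw [h.diag, Finset.sum_mul, Finset.mul_sum]
  rw [Finset.sum_congr rfl fun i _ => Finset.sum_comm, Finset.sum_comm]
  exact Finset.sum_congr rfl fun a _ => Finset.sum_congr rfl fun i _ =>
    Finset.sum_congr rfl fun j _ => by ring

lemma sum_sq_eq (h : EigenFrame A U lam) :
    ∑ i, ∑ j, A i j ^ 2 = ∑ a, lam a ^ 2 := by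
  have : ∑ i, ∑ j, A i j ^ 2 = ∑ i, ∑ j, A i j * A i j := by simp_rw [sq]
  rw [this, h.sum_mul_eq]
  refine Finset.sum_congr rfl fun a _ => ?_
  have : ∑ i, ∑ j, U i a * U j a * A i j = ∑ i, U i a * ∑ j, A i j * U j a := by
    refine Finset.sum_congr rfl fun i _ => ?_
    rw [Finset.mul_sum]
    exact Finset.sum_congr rfl fun j _ => by ring
  rw [this, h.rot_mul, h.cols]; simp [sq]

lemma linTrace_eq (h : EigenFrame A U lam) (hA : ∀ i j, A i j = A j i) :
    linTrace A = ∑ a, ((∑ i, A i i) - lam a) * lam a ^ 2 := by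
  have e0 : ∀ i j, ∑ k, A j k * A k i = ∑ a, lam a ^ 2 * (U i a * U j a) := by
    intro i j
    have : ∑ k, A j k * A k i = ∑ k, ∑ l, A j k * (if k = l then 1 else 0) * A i l := by
      refine Finset.sum_congr rfl fun k _ => ?_
      simp [hA k i]
    have e := h.sum_rot (fun k => A j k) (fun k => A i k)
    have r1 : ∀ i a, ∑ k, U k a * A i k = lam a * U i a := by
      intro i a
      have := h.rot_mul (fun k => if k = i then 1 else 0) a
      simp at this
      rw [← this]
      exact Finset.sum_congr rfl fun k _ => by rw [hA]
    simp_rw [r1] at e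
    simp_rw [hA _ i]
    rw [← e]
    exact Finset.sum_congr rfl fun a _ => by ring
  have e1 : linTrace A = (∑ k, A k k) * (∑ i, ∑ k, A i k * A k i)
      - ∑ i, ∑ j, A i j * ∑ k, A j k * A k i := by
    rw [linTrace, Finset.mul_sum, ← Finset.sum_sub_distrib]
    refine Finset.sum_congr rfl fun i _ => ?_
    simp_rw [sub_mul]
    rw [Finset.sum_sub_distrib]
    simp
  have e2 : ∑ i, ∑ k, A i k * A k i = ∑ a, lam a ^ 2 := by
    rw [← h.sum_sq_eq]
    exact Finset.sum_congr rfl fun i _ => Finset.sum_congr rfl fun k _ => by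
      rw [hA k i, sq]
  rw [e1, e2, h.sum_mul_eq, Finset.mul_sum, ← Finset.sum_sub_distrib]
  refine Finset.sum_congr rfl fun a _ => ?_
  have : ∑ i, ∑ j, U i a * U j a * ∑ k, A j k * A k i = lam a ^ 2 := by
    have s1 : ∑ i, ∑ j, U i a * U j a * ∑ k, A j k * A k i
        = ∑ i, ∑ j, ∑ b, lam b ^ 2 * ((U i a * U i b) * (U j a * U j b)) := by
      refine Finset.sum_congr rfl fun i _ => Finset.sum_congr rfl fun j _ => ?_
      rw [e0, Finset.mul_sum]
      exact Finset.sum_congr rfl fun b _ => by ring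
    rw [s1, Finset.sum_congr rfl fun i _ => Finset.sum_comm, Finset.sum_comm]
    simp_rw [← Finset.mul_sum, ← Finset.sum_mul, h.cols]
    simp
  rw [this]; ring

end EigenFrame

lemma sum_rot_cube {n : ℕ} {A U : Fin n → Fin n → ℝ} {lam : Fin n → ℝ} (h : EigenFrame A U lam)
    (T : Fin n → Fin n → Fin n → ℝ) :
    ∑ a, ∑ b, ∑ c, (∑ i, U i a * ∑ j, U j b * ∑ k, U k c * T i j k) ^ 2
      = ∑ i, ∑ j, ∑ k, T i j k ^ 2 := by
  calc _ = ∑ b, ∑ c, ∑ a, (∑ i, U i a * ∑ j, U j b * ∑ k, U k c * T i j k) ^ 2 := by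
        rw [Finset.sum_comm]
        exact Finset.sum_congr rfl fun b _ => Finset.sum_comm
    _ = ∑ b, ∑ c, ∑ i, (∑ j, U j b * ∑ k, U k c * T i j k) ^ 2 := by
        simp_rw [fun b c => h.sum_rot_sq (fun i => ∑ j, U j b * ∑ k, U k c * T i j k)]
    _ = ∑ c, ∑ i, ∑ b, (∑ j, U j b * ∑ k, U k c * T i j k) ^ 2 := by
        rw [Finset.sum_comm]
        exact Finset.sum_congr rfl fun b _ => Finset.sum_comm
    _ = ∑ c, ∑ i, ∑ j, (∑ k, U k c * T i j k) ^ 2 := by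
        simp_rw [fun c i => h.sum_rot_sq (fun j => ∑ k, U k c * T i j k)]
    _ = ∑ i, ∑ j, ∑ c, (∑ k, U k c * T i j k) ^ 2 := by
        rw [Finset.sum_comm]
        exact Finset.sum_congr rfl fun b _ => Finset.sum_comm
    _ = _ := by
        simp_rw [fun i j => h.sum_rot_sq (fun k => T i j k)]

lemma rot_cube_contract {n : ℕ} {U : Fin n → Fin n → ℝ} (T : Fin n → Fin n → Fin n → ℝ)
    (μ : Fin n → ℝ) (B : Fin n → Fin n → ℝ) (hB : ∀ i j, B i j = ∑ a, μ a * (U i a * U j a))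
    (c : Fin n) :
    ∑ a, μ a * (∑ i, U i a * ∑ j, U j a * ∑ k, U k c * T i j k)
      = ∑ k, U k c * ∑ i, ∑ j, B i j * T i j k := by
  have l : ∀ a, μ a * (∑ i, U i a * ∑ j, U j a * ∑ k, U k c * T i j k)
      = ∑ i, ∑ j, ∑ k, μ a * (U i a * U j a) * (U k c * T i j k) := by
    intro a
    simp_rw [Finset.mul_sum]
    exact Finset.sum_congr rfl fun i _ => Finset.sum_congr rfl fun j _ =>
      Finset.sum_congr rfl fun k _ => by ring
  have r : ∑ k, U k c * ∑ i, ∑ j, B i j * T i j k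
      = ∑ k, ∑ i, ∑ j, ∑ a, μ a * (U i a * U j a) * (U k c * T i j k) := by
    simp_rw [hB, Finset.mul_sum, Finset.sum_mul, Finset.mul_sum]
    exact Finset.sum_congr rfl fun i _ => Finset.sum_congr rfl fun j _ =>
      Finset.sum_congr rfl fun k _ => Finset.sum_congr rfl fun a _ => by ring
  simp_rw [l]
  rw [r, Finset.sum_comm]
  rw [Finset.sum_comm (s := Finset.univ) (t := Finset.univ)
    (f := fun k i => ∑ j, ∑ a, μ a * (U i a * U j a) * (U k c * T i j k))]
  refine Finset.sum_congr rfl fun i _ => ?_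
  rw [Finset.sum_comm]
  rw [Finset.sum_comm (s := Finset.univ) (t := Finset.univ)
    (f := fun k j => ∑ a, μ a * (U i a * U j a) * (U k c * T i j k))]
  refine Finset.sum_congr rfl fun j _ => ?_
  rw [Finset.sum_comm]

/-- The Jacobi inequality for a symmetric matrix `A` and a symmetric 3-tensor `T`. -/
lemma jacobi_form {n : ℕ} (hn : 2 ≤ n) (A : Fin n → Fin n → ℝ) (hA : ∀ i j, A i j = A j i)
    (T : Fin n → Fin n → Fin n → ℝ)
    (h1 : ∀ i j k, T i j k = T j i k) (h2 : ∀ i j k, T i j k = T i k j)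
    (L f K ε δ c : ℝ) (hL : 0 < L) (hAL : ∑ i, A i i = L)
    (hf : 2 * f = L ^ 2 - ∑ i, ∑ j, A i j ^ 2)
    (hK : 0 < K) (hfK : 1 / K ≤ f) (hε : 0 ≤ ε) (hε1 : ε ≤ 1) (hδ : 0 < δ)
    (hc : ∀ v : Fin n → ℝ, -c * L * ∑ i, v i ^ 2 ≤ ∑ i, ∑ j, v i * A i j * v j)
    (hc1 : c ≤ 1)
    (hp : ∀ x : ℝ, 0 ≤ x → x ≤ 1 + c → (1 + (1 + ε) * x)
        * (3 * ((n : ℝ) - 1) - 4 * (n - 1) * x + 2 * n * x ^ 2)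
      ≤ 3 * (n - 1 + 2 * x ^ 2)) :
    ∑ k, (∑ i, T i i k) ^ 2 + (1 + ε - δ) * linForm A (fun k => ∑ i, T i i k)
          (fun k => ∑ i, T i i k) / L
        - 625 * K / δ * ∑ k, (L * (∑ i, T i i k) - ∑ i, ∑ j, A i j * T i j k) ^ 2
      ≤ ∑ i, ∑ j, ∑ k, T i j k ^ 2 := by
  obtain ⟨U, lam, hU⟩ := exists_eigenFrame A hA
  set T' : Fin n → Fin n → Fin n → ℝ :=
    fun a b c => ∑ i, U i a * ∑ j, U j b * ∑ k, U k c * T i j k with hT'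
  have hlamc : ∀ a, -c * L ≤ lam a := by
    intro a
    have := hc (fun i => U i a)
    rw [hU.sum_quad] at this
    simp_rw [sq, hU.cols] at this
    simpa using this
  have ha : ∀ a, (L - lam a) / L ≤ 1 + c := by
    intro a
    rw [div_le_iff₀ hL]; nlinarith [hlamc a]
  have hT1 : ∀ a b c, T' a b c = T' b a c := by
    intro a b c
    simp only [hT']
    simp_rw [Finset.mul_sum]
    rw [Finset.sum_comm]
    exact Finset.sum_congr rfl fun i _ => Finset.sum_congr rfl fun j _ =>
      Finset.sum_congr rfl fun k _ => by rw [h1]; ring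
  have hT2 : ∀ a b c, T' a b c = T' a c b := by
    intro a b c
    simp only [hT']
    refine Finset.sum_congr rfl fun i _ => ?_
    congr 1
    simp_rw [Finset.mul_sum]
    rw [Finset.sum_comm]
    exact Finset.sum_congr rfl fun j _ =>
      Finset.sum_congr rfl fun k _ => by rw [h2]; ring
  have key := jacobi_diag hn lam T' hT1 hT2 L f K ε δ hL (by rw [hU.sum_lam, hAL])
    (by rw [← hU.sum_sq_eq, hf]) hK hfK hε hε1 hδ
    (fun i => by nlinarith [hlamc i]) (fun i hi => hp _ hi (ha i))
  rw [sum_rot_cube hU T] at key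
  have t1 : ∀ c, ∑ a, T' a a c = ∑ k, U k c * ∑ i, T i i k := by
    intro c
    have := rot_cube_contract (U := U) T (fun _ => 1) (fun i j => if i = j then 1 else 0)
      (by intro i j; simp [hU.rows]) c
    simpa using this
  have t2 : ∀ c, ∑ a, (L - lam a) * T' a a c
      = ∑ k, U k c * (L * (∑ i, T i i k) - ∑ i, ∑ j, A i j * T i j k) := by
    intro c
    rw [rot_cube_contract (U := U) T (fun a => L - lam a)
      (fun i j => (if i = j then L else 0) - A i j) ?_ c]
    · refine Finset.sum_congr rfl fun k _ => ?_
      congr 1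
      simp_rw [sub_mul, Finset.sum_sub_distrib]
      simp [Finset.mul_sum]
    · intro i j
      simp_rw [sub_mul]
      rw [Finset.sum_sub_distrib, ← hU.diag, ← Finset.mul_sum, hU.rows]; simp
  simp_rw [t2] at key
  rw [hU.sum_rot_sq] at key
  simp_rw [t1] at key
  rw [hU.sum_rot_sq] at key
  rw [hU.linForm_eq, hAL]
  simp_rw [← sq]
  exact key

/-- The algebraic setting: a symmetric matrix `A` with trace `L > 0` and `σ₂(A) = f ≥ 1 / K`. -/
structure SigmaTwoPos {n : ℕ} (A : Fin n → Fin n → ℝ) (L f K : ℝ) : Prop where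
  symm : ∀ i j, A i j = A j i
  trace : ∑ i, A i i = L
  sigma : 2 * f = L ^ 2 - ∑ i, ∑ j, A i j ^ 2
  posL : 0 < L
  posK : 0 < K
  lower : 1 / K ≤ f

namespace SigmaTwoPos

variable {n : ℕ} {A : Fin n → Fin n → ℝ} {L f K : ℝ}

lemma posf (h : SigmaTwoPos A L f K) : 0 < f :=
  lt_of_lt_of_le (one_div_pos.2 h.posK) h.lower

lemma one_le_mul (h : SigmaTwoPos A L f K) : 1 ≤ K * f := by
  have := h.lower
  rwa [div_le_iff₀ h.posK, mul_comm] at this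

lemma frame_sq (h : SigmaTwoPos A L f K) {U : Fin n → Fin n → ℝ} {lam : Fin n → ℝ}
    (hU : EigenFrame A U lam) : 2 * f = L ^ 2 - ∑ a, lam a ^ 2 := by
  rw [← hU.sum_sq_eq, h.sigma]

lemma frame_lower (h : SigmaTwoPos A L f K) {U : Fin n → Fin n → ℝ} {lam : Fin n → ℝ}
    (hU : EigenFrame A U lam) (a : Fin n) : f ≤ L * (L - lam a) := by
  have : lam a ^ 2 ≤ ∑ i, lam i ^ 2 :=
    Finset.single_le_sum (f := fun i => lam i ^ 2) (fun j _ => sq_nonneg _) (Finset.mem_univ a)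
  nlinarith [sq_nonneg (L - lam a), h.frame_sq hU]

lemma frame_pos (h : SigmaTwoPos A L f K) {U : Fin n → Fin n → ℝ} {lam : Fin n → ℝ}
    (hU : EigenFrame A U lam) (a : Fin n) : 0 < L - lam a :=
  pos_of_mul_pos_right (lt_of_lt_of_le h.posf (h.frame_lower hU a)) h.posL.le

lemma frame_le (h : SigmaTwoPos A L f K) {U : Fin n → Fin n → ℝ} {lam : Fin n → ℝ}
    (hU : EigenFrame A U lam) (a : Fin n) : L - lam a ≤ 2 * L := by
  have h1 : lam a ^ 2 ≤ ∑ i, lam i ^ 2 :=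
    Finset.single_le_sum (f := fun i => lam i ^ 2) (fun j _ => sq_nonneg _) (Finset.mem_univ a)
  have h2 : lam a ^ 2 ≤ L ^ 2 := by nlinarith [h.frame_sq hU, h.posf]
  have := abs_le_of_sq_le_sq' h2 h.posL.le
  linarith [this.1]

lemma linForm_frame (h : SigmaTwoPos A L f K) {U : Fin n → Fin n → ℝ} {lam : Fin n → ℝ}
    (hU : EigenFrame A U lam) (x y : Fin n → ℝ) :
    linForm A x y = ∑ a, (L - lam a) * ((∑ i, U i a * x i) * ∑ i, U i a * y i) := by
  rw [hU.linForm_eq, h.trace]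

lemma linForm_self_nonneg (h : SigmaTwoPos A L f K) (x : Fin n → ℝ) : 0 ≤ linForm A x x := by
  obtain ⟨U, lam, hU⟩ := exists_eigenFrame A h.symm
  rw [h.linForm_frame hU]
  exact Finset.sum_nonneg fun a _ => mul_nonneg (h.frame_pos hU a).le (mul_self_nonneg _)

lemma sum_sq_le_linForm (h : SigmaTwoPos A L f K) (x : Fin n → ℝ) :
    ∑ i, x i ^ 2 ≤ K * L * linForm A x x := by
  obtain ⟨U, lam, hU⟩ := exists_eigenFrame A h.symm
  rw [h.linForm_frame hU, ← hU.sum_rot_sq, Finset.mul_sum]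
  refine Finset.sum_le_sum fun a _ => ?_
  have h1 : 1 ≤ K * (L * (L - lam a)) :=
    h.one_le_mul.trans (mul_le_mul_of_nonneg_left (h.frame_lower hU a) h.posK.le)
  have := mul_le_mul_of_nonneg_right h1 (sq_nonneg (∑ i, U i a * x i))
  nlinarith

lemma linForm_self_le (h : SigmaTwoPos A L f K) (x : Fin n → ℝ) :
    linForm A x x ≤ 2 * L * ∑ i, x i ^ 2 := by
  obtain ⟨U, lam, hU⟩ := exists_eigenFrame A h.symm
  rw [h.linForm_frame hU, ← hU.sum_rot_sq, Finset.mul_sum]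
  refine Finset.sum_le_sum fun a _ => ?_
  rw [← sq]
  exact mul_le_mul_of_nonneg_right (h.frame_le hU a) (sq_nonneg _)

lemma linForm_sq_le (h : SigmaTwoPos A L f K) (x y : Fin n → ℝ) :
    linForm A x y ^ 2 ≤ linForm A x x * linForm A y y := by
  obtain ⟨U, lam, hU⟩ := exists_eigenFrame A h.symm
  simp_rw [h.linForm_frame hU]
  apply Finset.sum_sq_le_sum_mul_sum_of_sq_le_mul
  · exact fun a _ => mul_nonneg (h.frame_pos hU a).le (mul_self_nonneg _)
  · exact fun a _ => mul_nonneg (h.frame_pos hU a).le (mul_self_nonneg _)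
  · exact fun a _ => le_of_eq (by ring)

lemma linTrace_nonneg (h : SigmaTwoPos A L f K) : 0 ≤ linTrace A := by
  obtain ⟨U, lam, hU⟩ := exists_eigenFrame A h.symm
  rw [hU.linTrace_eq h.symm, h.trace]
  exact Finset.sum_nonneg fun a _ => mul_nonneg (h.frame_pos hU a).le (sq_nonneg _)

lemma linForm_mul_le (h : SigmaTwoPos A L f K) (w : Fin n → ℝ) :
    linForm A (fun i => ∑ j, A i j * w j) (fun i => ∑ j, A i j * w j)
      ≤ (∑ i, w i ^ 2) * linTrace A := by
  obtain ⟨U, lam, hU⟩ := exists_eigenFrame A h.symm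
  rw [hU.linTrace_eq h.symm, h.trace, h.linForm_frame hU, Finset.mul_sum]
  refine Finset.sum_le_sum fun a _ => ?_
  rw [hU.rot_mul, ← hU.sum_rot_sq]
  have : (∑ i, U i a * w i) ^ 2 ≤ ∑ a, (∑ i, U i a * w i) ^ 2 :=
    Finset.single_le_sum (f := fun a => (∑ i, U i a * w i) ^ 2) (fun j _ => sq_nonneg _)
      (Finset.mem_univ a)
  have := mul_le_mul_of_nonneg_right this
    (mul_nonneg (h.frame_pos hU a).le (sq_nonneg (lam a)))
  nlinarith

lemma abs_entry_le (h : SigmaTwoPos A L f K) (i j : Fin n) : |A i j| ≤ L := by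
  apply abs_le_of_sq_le_sq _ h.posL.le
  have h1 : A i j ^ 2 ≤ ∑ j, A i j ^ 2 :=
    Finset.single_le_sum (f := fun j => A i j ^ 2) (fun j _ => sq_nonneg _) (Finset.mem_univ j)
  have h2 : ∑ j, A i j ^ 2 ≤ ∑ i, ∑ j, A i j ^ 2 :=
    Finset.single_le_sum (f := fun i => ∑ j, A i j ^ 2)
      (fun j _ => Finset.sum_nonneg fun _ _ => sq_nonneg _) (Finset.mem_univ i)
  nlinarith [h.sigma, h.posf]

lemma lagrange_le {a x : Fin n → ℝ} {j m : Fin n} (hjm : m ≠ j) :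
    (x m * a j - x j * a m) ^ 2 ≤ (∑ i, a i ^ 2) * (∑ i, x i ^ 2) - (∑ i, a i * x i) ^ 2 := by
  have e : 2 * ((∑ i, a i ^ 2) * (∑ i, x i ^ 2) - (∑ i, a i * x i) ^ 2)
      = ∑ p, ∑ q, (x p * a q - x q * a p) ^ 2 := by
    have : ∀ p q, (x p * a q - x q * a p) ^ 2
        = x p ^ 2 * a q ^ 2 - 2 * ((a p * x p) * (a q * x q)) + a p ^ 2 * x q ^ 2 :=
      fun p q => by ring
    simp_rw [this, Finset.sum_add_distrib, Finset.sum_sub_distrib, ← Finset.mul_sum,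
      ← Finset.sum_mul]
    ring
  have h1 : ∀ p, ∀ q, (x p * a q - x q * a p) ^ 2 ≤ ∑ q, (x p * a q - x q * a p) ^ 2 := fun p q =>
    Finset.single_le_sum (f := fun q => (x p * a q - x q * a p) ^ 2) (fun j _ => sq_nonneg _)
      (Finset.mem_univ q)
  have h2 : ∑ q, (x m * a q - x q * a m) ^ 2 + ∑ q, (x j * a q - x q * a j) ^ 2
      ≤ ∑ p, ∑ q, (x p * a q - x q * a p) ^ 2 := by
    rw [← Finset.sum_pair (f := fun p => ∑ q, (x p * a q - x q * a p) ^ 2) hjm]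
    exact Finset.sum_le_sum_of_subset_of_nonneg (Finset.subset_univ _)
      fun p _ _ => Finset.sum_nonneg fun _ _ => sq_nonneg _
  nlinarith [h1 m j, h1 j m]

lemma minor_sq_le (h : SigmaTwoPos A L f K) (x : Fin n → ℝ) {j m : Fin n} (hjm : m ≠ j) :
    (x m * A j j - x j * A j m) ^ 2 ≤ 2 * L * linForm A x x := by
  obtain ⟨U, lam, hU⟩ := exists_eigenFrame A h.symm
  have h1 : (∑ i, ∑ j, A i j ^ 2) * (∑ i, x i ^ 2) - ∑ i, (∑ j, A i j * x j) ^ 2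
      ≤ 2 * L * linForm A x x := by
    rw [h.linForm_frame hU, hU.sum_sq_eq, ← hU.sum_rot_sq x,
      ← hU.sum_rot_sq (fun i => ∑ j, A i j * x j), Finset.mul_sum, Finset.mul_sum,
      ← Finset.sum_sub_distrib]
    refine Finset.sum_le_sum fun a _ => ?_
    rw [hU.rot_mul]
    have h3 : ∑ a, lam a ^ 2 - lam a ^ 2 ≤ 2 * L * (L - lam a) := by
      nlinarith [h.frame_sq hU, h.posf, sq_nonneg (L - lam a)]
    have := mul_le_mul_of_nonneg_right h3 (sq_nonneg (∑ i, U i a * x i))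
    nlinarith
  refine le_trans ?_ h1
  rw [Finset.sum_mul, ← Finset.sum_sub_distrib]
  refine (lagrange_le (a := A j) hjm).trans ?_
  refine Finset.single_le_sum (f := fun i => (∑ j, A i j ^ 2) * (∑ i, x i ^ 2)
    - (∑ j, A i j * x j) ^ 2) (fun i _ => ?_) (Finset.mem_univ j)
  exact sub_nonneg.2 (Finset.sum_mul_sq_le_sq_mul_sq _ _ _)

lemma linForm_eq_sum (A : Fin n → Fin n → ℝ) (x y : Fin n → ℝ) :
    linForm A x y = ∑ i, ∑ j, (A j j * (x i * y i) - x i * A i j * y j) := by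
  simp only [linForm, Finset.mul_sum, Finset.sum_mul, ← Finset.sum_sub_distrib]

lemma linForm_smul_sub (A : Fin n → Fin n → ℝ) (s t : ℝ) (x y : Fin n → ℝ) :
    linForm A (fun i => s * x i + t * y i) (fun i => s * x i + t * y i)
      = s ^ 2 * linForm A x x + s * t * linForm A x y + s * t * linForm A y x
        + t ^ 2 * linForm A y y := by
  simp only [linForm_eq_sum, Finset.mul_sum, ← Finset.sum_add_distrib]
  exact Finset.sum_congr rfl fun i _ => Finset.sum_congr rfl fun j _ => by ring

lemma linForm_comm (h : SigmaTwoPos A L f K) (x y : Fin n → ℝ) :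
    linForm A x y = linForm A y x := by
  obtain ⟨U, lam, hU⟩ := exists_eigenFrame A h.symm
  simp_rw [h.linForm_frame hU]
  exact Finset.sum_congr rfl fun a _ => by ring

/-- Parallelogram-type bound for the quadratic form. -/
lemma linForm_add_le (h : SigmaTwoPos A L f K) (s t : ℝ) (x y : Fin n → ℝ) :
    linForm A (fun i => s * x i + t * y i) (fun i => s * x i + t * y i)
      ≤ 2 * s ^ 2 * linForm A x x + 2 * t ^ 2 * linForm A y y := by
  have h1 := h.linForm_self_nonneg (fun i => s * x i + (-t) * y i)
  rw [linForm_smul_sub] at h1 ⊢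
  rw [h.linForm_comm y x] at *
  nlinarith

lemma linForm_smul (A : Fin n → Fin n → ℝ) (s : ℝ) (x : Fin n → ℝ) :
    linForm A (fun i => s * x i) (fun i => s * x i) = s ^ 2 * linForm A x x := by
  have := linForm_smul_sub A s 0 x x
  simpa using this

end SigmaTwoPos

/-- The Jacobi inequality for `log Λ`, with the gradient `df` of the right-hand side absorbed. -/
lemma jacobi_log {n : ℕ} (hn : 2 ≤ n) {A : Fin n → Fin n → ℝ} {L f K : ℝ}
    (h : SigmaTwoPos A L f K) (T : Fin n → Fin n → Fin n → ℝ)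
    (h1 : ∀ i j k, T i j k = T j i k) (h2 : ∀ i j k, T i j k = T i k j)
    (ε δ c Cf : ℝ) (hε : 0 ≤ ε) (hε1 : ε ≤ 1) (hδ : 0 < δ)
    (hc : ∀ v : Fin n → ℝ, -c * L * ∑ i, v i ^ 2 ≤ ∑ i, ∑ j, v i * A i j * v j)
    (hc1 : c ≤ 1)
    (hp : ∀ x : ℝ, 0 ≤ x → x ≤ 1 + c → (1 + (1 + ε) * x)
        * (3 * ((n : ℝ) - 1) - 4 * (n - 1) * x + 2 * n * x ^ 2)
      ≤ 3 * (n - 1 + 2 * x ^ 2))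
    (τ df : Fin n → ℝ) (hτ : ∀ k, τ k = ∑ i, T i i k)
    (hdf : ∀ k, df k = L * τ k - ∑ i, ∑ j, A i j * T i j k)
    (hCf : ∑ k, df k ^ 2 ≤ Cf ^ 2 * L ^ 2) :
    (ε - δ) * (linForm A τ τ / L ^ 2) - 1251 * K * Cf ^ 2 / δ * L
      ≤ ((∑ i, ∑ j, ∑ k, T i j k ^ 2) - ∑ k, τ k ^ 2) / L - linForm A τ τ / L ^ 2
        + (∑ k, df k * τ k) / L ^ 2 := by
  have hL := h.posL
  have hK := h.posK
  have key := jacobi_form hn A h.symm T h1 h2 L f K ε (δ / 2) c hL h.trace h.sigma hK h.lower hε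
    hε1 (by positivity) hc hc1 hp
  simp_rw [← hτ, ← hdf] at key
  set Q := linForm A τ τ with hQ
  have hQ0 : 0 ≤ Q := h.linForm_self_nonneg τ
  set D := ∑ k, df k * τ k with hD
  have hD2 : D ^ 2 ≤ (Cf ^ 2 * L ^ 2) * (K * L * Q) := by
    calc D ^ 2 ≤ (∑ k, df k ^ 2) * ∑ k, τ k ^ 2 := Finset.sum_mul_sq_le_sq_mul_sq _ _ _
      _ ≤ _ := mul_le_mul hCf (h.sum_sq_le_linForm τ)
        (Finset.sum_nonneg fun _ _ => sq_nonneg _) (by positivity)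
  have hD3 : -D ≤ δ / 2 * Q + Cf ^ 2 * K * L ^ 3 / (2 * δ) := by
    have hY : 0 ≤ δ / 2 * Q + Cf ^ 2 * K * L ^ 3 / (2 * δ) := by positivity
    refine le_trans (neg_le_abs D) (abs_le_of_sq_le_sq (hD2.trans ?_) hY)
    have e : (δ / 2 * Q + Cf ^ 2 * K * L ^ 3 / (2 * δ)) ^ 2 - (Cf ^ 2 * L ^ 2) * (K * L * Q)
        = (δ / 2 * Q - Cf ^ 2 * K * L ^ 3 / (2 * δ)) ^ 2 := by field_simp; ring
    nlinarith [sq_nonneg (δ / 2 * Q - Cf ^ 2 * K * L ^ 3 / (2 * δ))]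
  have hJ : 625 * K / (δ / 2) * ∑ k, df k ^ 2 ≤ 625 * K / (δ / 2) * (Cf ^ 2 * L ^ 2) :=
    mul_le_mul_of_nonneg_left hCf (by positivity)
  set W := (∑ i, ∑ j, ∑ k, T i j k ^ 2) - ∑ k, τ k ^ 2 with hW
  have hW2 : (1 + ε - δ / 2) * Q / L - 1250 * K / δ * (Cf ^ 2 * L ^ 2) ≤ W := by
    have : 625 * K / (δ / 2) = 1250 * K / δ := by field_simp; norm_num
    rw [this] at hJ key
    linarith
  have e : W / L - Q / L ^ 2 + D / L ^ 2 - ((ε - δ) * (Q / L ^ 2) - 1251 * K * Cf ^ 2 / δ * L)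
      = ((W - ((1 + ε - δ / 2) * Q / L - 1250 * K / δ * (Cf ^ 2 * L ^ 2))) * L
        + (D + (δ / 2 * Q + Cf ^ 2 * K * L ^ 3 / (2 * δ)))
          + Cf ^ 2 * K * L ^ 3 / (2 * δ)) / L ^ 2 := by
    field_simp; ring
  have : 0 ≤ W / L - Q / L ^ 2 + D / L ^ 2
      - ((ε - δ) * (Q / L ^ 2) - 1251 * K * Cf ^ 2 / δ * L) := by
    rw [e]
    apply div_nonneg _ (by positivity)
    have a1 : 0 ≤ (W - ((1 + ε - δ / 2) * Q / L - 1250 * K / δ * (Cf ^ 2 * L ^ 2))) * L :=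
      mul_nonneg (by linarith) hL.le
    have a2 : 0 ≤ Cf ^ 2 * K * L ^ 3 / (2 * δ) := by positivity
    linarith
  linarith

set_option maxHeartbeats 4000000 in
/-- If `linTrace A` is small compared to the trace, then one eigenvalue of `A` dominates, and the
field `-4 (1 - g) z + ρ A w` is uniformly noncharacteristic. -/
lemma concentrated_spectrum {n : ℕ} (hn : 2 ≤ n) {A : Fin n → Fin n → ℝ} {L f K : ℝ}
    (h : SigmaTwoPos A L f K) {r α β C3 ρ g ω M L0 c : ℝ} {z p w : Fin n → ℝ}
    (hr : 0 < r) (hα : 0 < α) (hβ : 0 < β) (hM : 0 ≤ M) (hC3 : 0 ≤ C3) (hL0 : 0 < L0)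
    (hz : r ^ 2 ≤ ∑ i, z i ^ 2) (hz2 : ∑ i, z i ^ 2 ≤ 1 / 4)
    (hw : ∀ i, w i = α * z i + β * p i) (hp : ∑ i, p i ^ 2 ≤ M ^ 2)
    (hwω : ∑ i, w i ^ 2 ≤ ω ^ 2) (hω : 64 * C3 * ω ^ 2 ≤ β * r ^ 2) (hβM : 4 * (β * M) ≤ α * r)
    (hρ : 0 < ρ) (hρ4 : ρ ≤ 1 / 4) (hg : |g| ≤ 1 / 2)
    (hS : β * ρ ^ 2 * linTrace A ≤ C3 * L) (hLρ : L0 ≤ L * ρ)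
    (h1 : 400 * C3 ≤ β * L0 ^ 2) (h2 : 4 * n ^ 2 * C3 < β * L0 ^ 2) (h3 : 48 ≤ α * r * L0)
    (hc1 : c ≤ r ^ 2) (hc2 : 64 * K * c ≤ α ^ 2 * r ^ 2) :
    (∀ v : Fin n → ℝ, -(1 / 10) * L * ∑ i, v i ^ 2 ≤ ∑ i, ∑ j, v i * A i j * v j) ∧
    c * ρ ^ 2 * L ≤ linForm A (fun i => (-4 * (1 - g)) * z i + ρ * ∑ j, A i j * w j)
      (fun i => (-4 * (1 - g)) * z i + ρ * ∑ j, A i j * w j) := by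
  obtain ⟨U, lam, hU⟩ := exists_eigenFrame A h.symm
  have hL := h.posL
  have hK := h.posK
  have hn' : (2 : ℝ) ≤ n := by exact_mod_cast hn
  have hT : linTrace A = ∑ a, (L - lam a) * lam a ^ 2 := by
    rw [hU.linTrace_eq h.symm, h.trace]
  have hsum : ∑ a, lam a = L := by rw [hU.sum_lam, h.trace]
  have hβρ : 0 < β * ρ ^ 2 := by positivity
  have hLL : β * L0 ^ 2 ≤ β * ρ ^ 2 * L ^ 2 := by
    have : L0 ^ 2 ≤ (L * ρ) ^ 2 := by gcongr
    calc β * L0 ^ 2 ≤ β * (L * ρ) ^ 2 := mul_le_mul_of_nonneg_left this hβ.le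
      _ = _ := by ring
  have small : ∀ a, lam a ≤ 3 / 4 * L → β * ρ ^ 2 * lam a ^ 2 ≤ 4 * C3 := by
    intro a ha
    have e1 : (L - lam a) * lam a ^ 2 ≤ linTrace A := by
      rw [hT]
      exact Finset.single_le_sum (f := fun a => (L - lam a) * lam a ^ 2)
        (fun a _ => mul_nonneg (h.frame_pos hU a).le (sq_nonneg _)) (Finset.mem_univ a)
    have e2 : L * lam a ^ 2 ≤ 4 * linTrace A := by
      have := mul_le_mul_of_nonneg_right (by linarith : L / 4 ≤ L - lam a) (sq_nonneg (lam a))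
      linarith
    have e3 : L * (β * ρ ^ 2 * lam a ^ 2) ≤ L * (4 * C3) := by
      linarith [mul_le_mul_of_nonneg_left e2 hβρ.le]
    exact le_of_mul_le_mul_left e3 hL
  have small1 : ∀ a, lam a ≤ 3 / 4 * L → lam a ^ 2 ≤ (L / 10) ^ 2 := by
    intro a ha
    have : β * ρ ^ 2 * lam a ^ 2 ≤ β * ρ ^ 2 * (L / 10) ^ 2 := by
      linarith [small a ha]
    exact le_of_mul_le_mul_left this hβρ
  have small2 : ∀ a, lam a ≤ 3 / 4 * L → n * lam a < L := by
    intro a ha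
    have e : β * ρ ^ 2 * (n * lam a) ^ 2 < β * ρ ^ 2 * L ^ 2 := by
      have := mul_le_mul_of_nonneg_left (small a ha) (sq_nonneg (n : ℝ))
      linarith
    have := lt_of_mul_lt_mul_left e hβρ.le
    exact lt_of_pow_lt_pow_left₀ 2 hL.le this
  obtain ⟨a1, ha1⟩ : ∃ a1, 3 / 4 * L < lam a1 := by
    by_contra hcon
    push Not at hcon
    have hne : (Finset.univ : Finset (Fin n)).Nonempty := ⟨⟨0, by omega⟩, Finset.mem_univ _⟩
    have : ∑ a, n * lam a < ∑ _a : Fin n, L :=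
      Finset.sum_lt_sum_of_nonempty hne fun a _ => small2 a (hcon a)
    rw [← Finset.mul_sum, hsum] at this
    simp at this
  have hother : ∀ a, a ≠ a1 → lam a ≤ 3 / 4 * L := by
    intro a ha
    by_contra hcon
    push Not at hcon
    have e : lam a ^ 2 + lam a1 ^ 2 ≤ ∑ a, lam a ^ 2 := by
      rw [← Finset.sum_pair (f := fun a => lam a ^ 2) ha]
      exact Finset.sum_le_sum_of_subset_of_nonneg (Finset.subset_univ _)
        fun p _ _ => sq_nonneg _
    have q1 := pow_lt_pow_left₀ ha1 (by positivity) two_ne_zero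
    have q2 := pow_lt_pow_left₀ hcon (by positivity) two_ne_zero
    have := sq_nonneg L
    linarith [h.frame_sq hU, h.posf]
  constructor
  · intro v
    rw [hU.sum_quad, ← hU.sum_rot_sq v, Finset.mul_sum]
    refine Finset.sum_le_sum fun a _ => ?_
    have : -(1 / 10) * L ≤ lam a := by
      by_cases ha : lam a ≤ 3 / 4 * L
      · have := abs_le_of_sq_le_sq' (small1 a ha) (by positivity)
        linarith [this.1]
      · push Not at ha; linarith
    rw [← sq]
    exact mul_le_mul_of_nonneg_right this (sq_nonneg _)
  · rw [h.linForm_frame hU]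
    set z' : Fin n → ℝ := fun a => ∑ i, U i a * z i with hz'
    set w' : Fin n → ℝ := fun a => ∑ i, U i a * w i with hw'
    set p' : Fin n → ℝ := fun a => ∑ i, U i a * p i with hp'
    have hξ : ∀ a, ∑ i, U i a * ((-4 * (1 - g)) * z i + ρ * ∑ j, A i j * w j)
        = -4 * (1 - g) * z' a + ρ * (lam a * w' a) := by
      intro a
      rw [hw', ← hU.rot_mul, hz']
      simp only [mul_add, Finset.sum_add_distrib, Finset.mul_sum]
      congr 1
      · exact Finset.sum_congr rfl fun i _ => by ring
      · exact Finset.sum_congr rfl fun i _ => Finset.sum_congr rfl fun j _ => by ring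
    simp_rw [hξ]
    have hzz : ∑ a, z' a ^ 2 = ∑ i, z i ^ 2 := hU.sum_rot_sq z
    have hww : ∑ a, w' a ^ 2 = ∑ i, w i ^ 2 := hU.sum_rot_sq w
    have hpp : ∑ a, p' a ^ 2 = ∑ i, p i ^ 2 := hU.sum_rot_sq p
    have hnn : ∀ a ∈ Finset.univ, 0 ≤ (L - lam a) * ((-4 * (1 - g) * z' a + ρ * (lam a * w' a))
        * (-4 * (1 - g) * z' a + ρ * (lam a * w' a))) := fun a _ =>
      mul_nonneg (h.frame_pos hU a).le (mul_self_nonneg _)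
    have hg1 := abs_le.1 hg
    by_cases hZ : r ^ 2 / 4 ≤ ∑ a ∈ Finset.univ.erase a1, z' a ^ 2
    · refine le_trans ?_ (Finset.sum_le_sum_of_subset_of_nonneg
        (Finset.erase_subset a1 Finset.univ) fun a ha _ => hnn a ha)
      have e1 : ∀ a ∈ Finset.univ.erase a1, L / 4 * (2 * z' a ^ 2 - 4 * C3 / β * w' a ^ 2)
          ≤ (L - lam a) * ((-4 * (1 - g) * z' a + ρ * (lam a * w' a))
            * (-4 * (1 - g) * z' a + ρ * (lam a * w' a))) := by
        intro a ha
        have ha := hother a (Finset.ne_of_mem_erase ha)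
        have e2 : ρ ^ 2 * lam a ^ 2 ≤ 4 * C3 / β := by
          rw [le_div_iff₀ hβ]; linarith [small a ha]
        have e3 : 2 * z' a ^ 2 - 4 * C3 / β * w' a ^ 2 ≤
            (-4 * (1 - g) * z' a + ρ * (lam a * w' a))
            * (-4 * (1 - g) * z' a + ρ * (lam a * w' a)) := by
          have e4 := mul_le_mul_of_nonneg_right e2 (sq_nonneg (w' a))
          have e5 : 2 * z' a ^ 2 ≤ 8 * (1 - g) ^ 2 * z' a ^ 2 := by
            apply mul_le_mul_of_nonneg_right _ (sq_nonneg _)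
            have := pow_le_pow_left₀ (by norm_num) (by linarith : (1 : ℝ) / 2 ≤ 1 - g) 2
            linarith
          linarith [sq_nonneg (-4 * (1 - g) * z' a + 2 * (ρ * (lam a * w' a)))]
        have e6 := mul_le_mul_of_nonneg_left e3 (by positivity : 0 ≤ L / 4)
        have e7 : L / 4 * ((-4 * (1 - g) * z' a + ρ * (lam a * w' a))
            * (-4 * (1 - g) * z' a + ρ * (lam a * w' a)))
            ≤ (L - lam a) * ((-4 * (1 - g) * z' a + ρ * (lam a * w' a))
            * (-4 * (1 - g) * z' a + ρ * (lam a * w' a))) :=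
          mul_le_mul_of_nonneg_right (by linarith) (mul_self_nonneg _)
        linarith
      refine le_trans ?_ (Finset.sum_le_sum e1)
      rw [← Finset.mul_sum, Finset.sum_sub_distrib, ← Finset.mul_sum, ← Finset.mul_sum]
      have e8 : ∑ a ∈ Finset.univ.erase a1, w' a ^ 2 ≤ ω ^ 2 := by
        refine le_trans (Finset.sum_le_sum_of_subset_of_nonneg
          (Finset.erase_subset a1 Finset.univ) fun a ha _ => sq_nonneg _) ?_
        rw [hww]; exact hwω
      have e9 : 4 * C3 / β * ∑ a ∈ Finset.univ.erase a1, w' a ^ 2 ≤ r ^ 2 / 16 := by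
        refine le_trans (mul_le_mul_of_nonneg_left e8 (by positivity)) ?_
        rw [div_mul_eq_mul_div, div_le_iff₀ hβ]; linarith
      have e10 : c * ρ ^ 2 ≤ r ^ 2 * (1 / 16) := by
        have : ρ ^ 2 ≤ 1 / 16 := by
          have := pow_le_pow_left₀ hρ.le hρ4 2
          linarith
        calc c * ρ ^ 2 ≤ r ^ 2 * ρ ^ 2 := mul_le_mul_of_nonneg_right hc1 (sq_nonneg _)
          _ ≤ _ := mul_le_mul_of_nonneg_left this (sq_nonneg _)
      calc c * ρ ^ 2 * L ≤ r ^ 2 * (1 / 16) * L := mul_le_mul_of_nonneg_right e10 hL.le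
        _ = L / 4 * (r ^ 2 / 4) := by ring
        _ ≤ _ := by
          apply mul_le_mul_of_nonneg_left _ (by positivity)
          have := sq_nonneg r
          linarith
    · push Not at hZ
      have e1 : z' a1 ^ 2 + ∑ a ∈ Finset.univ.erase a1, z' a ^ 2 = ∑ i, z i ^ 2 := by
        rw [← hzz]; exact Finset.add_sum_erase _ (fun a => z' a ^ 2) (Finset.mem_univ a1)
      have e2 : r / 2 ≤ |z' a1| := by
        apply le_of_sq_le_sq _ (abs_nonneg _)
        rw [sq_abs]; have := sq_nonneg r; linarith
      have e2' : |z' a1| ≤ 1 / 2 := by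
        apply abs_le_of_sq_le_sq _ (by norm_num)
        have : 0 ≤ ∑ a ∈ Finset.univ.erase a1, z' a ^ 2 :=
          Finset.sum_nonneg fun _ _ => sq_nonneg _
        linarith
      have e3 : |p' a1| ≤ M := by
        apply abs_le_of_sq_le_sq _ hM
        refine le_trans ?_ hp
        rw [← hpp]
        exact Finset.single_le_sum (f := fun a => p' a ^ 2) (fun _ _ => sq_nonneg _)
          (Finset.mem_univ a1)
      have e4 : w' a1 = α * z' a1 + β * p' a1 := by
        simp only [hw', hz', hp', hw, mul_add, Finset.sum_add_distrib, Finset.mul_sum]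
        congr 1 <;> exact Finset.sum_congr rfl fun i _ => by ring
      have e5 : α * r / 4 ≤ |w' a1| := by
        have : |α * z' a1| ≤ |w' a1| + |β * p' a1| := by
          have := abs_sub (w' a1) (β * p' a1)
          rwa [e4, add_sub_cancel_right, ← e4] at this
        rw [abs_mul, abs_mul, abs_of_pos hα, abs_of_pos hβ] at this
        linarith [mul_le_mul_of_nonneg_left e2 hα.le, mul_le_mul_of_nonneg_left e3 hβ.le]
      have e6 : α * r * (L * ρ) / 8 ≤ |-4 * (1 - g) * z' a1 + ρ * (lam a1 * w' a1)| := by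
        have b1 : |ρ * (lam a1 * w' a1)| ≤ |-4 * (1 - g) * z' a1 + ρ * (lam a1 * w' a1)|
            + |-4 * (1 - g) * z' a1| := by
          have := abs_sub (-4 * (1 - g) * z' a1 + ρ * (lam a1 * w' a1)) (-4 * (1 - g) * z' a1)
          rwa [add_sub_cancel_left] at this
        have b2 : |-4 * (1 - g) * z' a1| ≤ 3 := by
          rw [abs_mul]
          have : |-4 * (1 - g)| ≤ 6 := by rw [abs_le]; constructor <;> linarith
          calc _ ≤ 6 * (1 / 2) := mul_le_mul this e2' (abs_nonneg _) (by norm_num)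
            _ = 3 := by norm_num
        have hl1 : 0 < lam a1 := by linarith
        have b3 : ρ * (3 / 4 * L * (α * r / 4)) ≤ |ρ * (lam a1 * w' a1)| := by
          rw [abs_mul, abs_mul, abs_of_pos hρ, abs_of_pos hl1]
          apply mul_le_mul_of_nonneg_left _ hρ.le
          exact mul_le_mul ha1.le e5 (by positivity) hl1.le
        have b4 : α * r * L0 ≤ α * r * (L * ρ) := mul_le_mul_of_nonneg_left hLρ (by positivity)
        linarith
      refine le_trans ?_ (Finset.single_le_sum hnn (Finset.mem_univ a1))
      have e7 : (α * r * (L * ρ) / 8) ^ 2 ≤ (-4 * (1 - g) * z' a1 + ρ * (lam a1 * w' a1))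
            * (-4 * (1 - g) * z' a1 + ρ * (lam a1 * w' a1)) := by
        rw [← sq, ← sq_abs (-4 * (1 - g) * z' a1 + ρ * (lam a1 * w' a1))]
        exact pow_le_pow_left₀ (by positivity) e6 2
      refine le_trans ?_ (mul_le_mul_of_nonneg_left e7 (h.frame_pos hU a1).le)
      have e8 : 1 ≤ K * (L * (L - lam a1)) :=
        h.one_le_mul.trans (mul_le_mul_of_nonneg_left (h.frame_lower hU a1) hK.le)
      have e9 : 64 * K * (c * ρ ^ 2 * L) ≤
          64 * K * ((L - lam a1) * (α * r * (L * ρ) / 8) ^ 2) := by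
        calc 64 * K * (c * ρ ^ 2 * L) = (64 * K * c) * (ρ ^ 2 * L) := by ring
          _ ≤ (α ^ 2 * r ^ 2) * (ρ ^ 2 * L) := mul_le_mul_of_nonneg_right hc2 (by positivity)
          _ = 1 * (α ^ 2 * r ^ 2 * (ρ ^ 2 * L)) := by ring
          _ ≤ K * (L * (L - lam a1)) * (α ^ 2 * r ^ 2 * (ρ ^ 2 * L)) :=
            mul_le_mul_of_nonneg_right e8 (by positivity)
          _ = _ := by ring
      exact le_of_mul_le_mul_left e9 (by positivity)

/-- The drift produced by the barrier `-ρ⁻² (1 - g)`, in scalar form; here `s = ρ⁻¹`. -/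
lemma barrier_lower {n α β s L f S FZ X D g ω Cf : ℝ} (hn : 2 ≤ n) (hα : 0 ≤ α) (hβ : 0 ≤ β)
    (hs : 4 ≤ s) (hL : 0 ≤ L) (hf : 0 ≤ f) (hS : 0 ≤ S) (hFZ0 : 0 ≤ FZ) (hFZ : FZ ≤ L / 2)
    (hX : X ^ 2 ≤ FZ * (ω ^ 2 * S)) (hω : 64 * ω ^ 2 ≤ β) (hD : |D| ≤ Cf * L)
    (hg : |g| ≤ 1 / 2) (hCf : 0 ≤ Cf) :
    3 / 4 * β * s ^ 2 * S - (2 * n + 19 + Cf) * s ^ 4 * L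
      ≤ -24 * s ^ 4 * (1 - g) * FZ + 8 * s ^ 3 * X - 4 * (1 - g) * s ^ 3 * (n - 1) * L
        + s ^ 2 * (D + 2 * α * f + β * S) := by
  have hg1 := abs_le.1 hg
  have hs0 : 0 < s := by linarith
  have a1 : 24 * s ^ 4 * (1 - g) * FZ ≤ 18 * s ^ 4 * L := by
    calc 24 * s ^ 4 * (1 - g) * FZ ≤ 24 * s ^ 4 * (3 / 2) * (L / 2) := by
          gcongr
          linarith
      _ = _ := by ring
  have a2 : -(8 * s ^ 3 * X) ≤ 1 / 4 * β * s ^ 2 * S + 1 / 2 * s ^ 4 * L := by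
    refine le_trans (neg_le_abs _) (abs_le_of_sq_le_sq ?_ (by positivity))
    have b1 : (8 * s ^ 3 * X) ^ 2 ≤ s ^ 6 * (L / 2 * (β * S)) := by
      calc (8 * s ^ 3 * X) ^ 2 = 64 * s ^ 6 * X ^ 2 := by ring
        _ ≤ 64 * s ^ 6 * (FZ * (ω ^ 2 * S)) := mul_le_mul_of_nonneg_left hX (by positivity)
        _ = s ^ 6 * (FZ * (64 * ω ^ 2 * S)) := by ring
        _ ≤ _ := by gcongr
    have b2 := sq_nonneg (1 / 4 * β * s ^ 2 * S - 1 / 2 * s ^ 4 * L)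
    linarith
  have a3 : 4 * (1 - g) * s ^ 3 * (n - 1) * L ≤ 2 * n * s ^ 4 * L := by
    have b1 : s ^ 3 ≤ s ^ 4 / 4 := by
      have : s ^ 4 = s ^ 3 * s := by ring
      rw [this]
      have := mul_le_mul_of_nonneg_left hs (by positivity : 0 ≤ s ^ 3)
      linarith
    calc 4 * (1 - g) * s ^ 3 * (n - 1) * L ≤ 4 * (3 / 2) * (s ^ 4 / 4) * n * L := by
          gcongr
          · linarith
          · linarith
          · linarith
      _ = 3 / 2 * (n * s ^ 4 * L) := by ring
      _ ≤ 2 * (n * s ^ 4 * L) := by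
          apply mul_le_mul_of_nonneg_right (by norm_num)
          have : 0 ≤ n := by linarith
          positivity
      _ = _ := by ring
  have a4 : -(Cf * s ^ 4 * L) ≤ s ^ 2 * D := by
    have b1 : s ^ 2 ≤ s ^ 4 := by
      apply pow_le_pow_right₀ _ (by norm_num)
      linarith
    have b2 := neg_le_of_abs_le hD
    have b3 : -(s ^ 2 * (Cf * L)) ≤ s ^ 2 * D := by
      have := mul_le_mul_of_nonneg_left b2 (sq_nonneg s)
      linarith
    have b4 := mul_le_mul_of_nonneg_right b1 (by positivity : 0 ≤ Cf * L)
    linarith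
  have a5 : 0 ≤ s ^ 2 * (2 * α * f) := by positivity
  have a6 : 0 ≤ s ^ 4 * L := by positivity
  linarith

set_option maxHeartbeats 4000000 in
/-- The differential inequality in algebraic form: the divergence of the flux of
`P = log Λ - N ρ⁻² (1 - g)` is bounded below. -/
lemma exists_pointwise_bound {n : ℕ} (hn : 2 ≤ n) {K M Cf : ℝ} (hK : 0 < K) (hM : 0 ≤ M)
    (hCf : 0 ≤ Cf) :
    ∃ α β L0 N1 : ℝ, 0 < α ∧ 0 < β ∧ 0 < L0 ∧ 1 ≤ N1 ∧ α * (3 / 2 * M) + β * M ^ 2 / 2 ≤ 1 / 2 ∧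
      ∀ N : ℝ, N1 ≤ N → ∀ (A : Fin n → Fin n → ℝ) (L f : ℝ), SigmaTwoPos A L f K →
      ∀ (T : Fin n → Fin n → Fin n → ℝ), (∀ i j k, T i j k = T j i k) →
      (∀ i j k, T i j k = T i k j) → ∀ (z p w τ df ξ : Fin n → ℝ) (g ρ : ℝ),
      (∀ v : Fin n → ℝ, -((Real.sqrt (3 * (n : ℝ) ^ 2 + 1) - n + 1) / (2 * n)) * L * ∑ i, v i ^ 2
        ≤ ∑ i, ∑ j, v i * A i j * v j) →
      (∀ k, τ k = ∑ i, T i i k) →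
      (∀ k, df k = L * τ k - ∑ i, ∑ j, A i j * T i j k) →
      ∑ k, df k ^ 2 ≤ Cf ^ 2 * L ^ 2 →
      (∀ i, w i = α * z i + β * p i) →
      (∀ i, ξ i = (-4 * (1 - g)) * z i + ρ * ∑ j, A i j * w j) →
      |g| ≤ 1 / 2 → ∑ i, p i ^ 2 ≤ M ^ 2 → (1 / 8) ^ 2 ≤ ∑ i, z i ^ 2 → ∑ i, z i ^ 2 ≤ 1 / 4 →
      0 < ρ → ρ ≤ 1 / 4 → L0 ≤ L * ρ →
      N * L ≤ (((∑ i, ∑ j, ∑ k, T i j k ^ 2) - ∑ k, τ k ^ 2) / L - linForm A τ τ / L ^ 2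
          + (∑ k, df k * τ k) / L ^ 2)
        + N * (-24 * (ρ⁻¹) ^ 4 * (1 - g) * linForm A z z
          + 8 * (ρ⁻¹) ^ 3 * linForm A z (fun i => ∑ j, A i j * w j)
          - 4 * (1 - g) * (ρ⁻¹) ^ 3 * (n - 1) * L
          + (ρ⁻¹) ^ 2 * ((∑ k, df k * w k) + 2 * α * f + β * linTrace A))
        + 1 / 4 * linForm A (fun i => τ i / L + N * ((ρ⁻¹) ^ 3 * ξ i))
          (fun i => τ i / L + N * ((ρ⁻¹) ^ 3 * ξ i)) := by
  have hn' : (2 : ℝ) ≤ n := by exact_mod_cast hn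
  set CJ : ℝ := 1251 * K * Cf ^ 2 with hCJ
  have hCJ0 : 0 ≤ CJ := by positivity
  set C2 : ℝ := 2 * n + 19 + Cf with hC2
  have hC20 : 0 < C2 := by positivity
  set C3 : ℝ := 2 * (73 + C2 + CJ) with hC3
  have hC31 : 1 ≤ C3 := by linarith
  set β : ℝ := 1 / (4000000 * (M + 1) ^ 2 * C3) with hβ
  have hM1 : 1 ≤ M + 1 := by linarith
  have hβ0 : 0 < β := by positivity
  have hβC : β * (4000000 * (M + 1) ^ 2 * C3) = 1 := by rw [hβ]; field_simp
  set α : ℝ := 32 * (M + 1) * β with hα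
  have hα0 : 0 < α := by positivity
  set ω : ℝ := 23 * (M + 1) * β with hω
  have hω1 : 64 * C3 * ω ^ 2 ≤ β * (1 / 8) ^ 2 := by
    have : 64 * C3 * ω ^ 2 = β * (33856 / 4000000) * (β * (4000000 * (M + 1) ^ 2 * C3)) := by
      rw [hω]; ring
    rw [this, hβC]
    linarith
  have hω2 : 64 * ω ^ 2 ≤ β := by
    have := mul_le_mul_of_nonneg_right hC31 (sq_nonneg ω)
    linarith
  have hβsmall : (M + 1) ^ 2 * β ≤ 1 / 4000000 := by
    have : 0 ≤ β * (M + 1) ^ 2 := by positivity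
    have := mul_le_mul_of_nonneg_left hC31 this
    linarith
  have hω3 : ω ≤ 1 := by
    have : (M + 1) * β ≤ (M + 1) ^ 2 * β := by
      apply mul_le_mul_of_nonneg_right _ hβ0.le
      rw [sq]; exact le_mul_of_one_le_left (by linarith) hM1
    rw [hω]; linarith
  set c : ℝ := min ((1 / 8) ^ 2) (α ^ 2 * (1 / 8) ^ 2 / (64 * K)) with hc
  have hc0 : 0 < c := by
    apply lt_min (by norm_num); positivity
  have hc1 : c ≤ (1 / 8) ^ 2 := min_le_left _ _
  have hc2 : 64 * K * c ≤ α ^ 2 * (1 / 8) ^ 2 := by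
    have := min_le_right ((1 / 8 : ℝ) ^ 2) (α ^ 2 * (1 / 8) ^ 2 / (64 * K))
    rw [← hc, le_div_iff₀ (by positivity)] at this
    linarith
  set L0 : ℝ := 1 + (400 + 4 * n ^ 2) * C3 / β + 384 / α with hL0
  have hL01 : 1 ≤ L0 := by
    have : 0 ≤ (400 + 4 * (n : ℝ) ^ 2) * C3 / β + 384 / α := by positivity
    linarith
  have hβL : (400 + 4 * n ^ 2) * C3 < β * L0 ^ 2 := by
    have e1 : (400 + 4 * (n : ℝ) ^ 2) * C3 < β * L0 := by
      have : β * L0 = β + (400 + 4 * (n : ℝ) ^ 2) * C3 + β * (384 / α) := by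
        rw [hL0]; field_simp
      have : 0 < β * (384 / α) := by positivity
      linarith
    have e2 : L0 ≤ L0 ^ 2 := by nlinarith only [hL01]
    have := mul_le_mul_of_nonneg_left e2 hβ0.le
    linarith
  have hαL : 48 ≤ α * (1 / 8) * L0 := by
    have : α * (1 / 8) * L0 = α * (1 / 8) * (1 + (400 + 4 * n ^ 2) * C3 / β) + 48 := by
      rw [hL0]; field_simp; ring
    have : 0 ≤ α * (1 / 8) * (1 + (400 + 4 * n ^ 2) * C3 / β) := by positivity
    linarith
  refine ⟨α, β, L0, 1 + 40 * (20 * CJ + C2 + 1) / c, hα0, hβ0, by linarith, ?_, ?_, ?_⟩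
  · have : 0 ≤ 40 * (20 * CJ + C2 + 1) / c := by positivity
    linarith
  · have e1 : M ^ 2 ≤ (M + 1) ^ 2 := by gcongr; linarith
    have e2 : (M + 1) * M ≤ (M + 1) ^ 2 := by
      rw [sq]; apply mul_le_mul_of_nonneg_left _ (by linarith); linarith
    have e3 := mul_le_mul_of_nonneg_right e1 hβ0.le
    have e4 := mul_le_mul_of_nonneg_right e2 hβ0.le
    rw [hα]; linarith
  intro N hN A L f h T h1 h2 z p w τ df ξ g ρ hlow hτ hdf hdfC hw hξ hg hp hz hz2 hρ hρ4 hLρ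
  clear_value c L0 ω α β C3 C2 CJ
  have hL := h.posL
  have hN1 : 1 ≤ N := by
    have : 0 ≤ 40 * (20 * CJ + C2 + 1) / c := by positivity
    linarith only [this, hN]
  have hNc : 40 * (20 * CJ + C2 + 1) ≤ N * c := by
    have : 40 * (20 * CJ + C2 + 1) / c ≤ N := by linarith only [hN]
    rwa [div_le_iff₀ hc0] at this
  set s := ρ⁻¹ with hs
  have hsρ : s * ρ = 1 := inv_mul_cancel₀ hρ.ne'
  clear_value s
  have hs4 : 4 ≤ s := by
    rw [hs, le_inv_comm₀ (by norm_num) hρ]; linarith only [hρ4]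
  have hs0 : 0 < s := by linarith only [hs4]
  have hwω : ∑ i, w i ^ 2 ≤ ω ^ 2 := by
    have e1 : ∀ i, w i ^ 2 ≤ 2 * α ^ 2 * z i ^ 2 + 2 * β ^ 2 * p i ^ 2 := by
      intro i
      rw [hw]; nlinarith only [sq_nonneg (α * z i - β * p i)]
    calc ∑ i, w i ^ 2 ≤ ∑ i, (2 * α ^ 2 * z i ^ 2 + 2 * β ^ 2 * p i ^ 2) :=
          Finset.sum_le_sum fun i _ => e1 i
      _ = 2 * α ^ 2 * ∑ i, z i ^ 2 + 2 * β ^ 2 * ∑ i, p i ^ 2 := by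
          rw [Finset.sum_add_distrib, Finset.mul_sum, Finset.mul_sum]
      _ ≤ 2 * α ^ 2 * (1 / 4) + 2 * β ^ 2 * M ^ 2 := by gcongr
      _ ≤ ω ^ 2 := by
          have : M ^ 2 ≤ (M + 1) ^ 2 := by gcongr; linarith only
          have := mul_le_mul_of_nonneg_left this (sq_nonneg β)
          rw [hα, hω]
          have : 0 ≤ β ^ 2 * (M + 1) ^ 2 := by positivity
          nlinarith only [this, mul_le_mul_of_nonneg_left ‹M ^ 2 ≤ (M + 1) ^ 2› (sq_nonneg β)]
  set S := linTrace A with hS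
  have hS0 : 0 ≤ S := h.linTrace_nonneg
  set y : Fin n → ℝ := fun i => ∑ j, A i j * w j with hy
  have hyy : linForm A y y ≤ ω ^ 2 * S := (h.linForm_mul_le w).trans
    (mul_le_mul_of_nonneg_right hwω hS0)
  have hFZ0 := h.linForm_self_nonneg z
  have hFZ : linForm A z z ≤ L / 2 := by
    have := mul_le_mul_of_nonneg_left hz2 (by positivity : 0 ≤ 2 * L)
    linarith only [h.linForm_self_le z, this]
  have hX : linForm A z y ^ 2 ≤ linForm A z z * (ω ^ 2 * S) :=
    (h.linForm_sq_le z y).trans (mul_le_mul_of_nonneg_left hyy hFZ0)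
  have hD : |∑ k, df k * w k| ≤ Cf * L := by
    apply abs_le_of_sq_le_sq _ (by positivity)
    calc (∑ k, df k * w k) ^ 2 ≤ (∑ k, df k ^ 2) * ∑ k, w k ^ 2 :=
          Finset.sum_mul_sq_le_sq_mul_sq _ _ _
      _ ≤ (Cf ^ 2 * L ^ 2) * 1 := by
          apply mul_le_mul hdfC _ (Finset.sum_nonneg fun _ _ => sq_nonneg _) (by positivity)
          refine hwω.trans ?_
          have hω0 : 0 ≤ ω := by rw [hω]; positivity
          exact pow_le_one₀ hω0 hω3
      _ = _ := by ring
  have hLV := barrier_lower hn' hα0.le hβ0.le hs4 hL.le h.posf.le hS0 hFZ0 hFZ hX hω2 hD hg hCf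
  set LV := -24 * s ^ 4 * (1 - g) * linForm A z z + 8 * s ^ 3 * linForm A z y
    - 4 * (1 - g) * s ^ 3 * (n - 1) * L
        + s ^ 2 * ((∑ k, df k * w k) + 2 * α * f + β * S) with hLVdef
  rw [← hC2] at hLV
  have hNLV := mul_le_mul_of_nonneg_left hLV (by linarith only [hN1] : 0 ≤ N)
  set q : Fin n → ℝ := fun i => τ i / L + N * (s ^ 3 * ξ i) with hq
  set Q := linForm A q q with hQ
  have hQ0 : 0 ≤ Q := h.linForm_self_nonneg q
  set Ξ := linForm A ξ ξ with hΞ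
  set B := linForm A τ τ / L ^ 2 with hB
  have hBeq : B = linForm A (fun i => (1 / L) * τ i) (fun i => (1 / L) * τ i) := by
    rw [SigmaTwoPos.linForm_smul, hB]; field_simp
  have hB0 : 0 ≤ B := by rw [hBeq]; exact h.linForm_self_nonneg _
  have hB1 : B ≤ 2 * Q + 2 * (N * s ^ 3) ^ 2 * Ξ := by
    have e := h.linForm_add_le 1 (-(N * s ^ 3)) q ξ
    have e2 : (fun i => 1 * q i + -(N * s ^ 3) * ξ i) = fun i => (1 / L) * τ i := by
      ext i; simp only [hq]; ring
    rw [e2, ← hBeq] at e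
    linarith only [e]
  have hB2 : (N * s ^ 3) ^ 2 * Ξ ≤ 2 * Q + 2 * B := by
    have e := h.linForm_add_le 1 (-1) q (fun i => (1 / L) * τ i)
    have e2 : (fun i => 1 * q i + -1 * ((1 / L) * τ i)) = fun i => (N * s ^ 3) * ξ i := by
      ext i; simp only [hq]; ring
    rw [e2, ← hBeq, SigmaTwoPos.linForm_smul] at e
    linarith only [e]
  have hξ' : ξ = fun i => (-4 * (1 - g)) * z i + ρ * y i := funext hξ
  have hs2 : 16 ≤ s ^ 2 := by
    have := pow_le_pow_left₀ (by norm_num) hs4 2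
    linarith only [this]
  have hs24 : s ^ 2 ≤ s ^ 4 := pow_le_pow_right₀ (by linarith only [hs4]) (by norm_num)
  have hs14 : 1 ≤ s ^ 4 := by linarith only [hs2, hs24]
  have hfin : N * L ≤ N * (s ^ 4 * L) := by
    have := mul_le_mul_of_nonneg_right hs14 hL.le
    exact mul_le_mul_of_nonneg_left (by linarith only [this]) (by linarith only [hN1])
  have hcn : (Real.sqrt (3 * (n : ℝ) ^ 2 + 1) - n + 1) / (2 * n) ≤ 1 := by
    rw [div_le_one (by positivity)]
    have : Real.sqrt (3 * (n : ℝ) ^ 2 + 1) ≤ 2 * n := by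
      rw [Real.sqrt_le_left (by positivity)]; nlinarith only [hn']
    linarith only [this, hn']
  clear_value LV B Ξ Q q
  by_cases hcase : C3 * s ^ 2 * L ≤ β * S
  · -- the spectrum is not concentrated
    have hδ : 0 < 1 / (N * s ^ 2) := by positivity
    have hJ := jacobi_log hn h T h1 h2 0 (1 / (N * s ^ 2))
      ((Real.sqrt (3 * (n : ℝ) ^ 2 + 1) - n + 1) / (2 * n)) Cf le_rfl zero_le_one hδ hlow hcn
      (fun x hx hx1 => (jacobi_poly_critical hn' hx hx1).1) τ df hτ hdf hdfC
    rw [← hCJ, ← hB] at hJ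
    have e1 : CJ / (1 / (N * s ^ 2)) * L = N * (CJ * s ^ 2 * L) := by field_simp
    rw [e1] at hJ
    have hΞ1 : Ξ ≤ 36 * L + 2 * ρ ^ 2 * (ω ^ 2 * S) := by
      have e := h.linForm_add_le (-4 * (1 - g)) ρ z y
      rw [← hξ', ← hΞ] at e
      have e3 : (-4 * (1 - g)) ^ 2 ≤ 36 := by
        have hg1 := abs_le.1 hg
        nlinarith only [hg1.1, hg1.2]
      have e4 : 2 * (-4 * (1 - g)) ^ 2 * linForm A z z ≤ 2 * 36 * (L / 2) := by gcongr
      have e5 := mul_le_mul_of_nonneg_left hyy (by positivity : 0 ≤ 2 * ρ ^ 2)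
      linarith only [e, e4, e5]
    have hδB : 1 / (N * s ^ 2) * B ≤ 1 / 8 * Q
        + N * (2 * s ^ 4 * (36 * L) + 4 * s ^ 2 * (ω ^ 2 * S)) := by
      have e2 := mul_le_mul_of_nonneg_left hB1 hδ.le
      have e3 : 1 / (N * s ^ 2) * (2 * Q + 2 * (N * s ^ 3) ^ 2 * Ξ)
          = 2 / (N * s ^ 2) * Q + 2 * N * s ^ 4 * Ξ := by field_simp
      have e4 : 2 / (N * s ^ 2) * Q ≤ 1 / 8 * Q := by
        apply mul_le_mul_of_nonneg_right _ hQ0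
        rw [div_le_div_iff₀ (by positivity) (by norm_num)]
        nlinarith only [hN1, hs2]
      have e5 := mul_le_mul_of_nonneg_left hΞ1 (by positivity : 0 ≤ 2 * N * s ^ 4)
      have e6 : 2 * N * s ^ 4 * (36 * L + 2 * ρ ^ 2 * (ω ^ 2 * S))
          = N * (2 * s ^ 4 * (36 * L) + 4 * s ^ 2 * (s * ρ) ^ 2 * (ω ^ 2 * S)) := by ring
      rw [hsρ] at e6
      linarith only [e2, e3, e4, e5, e6]
    have e7 : s ^ 4 * L ≤ 3 / 4 * β * s ^ 2 * S - C2 * s ^ 4 * L - 2 * s ^ 4 * (36 * L)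
        - 4 * s ^ 2 * (ω ^ 2 * S) - CJ * s ^ 2 * L := by
      have b1 := mul_le_mul_of_nonneg_left hcase (sq_nonneg s)
      have b2 := mul_le_mul_of_nonneg_right hω2 (by positivity : 0 ≤ s ^ 2 * S)
      have b3 := mul_le_mul_of_nonneg_left hs24 (by positivity : 0 ≤ CJ * L)
      have b4 : s ^ 2 * (C3 * s ^ 2 * L) = 2 * (73 + C2 + CJ) * (s ^ 4 * L) := by rw [hC3]; ring
      have b5 : 0 ≤ β * (s ^ 2 * S) := by positivity
      linarith only [b1, b2, b3, b4, b5]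
    have e8 := mul_le_mul_of_nonneg_left e7 (by linarith only [hN1] : 0 ≤ N)
    linarith only [e8, hJ, hδB, hNLV, hfin, hQ0]
  · push Not at hcase
    have hSβ : β * ρ ^ 2 * S ≤ C3 * L := by
      have := mul_le_mul_of_nonneg_left hcase.le (sq_nonneg ρ)
      have e : ρ ^ 2 * (C3 * s ^ 2 * L) = C3 * L * (s * ρ) ^ 2 := by ring
      rw [e, hsρ] at this
      linarith only [this]
    have hn2 : 0 ≤ 4 * (n : ℝ) ^ 2 * C3 := by positivity
    obtain ⟨hlow', hΞ2⟩ := concentrated_spectrum hn h (r := 1 / 8) (α := α) (β := β) (C3 := C3)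
      (ρ := ρ) (g := g) (ω := ω) (M := M) (L0 := L0) (c := c) (z := z) (p := p) (w := w)
      (by norm_num) hα0 hβ0 hM (by linarith only [hC31]) (by linarith only [hL01]) hz hz2
      hw hp hwω hω1
      (by rw [hα]; linarith only [hβ0]) hρ hρ4 hg hSβ hLρ (by linarith only [hβL, hn2])
      (by linarith only [hβL, hC31]) hαL hc1 hc2
    have hJ := jacobi_log hn h T h1 h2 (1 / 10) (1 / 20) (1 / 10) Cf (by norm_num) (by norm_num)
      (by norm_num) hlow' (by norm_num)
      (fun x hx hx1 => jacobi_poly_tenth hn' hx (by linarith only [hx1])) τ df hτ hdf hdfC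
    rw [← hCJ, ← hB] at hJ
    change c * ρ ^ 2 * L ≤ linForm A (fun i => (-4 * (1 - g)) * z i + ρ * y i)
      (fun i => (-4 * (1 - g)) * z i + ρ * y i) at hΞ2
    rw [← hξ', ← hΞ] at hΞ2
    have e1 : N ^ 2 * (c * (s ^ 4 * L)) ≤ 2 * Q + 2 * B := by
      refine le_trans ?_ hB2
      have := mul_le_mul_of_nonneg_left hΞ2 (sq_nonneg (N * s ^ 3))
      have e : (N * s ^ 3) ^ 2 * (c * ρ ^ 2 * L) = N ^ 2 * (c * (s ^ 4 * L)) * (s * ρ) ^ 2 := by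
        ring
      rw [e, hsρ] at this
      linarith only [this]
    have e2 : N * (s ^ 4 * L) * (40 * (20 * CJ + C2 + 1)) ≤ N * (s ^ 4 * L) * (N * c) :=
      mul_le_mul_of_nonneg_left hNc (by positivity)
    have e3 : CJ * L ≤ N * (s ^ 4 * L) * CJ := by
      have : L ≤ N * (s ^ 4 * L) := le_trans (by nlinarith only [hN1, hL]) hfin
      have := mul_le_mul_of_nonneg_left this hCJ0
      linarith only [this]
    have e4 : 0 ≤ N * (β * s ^ 2 * S) := by positivity
    linarith only [e1, e2, e3, e4, hJ, hNLV, hfin, hQ0, hB0]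

/-- `f` is differentiable at `x` with partial derivatives `c i`. -/
def HasGrad {n : ℕ} (f : (Fin n → ℝ) → ℝ) (c : Fin n → ℝ) (x : Fin n → ℝ) : Prop :=
  ∃ f' : (Fin n → ℝ) →L[ℝ] ℝ, HasFDerivAt f f' x ∧ ∀ i, f' (Pi.single i 1) = c i

namespace HasGrad

variable {n : ℕ} {f g : (Fin n → ℝ) → ℝ} {c d : Fin n → ℝ} {x : Fin n → ℝ}

lemma fderiv_apply (h : HasGrad f c x) (i : Fin n) : fderiv ℝ f x (Pi.single i 1) = c i := by
  obtain ⟨f', h, h'⟩ := h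
  rw [h.fderiv, h']

lemma of_differentiableAt (h : DifferentiableAt ℝ f x) :
    HasGrad f (fun i => fderiv ℝ f x (Pi.single i 1)) x :=
  ⟨_, h.hasFDerivAt, fun _ => rfl⟩

lemma congr_grad (h : HasGrad f c x) (hcd : ∀ i, c i = d i) : HasGrad f d x := by
  rwa [← funext hcd]

lemma congr_fun (h : HasGrad f c x) (hfg : ∀ y, g y = f y) : HasGrad g c x := by
  rwa [funext hfg]

lemma const (a : ℝ) : HasGrad (fun _ : Fin n → ℝ => a) (fun _ => 0) x :=
  ⟨0, hasFDerivAt_const a x, fun _ => rfl⟩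

lemma coord (j : Fin n) : HasGrad (fun y : Fin n → ℝ => y j) (fun i => if i = j then 1 else 0) x :=
  ⟨ContinuousLinearMap.proj j,
    (ContinuousLinearMap.proj (R := ℝ) (φ := fun _ : Fin n => ℝ) j).hasFDerivAt,
    fun i => by simp [Pi.single_apply, eq_comm]⟩

lemma add (hf : HasGrad f c x) (hg : HasGrad g d x) :
    HasGrad (fun y => f y + g y) (fun i => c i + d i) x := by
  obtain ⟨f', h1, h2⟩ := hf
  obtain ⟨g', h3, h4⟩ := hg
  exact ⟨f' + g', h1.add h3, fun i => by simp [h2, h4]⟩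

lemma sub (hf : HasGrad f c x) (hg : HasGrad g d x) :
    HasGrad (fun y => f y - g y) (fun i => c i - d i) x := by
  obtain ⟨f', h1, h2⟩ := hf
  obtain ⟨g', h3, h4⟩ := hg
  exact ⟨f' - g', h1.sub h3, fun i => by simp [h2, h4]⟩

lemma mul (hf : HasGrad f c x) (hg : HasGrad g d x) :
    HasGrad (fun y => f y * g y) (fun i => c i * g x + f x * d i) x := by
  obtain ⟨f', h1, h2⟩ := hf
  obtain ⟨g', h3, h4⟩ := hg
  exact ⟨_, h1.mul h3, fun i => by simp [h2, h4]; ring⟩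

lemma const_mul (a : ℝ) (hf : HasGrad f c x) : HasGrad (fun y => a * f y) (fun i => a * c i) x := by
  obtain ⟨f', h1, h2⟩ := hf
  exact ⟨_, h1.const_mul a, fun i => by simp [h2]⟩

lemma comp {φ : ℝ → ℝ} {b : ℝ} (hφ : HasDerivAt φ b (f x)) (hf : HasGrad f c x) :
    HasGrad (fun y => φ (f y)) (fun i => b * c i) x := by
  obtain ⟨f', h1, h2⟩ := hf
  exact ⟨_, hφ.comp_hasFDerivAt x h1, fun i => by simp [h2]⟩

lemma inv (hf : HasGrad f c x) (h0 : f x ≠ 0) :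
    HasGrad (fun y => (f y)⁻¹) (fun i => -(f x ^ 2)⁻¹ * c i) x :=
  comp (hasDerivAt_inv h0) hf

lemma log (hf : HasGrad f c x) (h0 : f x ≠ 0) :
    HasGrad (fun y => Real.log (f y)) (fun i => (f x)⁻¹ * c i) x :=
  comp (Real.hasDerivAt_log h0) hf

lemma sum {ι : Type*} {s : Finset ι} {F : ι → (Fin n → ℝ) → ℝ} {C : ι → Fin n → ℝ}
    (h : ∀ k ∈ s, HasGrad (F k) (C k) x) :
    HasGrad (fun y => ∑ k ∈ s, F k y) (fun i => ∑ k ∈ s, C k i) x := by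
  classical
  induction s using Finset.induction_on with
  | empty => simpa using const 0
  | insert a s ha ih =>
    simp only [Finset.sum_insert ha]
    exact (h a (Finset.mem_insert_self a s)).add
      (ih fun k hk => h k (Finset.mem_insert_of_mem hk))

end HasGrad

/-- `p, A, T, U` are the partial derivatives of `u` of orders one to four on `O`. -/
structure IsJet {n : ℕ} (O : Set (Fin n → ℝ)) (u : (Fin n → ℝ) → ℝ)
    (p : Fin n → (Fin n → ℝ) → ℝ) (A : Fin n → Fin n → (Fin n → ℝ) → ℝ)
    (T : Fin n → Fin n → Fin n → (Fin n → ℝ) → ℝ)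
    (U : Fin n → Fin n → Fin n → Fin n → (Fin n → ℝ) → ℝ) : Prop where
  grad_u : ∀ x ∈ O, HasGrad u (fun i => p i x) x
  grad_p : ∀ x ∈ O, ∀ i, HasGrad (p i) (fun j => A i j x) x
  grad_A : ∀ x ∈ O, ∀ i j, HasGrad (A i j) (fun k => T i j k x) x
  grad_T : ∀ x ∈ O, ∀ i j k, HasGrad (T i j k) (fun l => U i j k l x) x
  contDiff_u : ContDiffOn ℝ 1 u O
  contDiff_p : ∀ i, ContDiffOn ℝ 1 (p i) O
  contDiff_A : ∀ i j, ContDiffOn ℝ 1 (A i j) O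
  contDiff_T : ∀ i j k, ContDiffOn ℝ 1 (T i j k) O
  symm_A : ∀ x ∈ O, ∀ i j, A i j x = A j i x
  symm_T : ∀ x ∈ O, ∀ i j k, T i j k x = T j i k x
  symm_T' : ∀ x ∈ O, ∀ i j k, T i j k x = T i k j x
  symm_U' : ∀ x ∈ O, ∀ i j k l, U i j k l x = U i k j l x
  symm_U'' : ∀ x ∈ O, ∀ i j k l, U i j k l x = U i j l k x

/-- The `i`-th partial derivative. -/
noncomputable def partialDeriv {n : ℕ} (i : Fin n) (f : (Fin n → ℝ) → ℝ) : (Fin n → ℝ) → ℝ :=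
  fun x => fderiv ℝ f x (Pi.single i 1)

section jet

variable {n : ℕ} {O : Set (Fin n → ℝ)}

lemma ContDiffOn.partialDeriv {f : (Fin n → ℝ) → ℝ} {k m : WithTop ℕ∞} (hO : IsOpen O)
    (hf : ContDiffOn ℝ m f O) (hkm : k + 1 ≤ m) (i : Fin n) :
    ContDiffOn ℝ k (partialDeriv i f) O :=
  (hf.fderiv_of_isOpen hO hkm).clm_apply contDiffOn_const

lemma ContDiffOn.hasGrad {f : (Fin n → ℝ) → ℝ} {m : WithTop ℕ∞} (hO : IsOpen O)
    (hf : ContDiffOn ℝ m f O) (hm : m ≠ 0) {x : Fin n → ℝ} (hx : x ∈ O) :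
    HasGrad f (fun i => _root_.partialDeriv i f x) x :=
  HasGrad.of_differentiableAt ((hf.differentiableOn hm).differentiableAt (hO.mem_nhds hx))

lemma ContDiffOn.partialDeriv_comm {f : (Fin n → ℝ) → ℝ} (hO : IsOpen O)
    (hf : ContDiffOn ℝ 2 f O) {x : Fin n → ℝ} (hx : x ∈ O) (i j : Fin n) :
    _root_.partialDeriv i (_root_.partialDeriv j f) x
      = _root_.partialDeriv j (_root_.partialDeriv i f) x := by
  have h1 : DifferentiableAt ℝ (fderiv ℝ f) x :=
    ((hf.fderiv_of_isOpen (m := 1) hO (by norm_num)).differentiableOn one_ne_zero).differentiableAt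
      (hO.mem_nhds hx)
  have h2 : ∀ i j : Fin n, _root_.partialDeriv i (_root_.partialDeriv j f) x
      = fderiv ℝ (fderiv ℝ f) x (Pi.single i 1) (Pi.single j 1) := by
    intro i j
    unfold _root_.partialDeriv
    rw [fderiv_clm_apply h1 (differentiableAt_const _)]
    simp
  rw [h2, h2]
  have := (hf.contDiffAt (hO.mem_nhds hx)).isSymmSndFDerivAt (by simp)
  exact this _ _

lemma partialDeriv_congr {f g : (Fin n → ℝ) → ℝ} (hO : IsOpen O) (h : ∀ x ∈ O, f x = g x)
    {x : Fin n → ℝ} (hx : x ∈ O) (i : Fin n) : partialDeriv i f x = partialDeriv i g x := by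
  unfold partialDeriv
  rw [Filter.EventuallyEq.fderiv_eq (Filter.eventually_of_mem (hO.mem_nhds hx) h)]

lemma isJet_partialDeriv {u : (Fin n → ℝ) → ℝ} (hO : IsOpen O) (hu : ContDiffOn ℝ 4 u O) :
    IsJet O u (fun i => partialDeriv i u) (fun i j => partialDeriv j (partialDeriv i u))
      (fun i j k => partialDeriv k (partialDeriv j (partialDeriv i u)))
      (fun i j k l => partialDeriv l (partialDeriv k (partialDeriv j (partialDeriv i u)))) := by
  have h1 : ∀ i, ContDiffOn ℝ 3 (partialDeriv i u) O := fun i => hu.partialDeriv hO (by norm_num) i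
  have h2 : ∀ i j, ContDiffOn ℝ 2 (partialDeriv j (partialDeriv i u)) O :=
    fun i j => (h1 i).partialDeriv hO (by norm_num) j
  have h3 : ∀ i j k, ContDiffOn ℝ 1 (partialDeriv k (partialDeriv j (partialDeriv i u))) O :=
    fun i j k => (h2 i j).partialDeriv hO (by norm_num) k
  have s2 : ∀ x ∈ O, ∀ i j, partialDeriv j (partialDeriv i u) x
      = partialDeriv i (partialDeriv j u) x :=
    fun x hx i j => (hu.of_le (by norm_num)).partialDeriv_comm hO hx j i
  have s3 : ∀ x ∈ O, ∀ i j k, partialDeriv k (partialDeriv j (partialDeriv i u)) x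
      = partialDeriv k (partialDeriv i (partialDeriv j u)) x :=
    fun x hx i j k => partialDeriv_congr hO (fun y hy => s2 y hy i j) hx k
  have s3' : ∀ x ∈ O, ∀ i j k, partialDeriv k (partialDeriv j (partialDeriv i u)) x
      = partialDeriv j (partialDeriv k (partialDeriv i u)) x :=
    fun x hx i j k => ((h1 i).of_le (by norm_num)).partialDeriv_comm hO hx k j
  exact {
    grad_u := fun x hx => hu.hasGrad hO (by norm_num) hx
    grad_p := fun x hx i => (h1 i).hasGrad hO (by norm_num) hx
    grad_A := fun x hx i j => (h2 i j).hasGrad hO (by norm_num) hx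
    grad_T := fun x hx i j k => (h3 i j k).hasGrad hO (by norm_num) hx
    contDiff_u := hu.of_le (by norm_num)
    contDiff_p := fun i => (h1 i).of_le (by norm_num)
    contDiff_A := fun i j => (h2 i j).of_le (by norm_num)
    contDiff_T := h3
    symm_A := s2
    symm_T := s3
    symm_T' := s3'
    symm_U' := fun x hx i j k l => partialDeriv_congr hO (fun y hy => s3' y hy i j k) hx l
    symm_U'' := fun x hx i j k l => (h2 i j).partialDeriv_comm hO hx l k }

end jet

namespace IsJet

variable {n : ℕ} {O : Set (Fin n → ℝ)} {u : (Fin n → ℝ) → ℝ}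
  {p : Fin n → (Fin n → ℝ) → ℝ} {A : Fin n → Fin n → (Fin n → ℝ) → ℝ}
  {T : Fin n → Fin n → Fin n → (Fin n → ℝ) → ℝ}
  {U : Fin n → Fin n → Fin n → Fin n → (Fin n → ℝ) → ℝ}

lemma grad_trace (h : IsJet O u p A T U) {x : Fin n → ℝ} (hx : x ∈ O) :
    HasGrad (fun x => ∑ i, A i i x) (fun k => ∑ i, T i i k x) x :=
  HasGrad.sum fun i _ => h.grad_A x hx i i

lemma grad_sigma (h : IsJet O u p A T U) {x : Fin n → ℝ} (hx : x ∈ O) :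
    HasGrad (fun x => ((∑ i, A i i x) ^ 2 - ∑ i, ∑ j, A i j x ^ 2) / 2)
      (fun k => (∑ i, A i i x) * (∑ i, T i i k x) - ∑ i, ∑ j, A i j x * T i j k x) x := by
  have h1 := (h.grad_trace hx).mul (h.grad_trace hx)
  have h2 : HasGrad (fun x => ∑ i, ∑ j, A i j x * A i j x) _ x :=
    HasGrad.sum fun i _ => HasGrad.sum fun j _ => (h.grad_A x hx i j).mul (h.grad_A x hx i j)
  refine (((h1.sub h2).const_mul (1 / 2)).congr_fun fun y => ?_).congr_grad fun k => ?_
  · simp only [sq]; ring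
  · have : ∑ i, ∑ j, (T i j k x * A i j x + A i j x * T i j k x)
        = 2 * ∑ i, ∑ j, A i j x * T i j k x := by
      rw [Finset.mul_sum]
      refine Finset.sum_congr rfl fun i _ => ?_
      rw [Finset.mul_sum]
      exact Finset.sum_congr rfl fun j _ => by ring
    rw [this]; ring

/-- The divergence of the field `∑ A_jk T_ijk - ∑ A_ij τ_j` is `|T|² - |τ|²`. -/
lemma grad_field (h : IsJet O u p A T U) {x : Fin n → ℝ} (hx : x ∈ O) :
    ∃ D : Fin n → Fin n → ℝ,
      (∀ i, HasGrad (fun x => (∑ j, ∑ k, A j k x * T i j k x) - ∑ j, A i j x * ∑ k, T k k j x)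
        (D i) x) ∧
      ∑ i, D i i = (∑ i, ∑ j, ∑ k, T i j k x ^ 2) - ∑ k, (∑ i, T i i k x) ^ 2 := by
  refine ⟨_, fun i => (HasGrad.sum fun j _ => HasGrad.sum fun k _ =>
    (h.grad_A x hx j k).mul (h.grad_T x hx i j k)).sub (HasGrad.sum fun j _ =>
    (h.grad_A x hx i j).mul (HasGrad.sum fun k _ => h.grad_T x hx k k j)), ?_⟩
  have e1 : ∑ i, ∑ j, ∑ k, T j k i x * T i j k x = ∑ i, ∑ j, ∑ k, T i j k x ^ 2 := by
    refine Finset.sum_congr rfl fun i _ => Finset.sum_congr rfl fun j _ =>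
      Finset.sum_congr rfl fun k _ => ?_
    rw [h.symm_T' x hx j k i, h.symm_T x hx j i k, sq]
  have e2 : ∑ i, ∑ j, T i j i x * ∑ k, T k k j x = ∑ k, (∑ i, T i i k x) ^ 2 := by
    rw [Finset.sum_comm]
    refine Finset.sum_congr rfl fun j _ => ?_
    rw [← Finset.sum_mul, sq]
    congr 1
    exact Finset.sum_congr rfl fun i _ => h.symm_T' x hx i j i
  have e3 : ∑ i, ∑ j, ∑ k, A j k x * U i j k i x = ∑ i, ∑ j, A i j x * ∑ k, U k k j i x := by
    rw [Finset.sum_comm]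
    refine Finset.sum_congr rfl fun i _ => ?_
    rw [Finset.sum_comm]
    refine Finset.sum_congr rfl fun j _ => ?_
    rw [Finset.mul_sum]
    refine Finset.sum_congr rfl fun k _ => ?_
    rw [h.symm_U'' x hx k i j k, h.symm_U' x hx k i k j, h.symm_U'' x hx k k i j,
      h.symm_U'' x hx k k j i]
  simp only [Finset.sum_sub_distrib, Finset.sum_add_distrib]
  rw [e1, e2, e3]
  ring

/-- Divergence of the linearized operator's flux. -/
lemma grad_linear_flux (h : IsJet O u p A T U) {x : Fin n → ℝ} (hx : x ∈ O)
    {W : Fin n → (Fin n → ℝ) → ℝ} {G : Fin n → Fin n → ℝ} (hW : ∀ j, HasGrad (W j) (G j) x) :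
    ∃ D : Fin n → Fin n → ℝ,
      (∀ i, HasGrad (fun x => (∑ k, A k k x) * W i x - ∑ j, A i j x * W j x) (D i) x) ∧
      ∑ i, D i i = (∑ k, A k k x) * (∑ i, G i i) - ∑ i, ∑ j, A i j x * G i j := by
  refine ⟨_, fun i => ((h.grad_trace hx).mul (hW i)).sub (HasGrad.sum fun j _ =>
    (h.grad_A x hx i j).mul (hW j)), ?_⟩
  have e1 : ∑ i, ∑ j, T i j i x * W j x = ∑ i, (∑ k, T k k i x) * W i x := by
    rw [Finset.sum_comm]
    refine Finset.sum_congr rfl fun j _ => ?_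
    rw [Finset.sum_mul]
    exact Finset.sum_congr rfl fun i _ => by rw [h.symm_T' x hx i j i]
  have e2 : ∑ i, ∑ j, A i j x * G j i = ∑ i, ∑ j, A i j x * G i j := by
    rw [Finset.sum_comm]
    exact Finset.sum_congr rfl fun i _ => Finset.sum_congr rfl fun j _ => by
      rw [h.symm_A x hx j i]
  simp only [Finset.sum_sub_distrib, Finset.sum_add_distrib]
  rw [e1, e2, ← Finset.mul_sum]
  ring

end IsJet

lemma sum_flux_identity {n : ℕ} {A : Fin n → Fin n → ℝ} {T : Fin n → Fin n → Fin n → ℝ}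
    {G : Fin n → Fin n → ℝ} {z v w : Fin n → ℝ} {L f a b c d α β : ℝ}
    (hA : ∀ i j, A i j = A j i) (hL : ∑ i, A i i = L)
    (hf : 2 * f = L ^ 2 - ∑ i, ∑ j, A i j ^ 2)
    (hG : ∀ i j, G i j = a * (z i * z j) + b * (z i * v j) + b * (v i * z j)
      + c * (if i = j then 1 else 0)
      + d * ((∑ k, T i j k * w k) + α * A i j + β * ∑ k, A i k * A k j)) :
    L * (∑ i, G i i) - ∑ i, ∑ j, A i j * G i j = a * linForm A z z + 2 * b * linForm A z v
      + c * (n - 1) * L + d * ((∑ k, (L * (∑ i, T i i k) - ∑ i, ∑ j, A i j * T i j k) * w k)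
        + 2 * α * f + β * linTrace A) := by
  have hB : ∀ (H : Fin n → Fin n → ℝ), L * (∑ i, H i i) - ∑ i, ∑ j, A i j * H i j
      = ∑ i, ∑ j, ((if i = j then L else 0) - A i j) * H i j := by
    intro H
    simp only [sub_mul, Finset.sum_sub_distrib, ite_mul, zero_mul, Finset.sum_ite_eq,
      Finset.mem_univ, if_true, Finset.mul_sum]
  rw [hB]
  have e : ∀ i j, ((if i = j then L else 0) - A i j) * G i j
      = a * (((if i = j then L else 0) - A i j) * (z i * z j))
        + b * (((if i = j then L else 0) - A i j) * (z i * v j))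
        + b * (((if i = j then L else 0) - A i j) * (v i * z j))
        + c * (((if i = j then L else 0) - A i j) * (if i = j then 1 else 0))
        + d * (((if i = j then L else 0) - A i j) * (∑ k, T i j k * w k))
        + d * α * (((if i = j then L else 0) - A i j) * A i j)
        + d * β * (((if i = j then L else 0) - A i j) * ∑ k, A i k * A k j) := by
    intro i j; rw [hG]; ring
  simp only [e, Finset.sum_add_distrib, ← Finset.mul_sum]
  simp only [← hB, if_true]
  have f1 : ∀ x y : Fin n → ℝ, L * (∑ i, x i * y i) - ∑ i, ∑ j, A i j * (x i * y j)
      = linForm A x y := by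
    intro x y
    unfold linForm
    rw [hL]
    congr 1
    exact Finset.sum_congr rfl fun i _ => Finset.sum_congr rfl fun j _ => by ring
  have f2 : linForm A v z = linForm A z v := by
    rw [← f1, ← f1]
    congr 1
    · simp only [mul_comm]
    · rw [Finset.sum_comm]
      exact Finset.sum_congr rfl fun i _ => Finset.sum_congr rfl fun j _ => by
        rw [hA j i]; ring
  rw [f1, f1, f1, f2]
  have f3 : L * (∑ _i : Fin n, (1 : ℝ))
      - ∑ i, ∑ j, A i j * (if i = j then (1 : ℝ) else 0) = (n - 1) * L := by
    simp [hL]; ring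
  have f4 : L * (∑ i, ∑ k, T i i k * w k) - ∑ i, ∑ j, A i j * ∑ k, T i j k * w k
      = ∑ k, (L * (∑ i, T i i k) - ∑ i, ∑ j, A i j * T i j k) * w k := by
    simp only [sub_mul, Finset.sum_sub_distrib, Finset.sum_mul, Finset.mul_sum]
    congr 1
    · rw [Finset.sum_comm]
      exact Finset.sum_congr rfl fun i _ => Finset.sum_congr rfl fun j _ => by ring
    · symm
      rw [Finset.sum_comm]
      refine Finset.sum_congr rfl fun i _ => ?_
      rw [Finset.sum_comm]
      exact Finset.sum_congr rfl fun j _ => Finset.sum_congr rfl fun k _ => by ring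
  have f5 : L * (∑ i, A i i) - ∑ i, ∑ j, A i j * A i j = 2 * f := by
    rw [hL, hf]; simp only [sq]
  have f6 : L * (∑ i, ∑ k, A i k * A k i) - ∑ i, ∑ j, A i j * ∑ k, A i k * A k j
      = linTrace A := by
    rw [hB fun i j => ∑ k, A i k * A k j]
    unfold linTrace
    refine Finset.sum_congr rfl fun i _ => Finset.sum_congr rfl fun j _ => ?_
    rw [hL]
    congr 1
    exact Finset.sum_congr rfl fun k _ => by rw [hA i k, hA k j]; ring
  rw [f3, f4, f5, f6]
  ring

/-- The cutoff `1/4 - |x - y|²`. -/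
noncomputable def cutoff {n : ℕ} (y x : Fin n → ℝ) : ℝ := 1 / 4 - ∑ j, (x j - y j) ^ 2

/-- The lower order perturbation `α ((x - y) · p - u) + β |p|² / 2`. -/
noncomputable def tilt {n : ℕ} (α β : ℝ) (y : Fin n → ℝ) (u : (Fin n → ℝ) → ℝ)
    (p : Fin n → (Fin n → ℝ) → ℝ) (x : Fin n → ℝ) : ℝ :=
  α * (∑ j, (x j - y j) * p j x - u x) + β / 2 * ∑ j, p j x ^ 2

/-- The components of `ρ³ ∇(-ρ⁻² (1 - g))`, with `ρ` the cutoff and `g` the perturbation. -/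
noncomputable def barrierGrad {n : ℕ} (α β : ℝ) (y : Fin n → ℝ) (u : (Fin n → ℝ) → ℝ)
    (p : Fin n → (Fin n → ℝ) → ℝ) (A : Fin n → Fin n → (Fin n → ℝ) → ℝ) (i : Fin n)
    (x : Fin n → ℝ) : ℝ :=
  -4 * (1 - tilt α β y u p x) * (x i - y i)
    + cutoff y x * ∑ j, A i j x * (α * (x j - y j) + β * p j x)

/-- The auxiliary function `log Λ - N ρ⁻² (1 - g)`. -/
noncomputable def auxFun {n : ℕ} (α β N : ℝ) (y : Fin n → ℝ) (u : (Fin n → ℝ) → ℝ)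
    (p : Fin n → (Fin n → ℝ) → ℝ) (A : Fin n → Fin n → (Fin n → ℝ) → ℝ) (x : Fin n → ℝ) : ℝ :=
  Real.log (∑ i, A i i x) - N * ((cutoff y x)⁻¹ ^ 2 * (1 - tilt α β y u p x))

/-- The gradient of `auxFun`. -/
noncomputable def auxGrad {n : ℕ} (α β N : ℝ) (y : Fin n → ℝ) (u : (Fin n → ℝ) → ℝ)
    (p : Fin n → (Fin n → ℝ) → ℝ) (A : Fin n → Fin n → (Fin n → ℝ) → ℝ)
    (T : Fin n → Fin n → Fin n → (Fin n → ℝ) → ℝ) (i : Fin n) (x : Fin n → ℝ) : ℝ :=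
  (∑ k, T k k i x) / (∑ k, A k k x) + N * ((cutoff y x)⁻¹ ^ 3 * barrierGrad α β y u p A i x)

/-- The flux `F ∇P - ∇f / Λ`, written without derivatives of order greater than three. -/
noncomputable def auxFlux {n : ℕ} (α β N : ℝ) (y : Fin n → ℝ) (u : (Fin n → ℝ) → ℝ)
    (p : Fin n → (Fin n → ℝ) → ℝ) (A : Fin n → Fin n → (Fin n → ℝ) → ℝ)
    (T : Fin n → Fin n → Fin n → (Fin n → ℝ) → ℝ) (i : Fin n) (x : Fin n → ℝ) : ℝ :=
  (∑ k, A k k x)⁻¹ * ((∑ j, ∑ k, A j k x * T i j k x) - ∑ j, A i j x * ∑ k, T k k j x)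
    + N * ((∑ k, A k k x) * ((cutoff y x)⁻¹ ^ 3 * barrierGrad α β y u p A i x)
      - ∑ j, A i j x * ((cutoff y x)⁻¹ ^ 3 * barrierGrad α β y u p A j x))

section

variable {n : ℕ} {O : Set (Fin n → ℝ)} {u : (Fin n → ℝ) → ℝ}
  {p : Fin n → (Fin n → ℝ) → ℝ} {A : Fin n → Fin n → (Fin n → ℝ) → ℝ}
  {T : Fin n → Fin n → Fin n → (Fin n → ℝ) → ℝ}
  {U : Fin n → Fin n → Fin n → Fin n → (Fin n → ℝ) → ℝ}

lemma hasGrad_shift (y x : Fin n → ℝ) (j : Fin n) :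
    HasGrad (fun x : Fin n → ℝ => x j - y j) (fun i => if i = j then 1 else 0) x :=
  ((HasGrad.coord j).sub (HasGrad.const (y j))).congr_grad fun i => by simp

lemma hasGrad_cutoff (y x : Fin n → ℝ) :
    HasGrad (cutoff y) (fun i => -2 * (x i - y i)) x := by
  refine (((HasGrad.const (1 / 4)).sub (HasGrad.sum (s := Finset.univ) fun j _ =>
    (hasGrad_shift y x j).mul (hasGrad_shift y x j))).congr_fun fun x' => ?_).congr_grad
      fun i => ?_
  · simp only [cutoff, sq]
  · simp only [Finset.sum_add_distrib, ite_mul, mul_ite, one_mul, mul_one, zero_mul, mul_zero,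
      Finset.sum_ite_eq, Finset.mem_univ, if_true]
    ring

lemma hasGrad_inv_cutoff {y x : Fin n → ℝ} (h0 : cutoff y x ≠ 0) :
    HasGrad (fun x => (cutoff y x)⁻¹) (fun i => 2 * (cutoff y x)⁻¹ ^ 2 * (x i - y i)) x :=
  ((hasGrad_cutoff y x).inv h0).congr_grad fun i => by rw [inv_pow]; ring

lemma IsJet.hasGrad_tilt (h : IsJet O u p A T U) (α β : ℝ) (y : Fin n → ℝ) {x : Fin n → ℝ}
    (hx : x ∈ O) :
    HasGrad (tilt α β y u p) (fun i => ∑ j, A i j x * (α * (x j - y j) + β * p j x)) x := by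
  refine ((((HasGrad.sum (s := Finset.univ) fun j _ =>
    (hasGrad_shift y x j).mul (h.grad_p x hx j)).sub (h.grad_u x hx)).const_mul α).add
    ((HasGrad.sum (s := Finset.univ) fun j _ =>
      (h.grad_p x hx j).mul (h.grad_p x hx j)).const_mul (β / 2))).congr_fun
      (fun x' => by simp only [tilt, sq]) |>.congr_grad fun i => ?_
  simp only [Finset.sum_add_distrib, ite_mul, one_mul, zero_mul, Finset.sum_ite_eq,
    Finset.mem_univ, if_true]
  have e1 : ∑ j, A i j x * (α * (x j - y j) + β * p j x)
      = α * ∑ j, (x j - y j) * A j i x + β * ∑ j, p j x * A j i x := by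
    rw [Finset.mul_sum, Finset.mul_sum, ← Finset.sum_add_distrib]
    exact Finset.sum_congr rfl fun j _ => by rw [h.symm_A x hx i j]; ring
  have e2 : ∑ j, A j i x * p j x = ∑ j, p j x * A j i x :=
    Finset.sum_congr rfl fun j _ => mul_comm _ _
  rw [e1, e2]; ring

lemma IsJet.hasGrad_auxFun (h : IsJet O u p A T U) (α β N : ℝ) (y : Fin n → ℝ) {x : Fin n → ℝ}
    (hx : x ∈ O) (h0 : cutoff y x ≠ 0) (hΛ : ∑ i, A i i x ≠ 0) :
    HasGrad (auxFun α β N y u p A) (fun i => auxGrad α β N y u p A T i x) x := by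
  have hs := hasGrad_inv_cutoff h0
  have h1 := (((h.grad_trace hx).log hΛ).sub
    (((hs.mul hs).mul ((HasGrad.const 1).sub (h.hasGrad_tilt α β y hx))).const_mul N))
  refine (h1.congr_fun fun x' => by simp only [auxFun, sq]).congr_grad fun i => ?_
  simp only [auxGrad, barrierGrad]
  have e : (cutoff y x)⁻¹ * cutoff y x = 1 := inv_mul_cancel₀ h0
  rw [div_eq_inv_mul]
  linear_combination (-N * (cutoff y x)⁻¹ ^ 2 *
    ∑ j, A i j x * (α * (x j - y j) + β * p j x)) * e

lemma IsJet.hasGrad_barrierGrad (h : IsJet O u p A T U) (α β : ℝ) (y : Fin n → ℝ)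
    {x : Fin n → ℝ} (hx : x ∈ O) (h0 : cutoff y x ≠ 0) (i : Fin n) :
    HasGrad (fun x => (cutoff y x)⁻¹ ^ 3 * barrierGrad α β y u p A i x)
      (fun j => -24 * (cutoff y x)⁻¹ ^ 4 * (1 - tilt α β y u p x)
          * ((x i - y i) * (x j - y j))
        + 4 * (cutoff y x)⁻¹ ^ 3 * ((x i - y i)
          * ∑ k, A j k x * (α * (x k - y k) + β * p k x))
        + 4 * (cutoff y x)⁻¹ ^ 3 * ((∑ k, A i k x * (α * (x k - y k) + β * p k x))
          * (x j - y j))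
        + -4 * (1 - tilt α β y u p x) * (cutoff y x)⁻¹ ^ 3 * (if i = j then 1 else 0)
        + (cutoff y x)⁻¹ ^ 2 * ((∑ k, T i j k x * (α * (x k - y k) + β * p k x))
          + α * A i j x + β * ∑ k, A i k x * A k j x)) x := by
  have hs := hasGrad_inv_cutoff h0
  have ht := h.hasGrad_tilt α β y hx
  have hv : HasGrad (fun x => ∑ k, A i k x * (α * (x k - y k) + β * p k x))
      (fun j => (∑ k, T i j k x * (α * (x k - y k) + β * p k x))
          + α * A i j x + β * ∑ k, A i k x * A k j x) x := by
    refine (HasGrad.sum (s := Finset.univ) fun k _ => (h.grad_A x hx i k).mul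
      (((hasGrad_shift y x k).const_mul α).add ((h.grad_p x hx k).const_mul β))).congr_grad
        fun j => ?_
    simp only [Finset.sum_add_distrib, mul_add, mul_ite, mul_one, mul_zero, Finset.sum_ite_eq,
      Finset.mem_univ, if_true, h.symm_T' x hx i j]
    rw [Finset.mul_sum]
    have : ∑ k, A i k x * (β * A k j x) = ∑ k, β * (A i k x * A k j x) :=
      Finset.sum_congr rfl fun k _ => by ring
    rw [this]
    ring
  have h1 := ((hs.mul hs).mul hs).mul ((((((HasGrad.const 1).sub ht).const_mul (-4)).mul
    (hasGrad_shift y x i)).add ((hasGrad_cutoff y x).mul hv)))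
  refine (h1.congr_fun fun x' => by simp only [barrierGrad]; ring).congr_grad fun j => ?_
  have e : (cutoff y x)⁻¹ * cutoff y x = 1 := inv_mul_cancel₀ h0
  simp only [eq_comm (a := j) (b := i)]
  set s := (cutoff y x)⁻¹
  set v := ∑ k, A i k x * (α * (x k - y k) + β * p k x)
  linear_combination (s ^ 2 * ((∑ k, T i j k x * (α * (x k - y k) + β * p k x))
          + α * A i j x + β * ∑ k, A i k x * A k j x) + 6 * s ^ 3 * (x j - y j) * v) * e

lemma IsJet.exists_grad_auxFlux (h : IsJet O u p A T U) (α β N : ℝ) (y : Fin n → ℝ)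
    {x : Fin n → ℝ} (hx : x ∈ O) (h0 : cutoff y x ≠ 0) (hΛ : ∑ i, A i i x ≠ 0)
    {L f ρ g : ℝ} {z w τ df : Fin n → ℝ}
    (hL : ∑ i, A i i x = L) (hf : 2 * f = L ^ 2 - ∑ i, ∑ j, A i j x ^ 2)
    (hρ : cutoff y x = ρ) (hg : tilt α β y u p x = g) (hz : ∀ i, z i = x i - y i)
    (hw : ∀ i, w i = α * (x i - y i) + β * p i x) (hτ : ∀ k, τ k = ∑ i, T i i k x)
    (hdf : ∀ k, df k = L * τ k - ∑ i, ∑ j, A i j x * T i j k x) :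
    ∃ D : Fin n → Fin n → ℝ, (∀ i, HasGrad (auxFlux α β N y u p A T i) (D i) x) ∧
      ∑ i, D i i = (((∑ i, ∑ j, ∑ k, T i j k x ^ 2) - ∑ k, τ k ^ 2) / L
          - linForm (fun i j => A i j x) τ τ / L ^ 2 + (∑ k, df k * τ k) / L ^ 2)
        + N * (-24 * (ρ⁻¹) ^ 4 * (1 - g) * linForm (fun i j => A i j x) z z
          + 8 * (ρ⁻¹) ^ 3 * linForm (fun i j => A i j x) z (fun i => ∑ j, A i j x * w j)
          - 4 * (1 - g) * (ρ⁻¹) ^ 3 * (n - 1) * L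
          + (ρ⁻¹) ^ 2 * ((∑ k, df k * w k) + 2 * α * f
            + β * linTrace (fun i j => A i j x))) := by
  obtain ⟨D1, hD1, hs1⟩ := h.grad_field hx
  obtain ⟨D2, hD2, hs2⟩ := h.grad_linear_flux hx (fun j => h.hasGrad_barrierGrad α β y hx h0 j)
  rw [hL, sum_flux_identity (A := fun i j => A i j x) (T := fun i j k => T i j k x)
    (z := fun i => x i - y i) (w := fun k => α * (x k - y k) + β * p k x)
    (v := fun i => ∑ k, A i k x * (α * (x k - y k) + β * p k x)) (h.symm_A x hx) hL hf
    (fun i j => rfl)] at hs2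
  refine ⟨_, fun i => (((h.grad_trace hx).inv hΛ).mul (hD1 i)).add ((hD2 i).const_mul N), ?_⟩
  have e1 : ∑ i, τ i * ((∑ j, ∑ k, A j k x * T i j k x) - ∑ j, A i j x * ∑ k, T k k j x)
      = linForm (fun i j => A i j x) τ τ - ∑ k, df k * τ k := by
    unfold linForm
    rw [hL, Finset.mul_sum, ← Finset.sum_sub_distrib, ← Finset.sum_sub_distrib]
    refine Finset.sum_congr rfl fun i _ => ?_
    rw [hdf i]
    have a1 : ∑ j, ∑ k, A j k x * T i j k x = ∑ j, ∑ k, A j k x * T j k i x :=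
      Finset.sum_congr rfl fun j _ => Finset.sum_congr rfl fun k _ => by
        rw [h.symm_T x hx i j k, h.symm_T' x hx j i k]
    have a2 : ∑ j, τ i * A i j x * τ j = τ i * ∑ j, A i j x * ∑ k, T k k j x := by
      rw [Finset.mul_sum]
      exact Finset.sum_congr rfl fun j _ => by rw [hτ j]; ring
    rw [a1, a2]; ring
  have e2 : ∀ i, -((∑ i, A i i x) ^ 2)⁻¹ * (∑ k, T k k i x)
      * ((∑ j, ∑ k, A j k x * T i j k x) - ∑ j, A i j x * ∑ k, T k k j x)
      = -(L ^ 2)⁻¹ * (τ i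
      * ((∑ j, ∑ k, A j k x * T i j k x) - ∑ j, A i j x * ∑ k, T k k j x)) := by
    intro i; rw [hL, hτ i]; ring
  have hL0 : L ≠ 0 := hL ▸ hΛ
  simp only [Finset.sum_add_distrib, e2, ← Finset.mul_sum]
  rw [e1, hs1, hs2, hL, hρ, hg]
  simp only [← hτ, ← hdf, hw, ← hz]
  field_simp
  ring

/-- The flux is `F ∇P - ∇f / Λ`. -/
lemma IsJet.auxFlux_eq (h : IsJet O u p A T U) (α β N : ℝ) (y : Fin n → ℝ)
    {x : Fin n → ℝ} (hx : x ∈ O) (hΛ : ∑ i, A i i x ≠ 0) (i : Fin n) :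
    auxFlux α β N y u p A T i x = (∑ k, A k k x) * auxGrad α β N y u p A T i x
      - ∑ j, A i j x * auxGrad α β N y u p A T j x
      - ((∑ k, A k k x) * (∑ k, T k k i x) - ∑ j, ∑ k, A j k x * T j k i x)
        / ∑ k, A k k x := by
  have a1 : ∑ j, ∑ k, A j k x * T i j k x = ∑ j, ∑ k, A j k x * T j k i x :=
    Finset.sum_congr rfl fun j _ => Finset.sum_congr rfl fun k _ => by
      rw [h.symm_T x hx i j k, h.symm_T' x hx j i k]
  have a2 : ∑ j, A i j x * auxGrad α β N y u p A T j x
      = (∑ k, A k k x)⁻¹ * (∑ j, A i j x * ∑ k, T k k j x)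
        + N * ∑ j, A i j x * ((cutoff y x)⁻¹ ^ 3 * barrierGrad α β y u p A j x) := by
    rw [Finset.mul_sum, Finset.mul_sum, ← Finset.sum_add_distrib]
    exact Finset.sum_congr rfl fun j _ => by
      simp only [auxGrad]; rw [div_eq_inv_mul]; ring
  rw [auxFlux, a1, a2, auxGrad]
  field_simp
  ring

end

section zeroExtension

variable {E : Type*} [NormedAddCommGroup E]

lemma ContinuousOn.continuous_of_eq_zero {Ω K : Set E} (hΩ : IsOpen Ω) (hK : IsClosed K)
    (hKΩ : K ⊆ Ω) {f : E → ℝ} (hf : ContinuousOn f Ω) (h0 : ∀ x ∉ K, f x = 0) :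
    Continuous f := by
  rw [continuous_iff_continuousAt]
  intro x
  by_cases hx : x ∈ Ω
  · exact hf.continuousAt (hΩ.mem_nhds hx)
  · have hx' : Kᶜ ∈ nhds x := hK.isOpen_compl.mem_nhds fun h => hx (hKΩ h)
    exact (continuousAt_const (y := (0 : ℝ))).congr
      (Filter.eventually_of_mem hx' fun y hy => (h0 y hy).symm)

variable [NormedSpace ℝ E]

lemma ContDiffOn.contDiff_of_eq_zero {Ω K : Set E} (hΩ : IsOpen Ω) (hK : IsClosed K)
    (hKΩ : K ⊆ Ω) {f : E → ℝ} {m : WithTop ℕ∞} (hf : ContDiffOn ℝ m f Ω)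
    (h0 : ∀ x ∉ K, f x = 0) : ContDiff ℝ m f := by
  rw [contDiff_iff_contDiffAt]
  intro x
  by_cases hx : x ∈ Ω
  · exact hf.contDiffAt (hΩ.mem_nhds hx)
  · have hx' : Kᶜ ∈ nhds x := hK.isOpen_compl.mem_nhds fun h => hx (hKΩ h)
    exact (contDiffAt_const (c := (0 : ℝ))).congr_of_eventuallyEq
      (Filter.eventually_of_mem hx' fun y hy => h0 y hy)

lemma fderiv_eq_zero_of_eq_zero {K : Set E} (hK : IsClosed K) {f : E → ℝ}
    (h0 : ∀ x ∉ K, f x = 0) : ∀ x ∉ K, fderiv ℝ f x = 0 := by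
  intro x hx
  have : f =ᶠ[nhds x] fun _ => (0 : ℝ) :=
    Filter.eventually_of_mem (hK.isOpen_compl.mem_nhds hx) h0
  rw [this.fderiv_eq]
  simp

end zeroExtension

section divergence

open MeasureTheory

variable {n : ℕ}

lemma ContinuousOn.integrable_of_eq_zero {Ω K : Set (Fin n → ℝ)} (hΩ : IsOpen Ω)
    (hK : IsCompact K) (hKΩ : K ⊆ Ω) {f : (Fin n → ℝ) → ℝ} (hf : ContinuousOn f Ω)
    (h0 : ∀ x ∉ K, f x = 0) : Integrable f :=
  (hf.continuous_of_eq_zero hΩ hK.isClosed hKΩ h0).integrable_of_hasCompactSupport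
    (HasCompactSupport.intro hK h0)

/-- Integration by parts for a vector field defined near the support of the test function. -/
lemma integral_mul_divergence {Ω K : Set (Fin n → ℝ)} (hΩ : IsOpen Ω) (hK : IsCompact K)
    (hKΩ : K ⊆ Ω) {G : (Fin n → ℝ) → ℝ} {Y : Fin n → (Fin n → ℝ) → ℝ} (hG : ContDiff ℝ 1 G)
    (h0 : ∀ x ∉ K, G x = 0) (hY : ∀ i, ContDiffOn ℝ 1 (Y i) Ω) :
    ∫ x, G x * ∑ i, fderiv ℝ (Y i) x (Pi.single i 1)
      = -∫ x, ∑ i, fderiv ℝ G x (Pi.single i 1) * Y i x := by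
  have hts : tsupport G ⊆ K :=
    closure_minimal (fun x hx => by
      by_contra h
      exact hx (h0 x h)) hK.isClosed
  have hY' : ∀ i, ContinuousOn (fun x => fderiv ℝ (Y i) x (Pi.single i 1)) Ω := fun i =>
    ((hY i).continuousOn_fderiv_of_isOpen hΩ le_rfl).clm_apply continuousOn_const
  have hG' : ∀ i : Fin n, Continuous fun x => fderiv ℝ G x (Pi.single i 1) := fun i =>
    (hG.continuous_fderiv one_ne_zero).clm_apply continuous_const
  have i1 : ∀ i, Integrable fun x => G x * fderiv ℝ (Y i) x (Pi.single i 1) := fun i =>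
    (hG.continuous.continuousOn.mul (hY' i)).integrable_of_eq_zero hΩ hK hKΩ
      fun x hx => by simp [h0 x hx]
  have i2 : ∀ i, Integrable fun x => fderiv ℝ G x (Pi.single i 1) * Y i x := fun i =>
    ((hG' i).continuousOn.mul (hY i).continuousOn).integrable_of_eq_zero hΩ hK hKΩ
      fun x hx => by simp [fderiv_eq_zero_of_eq_zero hK.isClosed h0 x hx]
  have i3 : ∀ i, Integrable fun x => G x * Y i x := fun i =>
    (hG.continuous.continuousOn.mul (hY i).continuousOn).integrable_of_eq_zero hΩ hK hKΩ
      fun x hx => by simp [h0 x hx]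
  simp only [Finset.mul_sum]
  rw [integral_finsetSum _ fun i _ => i1 i, integral_finsetSum _ fun i _ => i2 i,
    ← Finset.sum_neg_distrib]
  refine Finset.sum_congr rfl fun i _ => ?_
  exact integral_mul_fderiv_eq_neg_fderiv_mul_of_integrable (i2 i) (i1 i) (i3 i)
    (fun x _ => hG.differentiable one_ne_zero x)
    (fun x hx => ((hY i).differentiableOn one_ne_zero).differentiableAt
      (hΩ.mem_nhds (hKΩ (hts hx))))

end divergence

section potential

open MeasureTheory

variable {n : ℕ}

lemma clm_apply_eq_sum (L : (Fin n → ℝ) →L[ℝ] ℝ) (v : Fin n → ℝ) :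
    L v = ∑ m, v m * L (Pi.single m 1) := by
  have : v = ∑ m, v m • (Pi.single m 1 : Fin n → ℝ) := by
    ext k
    simp [Pi.single_apply]
  conv_lhs => rw [this, map_sum]
  exact Finset.sum_congr rfl fun m _ => by rw [map_smul, smul_eq_mul]

lemma contDiff_integral_translate {α : Type*} [TopologicalSpace α] [MeasurableSpace α]
    [OpensMeasurableSpace α] {ν : Measure α} [IsFiniteMeasure ν]
    {γ : α → Fin n → ℝ} {b : α → ℝ} (hγ : Continuous γ) (hb : Continuous b) {B : ℝ}
    (hB : ∀ᵐ a ∂ν, |b a| ≤ B) {h : (Fin n → ℝ) → ℝ} (hh : ContDiff ℝ 1 h)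
    (hc : HasCompactSupport h) :
    (∀ y, HasFDerivAt (fun y => ∫ a, b a * h (y - γ a) ∂ν)
      (∫ a, b a • fderiv ℝ h (y - γ a) ∂ν) y) ∧
    ContDiff ℝ 1 fun y => ∫ a, b a * h (y - γ a) ∂ν := by
  have hh' := hh.continuous_fderiv one_ne_zero
  obtain ⟨C0, hC0⟩ := hh.continuous.bounded_above_of_compact_support hc
  obtain ⟨C1, hC1⟩ := hh'.bounded_above_of_compact_support (hc.fderiv ℝ)
  have m0 : ∀ y, AEStronglyMeasurable (fun a => b a * h (y - γ a)) ν := fun y =>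
    (hb.measurable.mul (hh.continuous.comp
      (continuous_const.sub hγ)).measurable).aestronglyMeasurable
  have m1 : ∀ y, AEStronglyMeasurable (fun a => b a • fderiv ℝ h (y - γ a)) ν := fun y =>
    (hb.measurable.smul (hh'.comp (continuous_const.sub hγ)).measurable).aestronglyMeasurable
  have hb1 : ∀ᵐ a ∂ν, ∀ y, ‖b a • fderiv ℝ h (y - γ a)‖ ≤ B * C1 := by
    filter_upwards [hB] with a ha y
    rw [norm_smul]
    exact mul_le_mul ha (hC1 _) (norm_nonneg _) ((abs_nonneg _).trans ha)
  have hd : ∀ y, HasFDerivAt (fun y => ∫ a, b a * h (y - γ a) ∂ν)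
      (∫ a, b a • fderiv ℝ h (y - γ a) ∂ν) y := by
    intro y
    refine hasFDerivAt_integral_of_dominated_of_fderiv_le (s := univ) (bound := fun _ => B * C1)
      (F' := fun y a => b a • fderiv ℝ h (y - γ a))
      Filter.univ_mem (Filter.Eventually.of_forall m0) ?_ (m1 y)
      (hb1.mono fun a ha y _ => ha y) (integrable_const _) ?_
    · refine Integrable.of_bound (m0 y) (B * C0) ?_
      filter_upwards [hB] with a ha
      rw [norm_mul]
      exact mul_le_mul ha (hC0 _) (norm_nonneg _) ((abs_nonneg _).trans ha)
    · refine Filter.Eventually.of_forall fun a y _ => ?_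
      have h1 : HasFDerivAt h (fderiv ℝ h (y - γ a)) (y - γ a) :=
        (hh.differentiable one_ne_zero _).hasFDerivAt
      have h2 : HasFDerivAt (fun y => y - γ a) (ContinuousLinearMap.id ℝ (Fin n → ℝ)) y :=
        (hasFDerivAt_id y).sub_const (γ a)
      exact (h1.comp y h2).const_mul (b a)
  refine ⟨hd, contDiff_one_iff_hasFDerivAt.2 ⟨_, ?_, hd⟩⟩
  refine continuous_of_dominated m1 (fun y => hb1.mono fun a ha => ha y) (integrable_const (B * C1))
    (Filter.Eventually.of_forall fun a => ?_)
  exact (hh'.comp (continuous_id.sub continuous_const)).const_smul (b a)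

lemma inner_slice_le {ℓ : ℝ} (hn : 2 ≤ n) (hℓ : 0 < ℓ) {h : (Fin n → ℝ) → ℝ} (hc : Continuous h)
    (hcs : HasCompactSupport h) (h0 : ∀ x, 0 ≤ h x) (h1 : ∀ x, h x ≤ 1) (hmass : ∫ x, h x ≤ ℓ ^ n)
    (y : Fin n → ℝ) {s : ℝ} (hs : 0 < s) :
    ∫ ω in Icc (1 : Fin n → ℝ) 2, h (y - s • ω) ≤ 2 * (1 + (s / ℓ) ^ 2)⁻¹ := by
  have hi : Integrable fun ω => h (y - s • ω) := by
    have := (hc.integrable_of_hasCompactSupport (μ := volume) hcs).comp_sub_left y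
    exact this.comp_smul hs.ne'
  have b1 : ∫ ω in Icc (1 : Fin n → ℝ) 2, h (y - s • ω) ≤ 1 := by
    have hfin : volume (Icc (1 : Fin n → ℝ) 2) ≠ ⊤ :=
      (isCompact_Icc (a := (1 : Fin n → ℝ)) (b := 2)).measure_lt_top.ne
    calc ∫ ω in Icc (1 : Fin n → ℝ) 2, h (y - s • ω)
        ≤ ∫ ω in Icc (1 : Fin n → ℝ) 2, (1 : ℝ) :=
          setIntegral_mono hi.integrableOn (integrableOn_const (μ := volume) hfin) fun ω => h1 _
      _ = 1 := by
          simp [Measure.real, Real.volume_Icc_pi]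
          norm_num
  have b2 : ∫ ω in Icc (1 : Fin n → ℝ) 2, h (y - s • ω) ≤ (s ^ n)⁻¹ * ℓ ^ n := by
    calc ∫ ω in Icc (1 : Fin n → ℝ) 2, h (y - s • ω)
        ≤ ∫ ω, h (y - s • ω) :=
          setIntegral_le_integral hi (Filter.Eventually.of_forall fun ω => h0 _)
      _ = (s ^ n)⁻¹ * ∫ x, h x := by
          have := Measure.integral_comp_smul volume (fun ω : Fin n → ℝ => h (y - ω)) s
          rw [this, integral_sub_left_eq_self h volume y]
          simp [abs_of_pos hs]
      _ ≤ _ := by gcongr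
  have hpos : 0 < 1 + (s / ℓ) ^ 2 := by positivity
  rw [← div_eq_mul_inv, le_div_iff₀ hpos]
  rcases le_total s ℓ with hsl | hsl
  · have : (s / ℓ) ^ 2 ≤ 1 := pow_le_one₀ (by positivity) ((div_le_one hℓ).2 hsl)
    have h3 := mul_le_mul b1 (show 1 + (s / ℓ) ^ 2 ≤ 2 by linarith) hpos.le zero_le_one
    linarith
  · have ht : 1 ≤ s / ℓ := (one_le_div hℓ).2 hsl
    have e : (s ^ n)⁻¹ * ℓ ^ n = ((s / ℓ) ^ n)⁻¹ := by
      rw [div_pow, inv_div]; field_simp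
    have h4 : ((s / ℓ) ^ n)⁻¹ ≤ ((s / ℓ) ^ 2)⁻¹ :=
      inv_anti₀ (by positivity) (pow_le_pow_right₀ ht hn)
    have h5 : (1 : ℝ) ≤ (s / ℓ) ^ 2 := one_le_pow₀ ht
    rw [e] at b2
    calc _ ≤ ((s / ℓ) ^ 2)⁻¹ * (1 + (s / ℓ) ^ 2) :=
          mul_le_mul_of_nonneg_right (b2.trans h4) hpos.le
      _ ≤ ((s / ℓ) ^ 2)⁻¹ * (2 * (s / ℓ) ^ 2) := by gcongr; linarith
      _ = 2 := by field_simp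

/-- A bounded vector field with prescribed divergence of small total mass. -/
lemma exists_field_div_eq {ℓ : ℝ} (hn : 2 ≤ n) (hℓ : 0 < ℓ) {h : (Fin n → ℝ) → ℝ}
    (hh : ContDiff ℝ 1 h)
    (hcs : HasCompactSupport h) (h0 : ∀ x, 0 ≤ h x) (h1 : ∀ x, h x ≤ 1) (hmass : ∫ x, h x ≤ ℓ ^ n)
    {K : Set (Fin n → ℝ)} (hK : IsCompact K) :
    ∃ V : Fin n → (Fin n → ℝ) → ℝ, (∀ m, ContDiff ℝ 1 (V m)) ∧ (∀ m x, |V m x| ≤ 8 * ℓ) ∧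
      ∀ x ∈ K, ∑ m, fderiv ℝ (V m) x (Pi.single m 1) = h x := by
  obtain ⟨R1, hR1⟩ := hK.isBounded.subset_closedBall (0 : Fin n → ℝ)
  obtain ⟨R2, hR2⟩ := hcs.isCompact.isBounded.subset_closedBall (0 : Fin n → ℝ)
  set R : ℝ := |R1| + |R2| + 1 with hR
  have hRpos : 0 < R := by positivity
  let ν : Measure (ℝ × (Fin n → ℝ)) :=
    (volume.restrict (Ioc 0 R)).prod (volume.restrict (Icc (1 : Fin n → ℝ) 2))
  have : IsFiniteMeasure (volume.restrict (Icc (1 : Fin n → ℝ) 2)) :=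
    ⟨by simpa using (isCompact_Icc (a := (1 : Fin n → ℝ)) (b := 2)).measure_lt_top⟩
  have hν : ν = (volume.prod volume).restrict (Ioc 0 R ×ˢ Icc (1 : Fin n → ℝ) 2) :=
    Measure.prod_restrict _ _
  have hae : ∀ᵐ a ∂ν, a ∈ Ioc 0 R ×ˢ Icc (1 : Fin n → ℝ) 2 := by
    rw [hν]
    exact ae_restrict_mem (measurableSet_Ioc.prod measurableSet_Icc)
  have hB : ∀ m, ∀ᵐ a ∂ν, |a.2 m| ≤ 2 := fun m => by
    filter_upwards [hae] with a ha
    have l1 := ha.2.1 m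
    have l2 := ha.2.2 m
    simp only [Pi.ofNat_apply] at l1 l2
    rw [abs_le]
    constructor <;> linarith
  have key := fun m => contDiff_integral_translate (ν := ν) (γ := fun a => a.1 • a.2)
    (b := fun a => a.2 m) (by fun_prop) (by fun_prop) (hB m) hh hcs
  have hh' := hh.continuous_fderiv one_ne_zero
  have hslice0 : ∀ y, Integrable (fun a : ℝ × (Fin n → ℝ) => h (y - a.1 • a.2)) ν := fun y => by
    refine Integrable.of_bound (C := 1) ?_ ?_
    · exact (hh.continuous.comp (by fun_prop)).aestronglyMeasurable
    · refine Filter.Eventually.of_forall fun a => ?_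
      rw [Real.norm_eq_abs, abs_of_nonneg (h0 _)]
      exact h1 _
  refine ⟨fun m y => ∫ a, a.2 m * h (y - a.1 • a.2) ∂ν, fun m => (key m).2, ?_, ?_⟩
  · intro m x
    calc |∫ a, a.2 m * h (x - a.1 • a.2) ∂ν|
        ≤ ∫ a, 2 * h (x - a.1 • a.2) ∂ν := by
          refine norm_integral_le_of_norm_le (f := fun a : ℝ × (Fin n → ℝ) =>
            a.2 m * h (x - a.1 • a.2)) ((hslice0 x).const_mul 2) ?_
          filter_upwards [hB m] with a ha
          rw [norm_mul, Real.norm_eq_abs, Real.norm_eq_abs, abs_of_nonneg (h0 _)]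
          exact mul_le_mul_of_nonneg_right ha (h0 _)
      _ = 2 * ∫ s in Ioc 0 R, ∫ ω in Icc (1 : Fin n → ℝ) 2, h (x - s • ω) := by
          rw [integral_const_mul, integral_prod _ (hslice0 x)]
      _ ≤ 2 * ∫ s in Ioc 0 R, 2 * (1 + (s / ℓ) ^ 2)⁻¹ := by
          refine mul_le_mul_of_nonneg_left ?_ zero_le_two
          refine setIntegral_mono_on ((hslice0 x).integral_prod_left) ?_ measurableSet_Ioc
            fun s hs => inner_slice_le hn hℓ hh.continuous hcs h0 h1 hmass x hs.1
          refine (Continuous.integrableOn_Icc ?_).mono_set Ioc_subset_Icc_self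
          refine continuous_const.mul (Continuous.inv₀ (by fun_prop) fun s => ?_)
          positivity
      _ = 4 * ℓ * Real.arctan (R / ℓ) := by
          rw [← intervalIntegral.integral_of_le hRpos.le, intervalIntegral.integral_const_mul,
            intervalIntegral.integral_comp_div (fun s => (1 + s ^ 2)⁻¹) hℓ.ne',
            integral_inv_one_add_sq]
          simp
          ring
      _ ≤ 8 * ℓ := by
          have := Real.arctan_lt_pi_div_two (R / ℓ)
          have := Real.pi_le_four
          nlinarith
  · intro y hy
    have e1 : ∑ m, fderiv ℝ (fun y => ∫ a, a.2 m * h (y - a.1 • a.2) ∂ν) y (Pi.single m 1)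
        = ∫ a, fderiv ℝ h (y - a.1 • a.2) a.2 ∂ν := by
      obtain ⟨C1, hC1⟩ := hh'.bounded_above_of_compact_support (hcs.fderiv ℝ)
      have im : ∀ m, Integrable (fun a : ℝ × (Fin n → ℝ) =>
          a.2 m • fderiv ℝ h (y - a.1 • a.2)) ν := fun m => by
        refine Integrable.of_bound (C := 2 * C1) ?_ ?_
        · have c1 : Continuous fun a : ℝ × (Fin n → ℝ) => y - a.1 • a.2 := by fun_prop
          have c2 : Continuous fun a : ℝ × (Fin n → ℝ) => a.2 m := by fun_prop
          exact (c2.smul (hh'.comp c1)).aestronglyMeasurable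
        · filter_upwards [hB m] with a ha
          rw [norm_smul]
          exact mul_le_mul ha (hC1 _) (norm_nonneg _) zero_le_two
      have : ∀ m, fderiv ℝ (fun y => ∫ a, a.2 m * h (y - a.1 • a.2) ∂ν) y (Pi.single m 1)
          = ∫ a, a.2 m * fderiv ℝ h (y - a.1 • a.2) (Pi.single m 1) ∂ν := fun m => by
        rw [((key m).1 y).fderiv, ContinuousLinearMap.integral_apply (im m)]
        simp
      simp only [this]
      rw [← integral_finsetSum]
      · refine integral_congr_ae (Filter.Eventually.of_forall fun a => ?_)
        exact (clm_apply_eq_sum _ _).symm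
      · intro m _
        have := (im m).apply_continuousLinearMap (Pi.single m 1)
        simpa using this
    rw [e1]
    have ii : Integrable (fun a : ℝ × (Fin n → ℝ) => fderiv ℝ h (y - a.1 • a.2) a.2) ν := by
      obtain ⟨C1, hC1⟩ := hh'.bounded_above_of_compact_support (hcs.fderiv ℝ)
      refine Integrable.of_bound (C := C1 * 2) ?_ ?_
      · exact ((hh'.comp (by fun_prop)).clm_apply continuous_snd).aestronglyMeasurable
      · filter_upwards [ae_all_iff.2 hB] with a ha
        refine (ContinuousLinearMap.le_opNorm _ _).trans ?_
        exact mul_le_mul (hC1 _) ((pi_norm_le_iff_of_nonneg zero_le_two).2 ha) (norm_nonneg _)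
          ((norm_nonneg _).trans (hC1 0))
    rw [integral_prod_symm _ ii]
    have e2 : ∀ ω ∈ Icc (1 : Fin n → ℝ) 2,
        ∫ s in Ioc 0 R, fderiv ℝ h (y - s • ω) ω = h y := by
      intro ω hω
      have hd : ∀ s : ℝ, HasDerivAt (fun s : ℝ => -h (y - s • ω)) (fderiv ℝ h (y - s • ω) ω) s := by
        intro s
        have h1 : HasDerivAt (fun s : ℝ => y - s • ω) (-ω) s := by
          simpa using ((hasDerivAt_id s).smul_const ω).const_sub y
        have h2 := (hh.differentiable one_ne_zero (y - s • ω)).hasFDerivAt.comp_hasDerivAt s h1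
        rw [map_neg] at h2
        have h3 := h2.neg
        rw [neg_neg] at h3
        exact h3
      rw [← intervalIntegral.integral_of_le hRpos.le,
        intervalIntegral.integral_eq_sub_of_hasDerivAt (fun s _ => hd s)]
      · have hz : h (y - R • ω) = 0 := by
          by_contra hne
          have hmem := hR2 (subset_tsupport h hne)
          have hy' := hR1 hy
          rw [mem_closedBall_zero_iff] at hmem hy'
          have i0 : 0 < n := by omega
          have l1 := hω.1 ⟨0, i0⟩
          simp only [Pi.one_apply] at l1
          have l2 := (norm_le_pi_norm (y - R • ω) ⟨0, i0⟩).trans hmem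
          have l3 := (norm_le_pi_norm y ⟨0, i0⟩).trans hy'
          simp only [Pi.sub_apply, Pi.smul_apply, smul_eq_mul, Real.norm_eq_abs] at l2 l3
          have l4 := (abs_le.1 l2).1
          have l5 := (abs_le.1 l3).2
          have l6 := le_abs_self R1
          have l7 := le_abs_self R2
          have l8 : R ≤ R * ω ⟨0, i0⟩ := le_mul_of_one_le_right hRpos.le l1
          linarith
        simp [hz]
      · refine Continuous.intervalIntegrable ?_ _ _
        exact (hh'.comp (by fun_prop)).clm_apply continuous_const
    rw [setIntegral_congr_fun measurableSet_Icc e2]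
    simp [Measure.real, Real.volume_Icc_pi]
    norm_num

end potential

section legendre

open MeasureTheory

variable {n : ℕ}

/-- A smooth majorant of the indicator function of a compact set with almost the same integral. -/
lemma exists_smooth_majorant {S : Set (Fin n → ℝ)} (hS : IsCompact S) {a : ℝ}
    (ha : volume S < ENNReal.ofReal a) :
    ∃ h : (Fin n → ℝ) → ℝ, ContDiff ℝ 1 h ∧ HasCompactSupport h ∧ (∀ x, 0 ≤ h x) ∧
      (∀ x, h x ≤ 1) ∧ (∀ x ∈ S, h x = 1) ∧ ∫ x, h x ≤ a := by
  have ha0 : 0 < a := ENNReal.ofReal_pos.1 (lt_of_le_of_lt zero_le ha)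
  obtain ⟨U, hSU, hU, hUa⟩ := S.exists_isOpen_lt_of_lt _ ha
  obtain ⟨R, hR⟩ := hS.isBounded.subset_ball (0 : Fin n → ℝ)
  obtain ⟨h, h1, h2, h3, h4⟩ := exists_contMDiff_support_eq_eq_one_iff (n := 1)
    (modelWithCornersSelf ℝ (Fin n → ℝ)) (hU.inter (isOpen_ball (x := (0 : Fin n → ℝ)) (ε := R)))
    hS.isClosed (subset_inter hSU hR)
  have h01 : ∀ x, 0 ≤ h x ∧ h x ≤ 1 := fun x => h2 (mem_range_self x)
  have hc : HasCompactSupport h := by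
    refine HasCompactSupport.intro (isCompact_closedBall (0 : Fin n → ℝ) R) fun x hx => ?_
    by_contra hne
    have : x ∈ Function.support h := hne
    rw [h3] at this
    exact hx (ball_subset_closedBall this.2)
  refine ⟨h, contMDiff_iff_contDiff.1 h1, hc, fun x => (h01 x).1, fun x => (h01 x).2,
    fun x hx => (h4 x).1 hx, ?_⟩
  have hfin : volume U ≠ ⊤ := (hUa.trans ENNReal.ofReal_lt_top).ne
  have hi : Integrable h := (contMDiff_iff_contDiff.1 h1).continuous
    |>.integrable_of_hasCompactSupport hc
  calc ∫ x, h x ≤ ∫ x, U.indicator (fun _ => (1 : ℝ)) x := by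
        refine integral_mono hi ((integrable_indicator_iff hU.measurableSet).2
          (integrableOn_const (μ := volume) hfin)) fun x => ?_
        by_cases hx : x ∈ U
        · simpa [hx] using (h01 x).2
        · have : x ∉ Function.support h := by
            rw [h3]
            exact fun hx' => hx hx'.1
          simp [hx, Function.notMem_support.1 this]
    _ = (volume U).toReal := by
        rw [integral_indicator hU.measurableSet]
        simp [Measure.real]
    _ ≤ a := ENNReal.toReal_le_of_le_ofReal ha0.le hUa.le

/-- The map replacing the `j`-th coordinate by the function `q`. -/
def replaceCoord (j : Fin n) (q : (Fin n → ℝ) → ℝ) (x : Fin n → ℝ) : Fin n → ℝ :=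
  Function.update x j (q x)

lemma HasGrad.hasFDerivAt_replaceCoord {j : Fin n} {q : (Fin n → ℝ) → ℝ} {c x : Fin n → ℝ}
    (h : HasGrad q c x) :
    ∃ L : (Fin n → ℝ) →L[ℝ] (Fin n → ℝ), HasFDerivAt (replaceCoord j q) L x ∧ L.det = c j ∧
      ∀ i k, L (Pi.single i 1) k = if k = j then c i else if k = i then 1 else 0 := by
  obtain ⟨q', h1, h2⟩ := h
  let L : (Fin n → ℝ) →L[ℝ] (Fin n → ℝ) :=
    ContinuousLinearMap.pi fun k => if k = j then q' else ContinuousLinearMap.proj k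
  have hL : ∀ i k, L (Pi.single i 1) k = if k = j then c i else if k = i then 1 else 0 := by
    intro i k
    by_cases hk : k = j
    · simp [L, hk, h2]
    · simp [L, hk, Pi.single_apply]
  refine ⟨L, ?_, ?_, hL⟩
  · rw [hasFDerivAt_pi']
    intro k
    by_cases hk : k = j
    · subst hk
      have e1 : (fun y => replaceCoord k q y k) = q := by
        ext y
        simp [replaceCoord]
      have e2 : (ContinuousLinearMap.proj k).comp L = q' := by
        ext y
        simp [L]
      rw [e1, e2]
      exact h1
    · have e1 : (fun y => replaceCoord j q y k) = fun y => y k := by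
        ext y
        simp [replaceCoord, hk]
      have e2 : (ContinuousLinearMap.proj k).comp L = ContinuousLinearMap.proj k := by
        ext y
        simp [L, hk]
      rw [e1, e2]
      exact (ContinuousLinearMap.proj (R := ℝ) (φ := fun _ : Fin n => ℝ) k).hasFDerivAt
  · have e : LinearMap.toMatrix' (L : (Fin n → ℝ) →ₗ[ℝ] (Fin n → ℝ))
        = (1 : Matrix (Fin n) (Fin n) ℝ).transpose.updateRow j c := by
      ext k i
      rw [LinearMap.toMatrix'_apply, Matrix.updateRow_apply]
      rw [ContinuousLinearMap.coe_coe, hL i k]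
      simp [Matrix.one_apply, eq_comm]
    rw [ContinuousLinearMap.det, ← LinearMap.det_toMatrix', e, ← Matrix.cramer_transpose_apply]
    simp

variable {O : Set (Fin n → ℝ)} {u : (Fin n → ℝ) → ℝ}
  {p : Fin n → (Fin n → ℝ) → ℝ} {A : Fin n → Fin n → (Fin n → ℝ) → ℝ}
  {T : Fin n → Fin n → Fin n → (Fin n → ℝ) → ℝ}
  {U : Fin n → Fin n → Fin n → Fin n → (Fin n → ℝ) → ℝ}

lemma HasGrad.comp_replaceCoord {j : Fin n} {q W : (Fin n → ℝ) → ℝ} {c x : Fin n → ℝ}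
    (h : HasGrad q c x) (hW : ContDiff ℝ 1 W) :
    HasGrad (fun x => W (replaceCoord j q x))
      (fun i => fderiv ℝ W (replaceCoord j q x) (Pi.single j 1) * c i
        + if i = j then 0 else fderiv ℝ W (replaceCoord j q x) (Pi.single i 1)) x := by
  obtain ⟨L, hL, -, hL'⟩ := h.hasFDerivAt_replaceCoord (j := j)
  refine ⟨_, ((hW.differentiable one_ne_zero _).hasFDerivAt).comp x hL, fun i => ?_⟩
  rw [ContinuousLinearMap.comp_apply, clm_apply_eq_sum]
  simp only [hL']
  rw [← Finset.add_sum_erase _ _ (Finset.mem_univ j)]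
  simp only [if_true]
  rw [mul_comm]
  congr 1
  rw [Finset.sum_congr rfl (g := fun k =>
    if k = i then fderiv ℝ W (replaceCoord j q x) (Pi.single k 1) else 0)]
  · rw [Finset.sum_ite_eq']
    by_cases hij : i = j <;> simp [hij]
  · intro k hk
    rw [if_neg (Finset.ne_of_mem_erase hk)]
    split_ifs <;> simp

lemma IsJet.contDiffOn_replaceCoord (h : IsJet O u p A T U) (j : Fin n) :
    ContDiffOn ℝ 1 (replaceCoord j (p j)) O := by
  rw [contDiffOn_pi]
  intro k
  by_cases hk : k = j
  · subst hk
    have : (fun y => replaceCoord k (p k) y k) = p k := by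
      ext y
      simp [replaceCoord]
    rw [this]
    exact h.contDiff_p k
  · have : (fun y => replaceCoord j (p j) y k) = fun y => y k := by
      ext y
      simp [replaceCoord, hk]
    rw [this]
    exact (contDiff_apply ℝ ℝ k).contDiffOn

/-- The Piola transform of a field under the partial Legendre map. -/
lemma IsJet.exists_piola (h : IsJet O u p A T U) (j : Fin n)
    {V : Fin n → (Fin n → ℝ) → ℝ} (hV : ∀ m, ContDiff ℝ 1 (V m)) :
    ∃ Y : Fin n → (Fin n → ℝ) → ℝ, (∀ i, ContDiffOn ℝ 1 (Y i) O) ∧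
      (∀ x ∈ O, ∑ i, fderiv ℝ (Y i) x (Pi.single i 1)
        = A j j x * ∑ m, fderiv ℝ (V m) (replaceCoord j (p j) x) (Pi.single m 1)) ∧
      ∀ (x : Fin n → ℝ) (c : Fin n → ℝ), ∑ i, c i * Y i x = c j * V j (replaceCoord j (p j) x)
        + ∑ m, (c m * A j j x - c j * A j m x) * V m (replaceCoord j (p j) x) := by
  let W : Fin n → (Fin n → ℝ) → ℝ := fun m x => V m (replaceCoord j (p j) x)
  have hW : ∀ m, ContDiffOn ℝ 1 (W m) O := fun m =>
    (hV m).comp_contDiffOn (h.contDiffOn_replaceCoord j)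
  refine ⟨fun i x => A j j x * W i x + (if i = j then 1 else 0) * (W j x - ∑ m, A j m x * W m x),
    fun i => ?_, fun x hx => ?_, fun x c => ?_⟩
  · exact ((h.contDiff_A j j).mul (hW i)).add (contDiffOn_const.mul ((hW j).sub
      (ContDiffOn.sum fun m _ => (h.contDiff_A j m).mul (hW m))))
  · have gW := fun m => (h.grad_p x hx j).comp_replaceCoord (j := j) (hV m)
    have gY := fun i => ((h.grad_A x hx j j).mul (gW i)).add (((gW j).sub
      (HasGrad.sum (s := Finset.univ) fun m _ => (h.grad_A x hx j m).mul (gW m))).const_mul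
        (if i = j then 1 else 0))
    rw [Finset.sum_congr rfl fun i _ => (gY i).fderiv_apply i]
    simp only [Finset.sum_add_distrib, ite_mul, one_mul, zero_mul, Finset.sum_ite_eq',
      Finset.mem_univ, if_true, mul_add, add_zero]
    have e1 : ∑ m, T j m j x * V m (replaceCoord j (p j) x)
        = ∑ m, T j j m x * V m (replaceCoord j (p j) x) :=
      Finset.sum_congr rfl fun m _ => by rw [h.symm_T' x hx j m j]
    have e2 : ∑ i, A j j x * (if i = j then 0 else
          fderiv ℝ (V i) (replaceCoord j (p j) x) (Pi.single i 1))
        = A j j x * ∑ m, fderiv ℝ (V m) (replaceCoord j (p j) x) (Pi.single m 1)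
          - A j j x * fderiv ℝ (V j) (replaceCoord j (p j) x) (Pi.single j 1) := by
      rw [← Finset.mul_sum, ← mul_sub]
      congr 1
      rw [← Finset.add_sum_erase _ _ (Finset.mem_univ j),
        ← Finset.add_sum_erase _ (fun m => fderiv ℝ (V m) (replaceCoord j (p j) x) (Pi.single m 1))
          (Finset.mem_univ j)]
      simp only [if_true]
      rw [zero_add, add_sub_cancel_left]
      exact Finset.sum_congr rfl fun m hm => by rw [if_neg (Finset.ne_of_mem_erase hm)]
    have e3 : ∑ m, A j m x * (fderiv ℝ (V m) (replaceCoord j (p j) x) (Pi.single j 1) * A j j x)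
        = ∑ i, A j j x * (fderiv ℝ (V i) (replaceCoord j (p j) x) (Pi.single j 1) * A j i x) :=
      Finset.sum_congr rfl fun m _ => by ring
    simp only [e1, e2, e3, mul_zero, Finset.sum_const_zero]
    ring
  · have e1 : ∀ i, c i * (A j j x * W i x + (if i = j then 1 else 0)
        * (W j x - ∑ m, A j m x * W m x))
        = c i * A j j x * W i x + if i = j then c i * (W j x - ∑ m, A j m x * W m x) else 0 := by
      intro i
      split_ifs <;> ring
    have e2 : ∀ m, (c m * A j j x - c j * A j m x) * W m x
        = c m * A j j x * W m x - c j * (A j m x * W m x) := fun m => by ring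
    change ∑ i, c i * (A j j x * W i x + (if i = j then 1 else 0)
        * (W j x - ∑ m, A j m x * W m x))
        = c j * W j x + ∑ m, (c m * A j j x - c j * A j m x) * W m x
    simp only [e1, e2, Finset.sum_add_distrib, Finset.sum_sub_distrib, Finset.sum_ite_eq',
      Finset.mem_univ, if_true, ← Finset.mul_sum]
    ring

end legendre

section sobolev

open MeasureTheory

variable {n : ℕ} {O : Set (Fin n → ℝ)} {u : (Fin n → ℝ) → ℝ}
  {p : Fin n → (Fin n → ℝ) → ℝ} {A : Fin n → Fin n → (Fin n → ℝ) → ℝ}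
  {T : Fin n → Fin n → Fin n → (Fin n → ℝ) → ℝ}
  {U : Fin n → Fin n → Fin n → Fin n → (Fin n → ℝ) → ℝ}

lemma ContinuousOn.linForm {S : Set (Fin n → ℝ)} {A : Fin n → Fin n → (Fin n → ℝ) → ℝ}
    {a b : Fin n → (Fin n → ℝ) → ℝ} (hA : ∀ i j, ContinuousOn (A i j) S)
    (ha : ∀ i, ContinuousOn (a i) S) (hb : ∀ i, ContinuousOn (b i) S) :
    ContinuousOn (fun x => linForm (fun i j => A i j x) (fun i => a i x) fun i => b i x) S :=
  ((continuousOn_finsetSum _ fun i _ => hA i i).mul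
    (continuousOn_finsetSum _ fun i _ => (ha i).mul (hb i))).sub
    (continuousOn_finsetSum _ fun i _ => continuousOn_finsetSum _ fun j _ =>
      ((ha i).mul (hA i j)).mul (hb j))

lemma IsJet.volume_image_le (h : IsJet O u p A T U) {S : Set (Fin n → ℝ)}
    (hS : IsCompact S) (hSO : S ⊆ O) (j : Fin n) (hA : ∀ x ∈ S, |A j j x| ≤ ∑ i, A i i x) :
    volume (replaceCoord j (p j) '' S) ≤ ENNReal.ofReal (∫ x in S, ∑ i, A i i x) := by
  have h1 := fun x (hx : x ∈ O) => (h.grad_p x hx j).hasFDerivAt_replaceCoord (j := j)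
  choose! L hL hdet _ using h1
  have hc : ContinuousOn (fun x => ∑ i, A i i x) S :=
    (continuousOn_finsetSum _ fun i _ => (h.contDiff_A i i).continuousOn).mono hSO
  rw [ofReal_integral_eq_lintegral_ofReal (hc.integrableOn_compact hS)]
  · refine (addHaar_image_le_lintegral_abs_det_fderiv volume hS.measurableSet
      fun x hx => (hL x (hSO hx)).hasFDerivWithinAt).trans ?_
    refine setLIntegral_mono' hS.measurableSet fun x hx => ?_
    rw [hdet x (hSO hx)]
    exact ENNReal.ofReal_le_ofReal (hA x hx)
  · exact (ae_restrict_iff' hS.measurableSet).2 (Filter.Eventually.of_forall fun x hx =>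
      (abs_nonneg _).trans (hA x hx))

/-- The pointwise bound of the pairing of a gradient with a transformed field. -/
lemma SigmaTwoPos.pairing_le {a : Fin n → Fin n → ℝ} {L f K : ℝ} (h : SigmaTwoPos a L f K)
    (c v : Fin n → ℝ) (j : Fin n) {B : ℝ} (hv : ∀ m, |v m| ≤ B) :
    |c j * v j + ∑ m, (c m * a j j - c j * a j m) * v m|
      ≤ (√K + n * √2) * B * √(L * linForm a c c) := by
  have hB : 0 ≤ B := (abs_nonneg _).trans (hv j)
  have hF := h.linForm_self_nonneg c
  have hLF : 0 ≤ L * linForm a c c := mul_nonneg h.posL.le hF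
  have h1 : |c j| ≤ √K * √(L * linForm a c c) := by
    rw [← Real.sqrt_mul h.posK.le]
    refine Real.abs_le_sqrt ?_
    rw [← mul_assoc]
    exact (Finset.single_le_sum (f := fun i => c i ^ 2) (fun i _ => sq_nonneg _)
      (Finset.mem_univ j)).trans (h.sum_sq_le_linForm c)
  have h2 : ∀ m, |c m * a j j - c j * a j m| ≤ √2 * √(L * linForm a c c) := by
    intro m
    by_cases hm : m = j
    · subst hm
      simp only [sub_self, abs_zero]
      positivity
    · rw [← Real.sqrt_mul zero_le_two]
      refine Real.abs_le_sqrt ?_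
      rw [← mul_assoc]
      exact h.minor_sq_le c hm
  calc |c j * v j + ∑ m, (c m * a j j - c j * a j m) * v m|
      ≤ |c j * v j| + ∑ m, |(c m * a j j - c j * a j m) * v m| :=
        (abs_add_le _ _).trans (add_le_add le_rfl (Finset.abs_sum_le_sum_abs _ _))
    _ ≤ √K * √(L * linForm a c c) * B + ∑ _m : Fin n, √2 * √(L * linForm a c c) * B := by
        gcongr with m
        · rw [abs_mul]
          exact mul_le_mul h1 (hv j) (abs_nonneg _) (by positivity)
        · rw [abs_mul]
          exact mul_le_mul (h2 m) (hv m) (abs_nonneg _) (by positivity)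
    _ = (√K + n * √2) * B * √(L * linForm a c c) := by
        simp
        ring

lemma IsJet.integral_mul_diag_le (h : IsJet O u p A T U) (hn : 2 ≤ n) (hO : IsOpen O)
    {f : (Fin n → ℝ) → ℝ} {K : ℝ}
    (hσ : ∀ x ∈ O, SigmaTwoPos (fun i j => A i j x) (∑ i, A i i x) (f x) K)
    {S : Set (Fin n → ℝ)} (hS : IsCompact S) (hSO : S ⊆ O) {ℓ : ℝ} (hℓ : 0 < ℓ)
    (hmass : ∫ x in S, ∑ i, A i i x < ℓ ^ n) {φ : (Fin n → ℝ) → ℝ} (hφ : ContDiff ℝ 1 φ)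
    (h0 : ∀ x ∉ S, φ x = 0) (j : Fin n) :
    ∫ x, φ x * A j j x ≤ (√K + n * √2) * (8 * ℓ) * ∫ x, √((∑ i, A i i x) *
      linForm (fun i j => A i j x) (fun i => fderiv ℝ φ x (Pi.single i 1))
        (fun i => fderiv ℝ φ x (Pi.single i 1))) := by
  have hvol : volume (replaceCoord j (p j) '' S) < ENNReal.ofReal (ℓ ^ n) :=
    (h.volume_image_le hS hSO j fun x hx => (hσ x (hSO hx)).abs_entry_le j j).trans_lt
      ((ENNReal.ofReal_lt_ofReal_iff (by positivity)).2 hmass)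
  have hcomp : IsCompact (replaceCoord j (p j) '' S) :=
    hS.image_of_continuousOn ((h.contDiffOn_replaceCoord j).continuousOn.mono hSO)
  obtain ⟨η, e1, e2, e3, e4, e5, e6⟩ := exists_smooth_majorant hcomp hvol
  obtain ⟨V, hV, hVb, hVd⟩ := exists_field_div_eq hn hℓ e1 e2 e3 e4 e6 hcomp
  obtain ⟨Y, hY, hYd, hYp⟩ := h.exists_piola j hV
  have key := integral_mul_divergence hO hS hSO hφ h0 hY
  have l1 : ∫ x, φ x * A j j x = ∫ x, φ x * ∑ i, fderiv ℝ (Y i) x (Pi.single i 1) := by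
    refine integral_congr_ae (Filter.Eventually.of_forall fun x => ?_)
    by_cases hx : x ∈ S
    · have := mem_image_of_mem (replaceCoord j (p j)) hx
      simp only
      rw [hYd x (hSO hx), hVd _ this, e5 _ this, mul_one]
    · simp [h0 x hx]
  have hd0 := fderiv_eq_zero_of_eq_zero hS.isClosed h0
  have cd : ∀ i : Fin n, ContinuousOn (fun x => fderiv ℝ φ x (Pi.single i 1)) O := fun i =>
    ((hφ.continuous_fderiv one_ne_zero).clm_apply continuous_const).continuousOn
  have cA := fun i j => (h.contDiff_A i j).continuousOn
  rw [l1, key, ← integral_neg, ← integral_const_mul]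
  refine integral_mono ?_ ?_ fun x => ?_
  · refine Integrable.neg (ContinuousOn.integrable_of_eq_zero hO hS hSO
      (continuousOn_finsetSum _ fun i _ => (cd i).mul (hY i).continuousOn) fun x hx => ?_)
    simp [hd0 x hx]
  · refine Integrable.const_mul (ContinuousOn.integrable_of_eq_zero hO hS hSO
      (ContinuousOn.sqrt (((continuousOn_finsetSum _ fun i _ => cA i i)).mul
        (ContinuousOn.linForm cA cd cd))) fun x hx => ?_) _
    simp [hd0 x hx, linForm]
  · by_cases hx : x ∈ S
    · simp only
      rw [hYp x]
      exact (neg_le_abs _).trans ((hσ x (hSO hx)).pairing_le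
        (fun i => fderiv ℝ φ x (Pi.single i 1))
        (fun m => V m (replaceCoord j (p j) x)) j fun m => hVb m _)
    · simp [hd0 x hx, linForm]

/-- The Sobolev-type inequality for the linearized operator. -/
lemma IsJet.integral_mul_trace_le (h : IsJet O u p A T U) (hn : 2 ≤ n) (hO : IsOpen O)
    {f : (Fin n → ℝ) → ℝ} {K : ℝ}
    (hσ : ∀ x ∈ O, SigmaTwoPos (fun i j => A i j x) (∑ i, A i i x) (f x) K)
    {S : Set (Fin n → ℝ)} (hS : IsCompact S) (hSO : S ⊆ O) {ℓ : ℝ} (hℓ : 0 < ℓ)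
    (hmass : ∫ x in S, ∑ i, A i i x < ℓ ^ n) {φ : (Fin n → ℝ) → ℝ} (hφ : ContDiff ℝ 1 φ)
    (h0 : ∀ x ∉ S, φ x = 0) :
    ∫ x, φ x * ∑ i, A i i x ≤ (n * (√K + n * √2) * 8) * ℓ * ∫ x, √((∑ i, A i i x) *
      linForm (fun i j => A i j x) (fun i => fderiv ℝ φ x (Pi.single i 1))
        (fun i => fderiv ℝ φ x (Pi.single i 1))) := by
  simp only [Finset.mul_sum]
  rw [integral_finsetSum]
  · refine (Finset.sum_le_sum fun j _ =>
      h.integral_mul_diag_le hn hO hσ hS hSO hℓ hmass hφ h0 j).trans (le_of_eq ?_)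
    rw [Finset.sum_const, Finset.card_univ, Fintype.card_fin, nsmul_eq_mul]
    ring
  · intro j _
    exact (hφ.continuous.continuousOn.mul (h.contDiff_A j j).continuousOn).integrable_of_eq_zero
      hO hS hSO fun x hx => by simp [h0 x hx]

end sobolev

section truncation

open MeasureTheory

lemma hasDerivAt_max_sq (s : ℝ) : HasDerivAt (fun s : ℝ => (max s 0) ^ 2) (2 * max s 0) s := by
  rcases lt_trichotomy s 0 with hs | rfl | hs
  · have h1 : (fun s : ℝ => (max s 0) ^ 2) =ᶠ[nhds s] fun _ => 0 := by
      filter_upwards [gt_mem_nhds hs] with t ht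
      rw [max_eq_right ht.le]
      simp
    rw [max_eq_right hs.le, mul_zero]
    exact (hasDerivAt_const s (0 : ℝ)).congr_of_eventuallyEq h1
  · rw [max_self, mul_zero, hasDerivAt_iff_isLittleO]
    simp only [max_self, sub_zero, smul_zero, ne_eq, OfNat.ofNat_ne_zero, not_false_eq_true,
      zero_pow]
    refine Asymptotics.IsBigO.trans_isLittleO (g := fun s : ℝ => s ^ 2) ?_ ?_
    · refine Asymptotics.IsBigO.of_bound 1 (Filter.Eventually.of_forall fun t => ?_)
      rw [Real.norm_eq_abs, Real.norm_eq_abs, abs_of_nonneg (sq_nonneg _),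
        abs_of_nonneg (sq_nonneg _), one_mul]
      rcases le_total t 0 with h | h
      · rw [max_eq_right h]
        nlinarith
      · rw [max_eq_left h]
    · exact Asymptotics.isLittleO_pow_id one_lt_two
  · have h1 : (fun s : ℝ => (max s 0) ^ 2) =ᶠ[nhds s] fun t => t ^ 2 := by
      filter_upwards [lt_mem_nhds hs] with t ht
      rw [max_eq_left ht.le]
    rw [max_eq_left hs.le]
    simpa using (hasDerivAt_pow 2 s).congr_of_eventuallyEq h1

lemma contDiff_one_of_hasDerivAt {η η' : ℝ → ℝ} (hη : ∀ s, HasDerivAt η (η' s) s)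
    (hη' : Continuous η') : ContDiff ℝ 1 η := by
  rw [contDiff_one_iff_deriv]
  refine ⟨fun s => (hη s).differentiableAt, ?_⟩
  have : deriv η = η' := funext fun s => (hη s).deriv
  rwa [this]

variable {n : ℕ}

/-- Truncation of a function at a level whose superlevel set is compact. -/
lemma contDiff_truncation {Ω S : Set (Fin n → ℝ)} (hΩ : IsOpen Ω) (hS : IsCompact S)
    (hSΩ : S ⊆ Ω) {P : (Fin n → ℝ) → ℝ} {q : Fin n → (Fin n → ℝ) → ℝ} {k : ℝ}
    (hP : ContDiffOn ℝ 1 P Ω) (hq : ∀ x ∈ Ω, HasGrad P (fun i => q i x) x)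
    (hk : ∀ x ∈ Ω, x ∉ S → P x ≤ k) {η η' : ℝ → ℝ} (hη : ∀ s, HasDerivAt η (η' s) s)
    (hη' : Continuous η') (h0 : ∀ s ≤ 0, η s = 0) :
    ContDiff ℝ 1 (Ω.indicator fun x => η (P x - k)) ∧
      (∀ x ∉ S, Ω.indicator (fun x => η (P x - k)) x = 0) ∧
      ∀ x ∈ Ω, ∀ i, fderiv ℝ (Ω.indicator fun x => η (P x - k)) x (Pi.single i 1)
        = η' (P x - k) * q i x := by
  have hz : ∀ x ∉ S, Ω.indicator (fun x => η (P x - k)) x = 0 := by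
    intro x hx
    by_cases hxΩ : x ∈ Ω
    · rw [indicator_of_mem hxΩ]
      exact h0 _ (by linarith [hk x hxΩ hx])
    · rw [indicator_of_notMem hxΩ]
  refine ⟨?_, hz, ?_⟩
  · refine ContDiffOn.contDiff_of_eq_zero hΩ hS.isClosed hSΩ ?_ hz
    refine ContDiffOn.congr (f := fun x => η (P x - k)) ?_
      fun x hx => indicator_of_mem hx _
    exact (contDiff_one_of_hasDerivAt hη hη').comp_contDiffOn (hP.sub contDiffOn_const)
  · intro x hx i
    have h1 : (Ω.indicator fun x => η (P x - k)) =ᶠ[nhds x] fun x => η (P x - k) :=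
      Filter.eventually_of_mem (hΩ.mem_nhds hx) fun y hy => indicator_of_mem hy _
    rw [h1.fderiv_eq]
    have h2 : HasGrad (fun x => P x - k) (fun i => q i x - 0) x :=
      (hq x hx).sub (HasGrad.const k)
    have h3 := HasGrad.comp (f := fun x => P x - k) (hη (P x - k)) h2
    rw [h3.fderiv_apply i, sub_zero]

end truncation

section energy

open MeasureTheory

variable {n : ℕ}

lemma exp_weight_bounds {s : ℝ} (hs : 0 ≤ s) :
    s ^ 2 ≤ s ^ 2 * Real.exp s ∧ 2 * s ≤ (2 * s + s ^ 2) * Real.exp s ∧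
      s ^ 2 * Real.exp s ≤ (2 * s + s ^ 2) * Real.exp s ∧
      (2 * s + s ^ 2) * Real.exp s ≤ 3 * (s ^ 2 * Real.exp s) + 6 := by
  have h1 : 1 ≤ Real.exp s := Real.one_le_exp hs
  have h2 : 0 < Real.exp s := Real.exp_pos s
  refine ⟨by nlinarith [sq_nonneg s], by nlinarith [sq_nonneg s], by nlinarith, ?_⟩
  rcases le_total s 1 with h | h
  · have h3 : Real.exp s ≤ 3 := (Real.exp_le_exp.2 h).trans (by linarith [Real.exp_one_lt_d9])
    have h4 : s * Real.exp s ≤ 1 * 3 := mul_le_mul h h3 h2.le zero_le_one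
    have h5 : 0 ≤ s ^ 2 * Real.exp s := by positivity
    nlinarith
  · have h4 : s * Real.exp s ≤ s ^ 2 * Real.exp s :=
      mul_le_mul_of_nonneg_right (by nlinarith) h2.le
    nlinarith

/-- The energy pairing controls the flux: `q · Y ≥ ¾ F(q, q) - C Λ`. -/
lemma SigmaTwoPos.flux_lower {A : Fin n → Fin n → ℝ} {L f K Cf : ℝ} (h : SigmaTwoPos A L f K)
    {q X Y : Fin n → ℝ} (hY : ∀ i, Y i = L * q i - ∑ j, A i j * q j - X i)
    (hX : ∑ i, X i ^ 2 ≤ Cf ^ 2) :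
    3 / 4 * linForm A q q - K * Cf ^ 2 * L ≤ ∑ i, q i * Y i := by
  have e1 : ∑ i, q i * Y i = linForm A q q - ∑ i, q i * X i := by
    simp only [hY, linForm, h.trace]
    rw [Finset.mul_sum, ← Finset.sum_sub_distrib, ← Finset.sum_sub_distrib]
    refine Finset.sum_congr rfl fun i _ => ?_
    have : ∑ j, q i * A i j * q j = q i * ∑ j, A i j * q j := by
      rw [Finset.mul_sum]
      exact Finset.sum_congr rfl fun j _ => by ring
    rw [this]
    ring
  have h1 : (∑ i, q i * X i) ^ 2 ≤ (∑ i, q i ^ 2) * ∑ i, X i ^ 2 :=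
    Finset.sum_mul_sq_le_sq_mul_sq _ _ _
  have h2 := h.sum_sq_le_linForm q
  have h3 := h.linForm_self_nonneg q
  have h4 : 0 ≤ K * Cf ^ 2 * L := mul_nonneg (mul_nonneg h.posK.le (sq_nonneg _)) h.posL.le
  have h5 : (∑ i, q i * X i) ^ 2 ≤ (K * Cf ^ 2 * L) * linForm A q q := by
    calc _ ≤ (∑ i, q i ^ 2) * ∑ i, X i ^ 2 := h1
      _ ≤ (K * L * linForm A q q) * Cf ^ 2 :=
        mul_le_mul h2 hX (Finset.sum_nonneg fun i _ => sq_nonneg _)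
          ((Finset.sum_nonneg fun i _ => sq_nonneg _).trans h2)
      _ = _ := by ring
  have h6 : ∑ i, q i * X i ≤ 1 / 4 * linForm A q q + K * Cf ^ 2 * L := by
    refine le_of_sq_le_sq ?_ (by linarith)
    nlinarith [sq_nonneg (1 / 4 * linForm A q q - K * Cf ^ 2 * L)]
  linarith

end energy

section energy

open MeasureTheory

variable {n : ℕ} {O : Set (Fin n → ℝ)} {u : (Fin n → ℝ) → ℝ} {p : Fin n → (Fin n → ℝ) → ℝ}
  {A : Fin n → Fin n → (Fin n → ℝ) → ℝ} {T : Fin n → Fin n → Fin n → (Fin n → ℝ) → ℝ}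
  {U : Fin n → Fin n → Fin n → Fin n → (Fin n → ℝ) → ℝ}

/-- Energy estimate for the truncation of a function satisfying a quasilinear divergence
inequality on a compact superlevel set. -/
lemma energy_le {Ω S : Set (Fin n → ℝ)} (hΩ : IsOpen Ω) (hS : IsCompact S) (hSΩ : S ⊆ Ω)
    {f P : (Fin n → ℝ) → ℝ} {q X Y : Fin n → (Fin n → ℝ) → ℝ} {k K Cf N : ℝ}
    (hA : ∀ i j, ContinuousOn (A i j) Ω)
    (hσ : ∀ x ∈ Ω, SigmaTwoPos (fun i j => A i j x) (∑ i, A i i x) (f x) K)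
    (hP : ContDiffOn ℝ 1 P Ω) (hq : ∀ x ∈ Ω, HasGrad P (fun i => q i x) x)
    (hqc : ∀ i, ContinuousOn (q i) Ω)
    (hk : ∀ x ∈ Ω, x ∉ S → P x ≤ k) (hkS : ∀ x ∈ S, k ≤ P x)
    (hY1 : ∀ i, ContDiffOn ℝ 1 (Y i) Ω)
    (hY : ∀ x ∈ Ω, ∀ i, Y i x = (∑ l, A l l x) * q i x - ∑ j, A i j x * q j x - X i x)
    (hX : ∀ x ∈ Ω, ∑ i, X i x ^ 2 ≤ Cf ^ 2) (hN : 3 * (K * Cf ^ 2) + 1 ≤ N)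
    (hdiv : ∀ x ∈ S, N * ∑ i, A i i x ≤ ∑ i, fderiv ℝ (Y i) x (Pi.single i 1)
      + 1 / 4 * linForm (fun i j => A i j x) (fun i => q i x) (fun i => q i x)) :
    ∫ x in S, ((P x - k) ^ 2 * (∑ i, A i i x)
        + (P x - k) * linForm (fun i j => A i j x) (fun i => q i x) (fun i => q i x))
      ≤ (6 * (K * Cf ^ 2)) * ∫ x in S, ∑ i, A i i x := by
  set η : ℝ → ℝ := fun s => (max s 0) ^ 2 * Real.exp s with hη
  set η' : ℝ → ℝ := fun s => (2 * max s 0 + (max s 0) ^ 2) * Real.exp s with hη'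
  have hd : ∀ s, HasDerivAt η (η' s) s := fun s => by
    have := (hasDerivAt_max_sq s).mul (Real.hasDerivAt_exp s)
    refine this.congr_deriv ?_
    simp only [hη']
    ring
  have hη'c : Continuous η' := by fun_prop
  have hηc : Continuous η := by fun_prop
  obtain ⟨g1, g2, g3⟩ := contDiff_truncation hΩ hS hSΩ hP hq hk hd hη'c
    (fun s hs => by simp [hη, max_eq_right hs])
  set G := Ω.indicator fun x => η (P x - k) with hG
  have hGS : ∀ x ∈ S, G x = η (P x - k) := fun x hx => indicator_of_mem (hSΩ hx) _
  have hibp := integral_mul_divergence hΩ hS hSΩ g1 g2 hY1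
  have r1 := setIntegral_eq_integral_of_forall_compl_eq_zero (μ := volume) (s := S)
    (f := fun x => G x * ∑ i, fderiv ℝ (Y i) x (Pi.single i 1))
    fun x hx => by simp only [g2 x hx, zero_mul]
  have r2 := setIntegral_eq_integral_of_forall_compl_eq_zero (μ := volume) (s := S)
    (f := fun x => ∑ i, fderiv ℝ G x (Pi.single i 1) * Y i x)
    fun x hx => by simp [fderiv_eq_zero_of_eq_zero hS.isClosed g2 x hx]
  rw [← r1, ← r2] at hibp
  have hPc : ContinuousOn P S := hP.continuousOn.mono hSΩ
  have hAc : ContinuousOn (fun x => ∑ i, A i i x) S :=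
    continuousOn_finsetSum _ fun i _ => (hA i i).mono hSΩ
  have hFc : ContinuousOn (fun x => linForm (fun i j => A i j x) (fun i => q i x)
      (fun i => q i x)) S :=
    ContinuousOn.linForm (fun i j => (hA i j).mono hSΩ) (fun i => (hqc i).mono hSΩ)
      (fun i => (hqc i).mono hSΩ)
  have hDc : ContinuousOn (fun x => ∑ i, fderiv ℝ (Y i) x (Pi.single i 1)) S :=
    continuousOn_finsetSum _ fun i _ =>
      (((hY1 i).continuousOn_fderiv_of_isOpen hΩ le_rfl).clm_apply continuousOn_const).mono hSΩ
  have hqY : ContinuousOn (fun x => ∑ i, q i x * Y i x) S :=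
    continuousOn_finsetSum _ fun i _ =>
      ((hqc i).mono hSΩ).mul ((hY1 i).continuousOn.mono hSΩ)
  have hsc : ContinuousOn (fun x => P x - k) S := hPc.sub continuousOn_const
  have hms := hS.measurableSet
  have e1 : ∫ x in S, G x * ∑ i, fderiv ℝ (Y i) x (Pi.single i 1)
      = ∫ x in S, η (P x - k) * ∑ i, fderiv ℝ (Y i) x (Pi.single i 1) :=
    setIntegral_congr_fun hms fun x hx => by simp only [hGS x hx]
  have e2 : ∫ x in S, ∑ i, fderiv ℝ G x (Pi.single i 1) * Y i x
      = ∫ x in S, η' (P x - k) * ∑ i, q i x * Y i x :=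
    setIntegral_congr_fun hms fun x hx => by
      simp only [Finset.mul_sum]
      exact Finset.sum_congr rfl fun i _ => by rw [g3 x (hSΩ hx) i]; ring
  rw [e1, e2] at hibp
  have i1 : IntegrableOn (fun x => η (P x - k) * ∑ i, fderiv ℝ (Y i) x (Pi.single i 1)) S :=
    ((hηc.comp_continuousOn hsc).mul hDc).integrableOn_compact hS
  have i2 : IntegrableOn (fun x => η' (P x - k) * ∑ i, q i x * Y i x) S :=
    ((hη'c.comp_continuousOn hsc).mul hqY).integrableOn_compact hS
  have i3 : IntegrableOn (fun x => ((P x - k) ^ 2 * (∑ i, A i i x)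
        + (P x - k) * linForm (fun i j => A i j x) (fun i => q i x) (fun i => q i x))) S :=
    (((hsc.pow 2).mul hAc).add (hsc.mul hFc)).integrableOn_compact hS
  have i4 : IntegrableOn (fun x => (6 * (K * Cf ^ 2)) * ∑ i, A i i x) S :=
    (continuousOn_const.mul hAc).integrableOn_compact hS
  have key : ∫ x in S, (((P x - k) ^ 2 * (∑ i, A i i x)
        + (P x - k) * linForm (fun i j => A i j x) (fun i => q i x) (fun i => q i x))
        - (6 * (K * Cf ^ 2)) * ∑ i, A i i x)
      ≤ ∫ x in S, (η (P x - k) * ∑ i, fderiv ℝ (Y i) x (Pi.single i 1)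
        + η' (P x - k) * ∑ i, q i x * Y i x) := by
    refine setIntegral_mono_on (i3.sub i4) (i1.add i2) hms fun x hx => ?_
    have hs : 0 ≤ P x - k := by linarith [hkS x hx]
    have hxΩ := hSΩ hx
    have hσx := hσ x hxΩ
    obtain ⟨b1, b2, b3, b4⟩ := exp_weight_bounds hs
    have hfl := hσx.flux_lower (q := fun i => q i x) (fun i => hY x hxΩ i) (hX x hxΩ)
    have hdx := hdiv x hx
    have hF := hσx.linForm_self_nonneg (fun i => q i x)
    have hL := hσx.posL
    have hC : 0 ≤ K * Cf ^ 2 := mul_nonneg hσx.posK.le (sq_nonneg _)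
    simp only [hη, hη', max_eq_left hs]
    generalize linForm (fun i j => A i j x) (fun i => q i x) (fun i => q i x) = F at *
    generalize (∑ i, A i i x) = Λ at *
    generalize (∑ i, fderiv ℝ (Y i) x (Pi.single i 1)) = D at *
    generalize (∑ i, q i x * Y i x) = Q at *
    generalize P x - k = s at *
    generalize K * Cf ^ 2 = C at *
    clear hibp e1 e2 i1 i2 i3 i4
    generalize s ^ 2 * Real.exp s = a at *
    generalize (2 * s + s ^ 2) * Real.exp s = b at *
    have ha : 0 ≤ a := (sq_nonneg s).trans b1
    have hb : 0 ≤ b := ha.trans b3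
    have t1 : a * (N * Λ - 1 / 4 * F) ≤ a * D := mul_le_mul_of_nonneg_left (by linarith) ha
    have t2 : b * (3 / 4 * F - C * Λ) ≤ b * Q := mul_le_mul_of_nonneg_left hfl hb
    have t3 : (a * Λ) * (3 * C + 1) ≤ (a * Λ) * N :=
      mul_le_mul_of_nonneg_left hN (mul_nonneg ha hL.le)
    have t4 : a * F ≤ b * F := mul_le_mul_of_nonneg_right b3 hF
    have t5 : 2 * s * F ≤ b * F := mul_le_mul_of_nonneg_right b2 hF
    have t6 : b * (C * Λ) ≤ (3 * a + 6) * (C * Λ) :=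
      mul_le_mul_of_nonneg_right b4 (mul_nonneg hC hL.le)
    have t7 : s ^ 2 * Λ ≤ a * Λ := mul_le_mul_of_nonneg_right b1 hL.le
    linarith only [t1, t2, t3, t4, t5, t6, t7]
  rw [integral_sub i3 i4, integral_add i1 i2, integral_const_mul, hibp] at key
  linarith

/-- The truncated Sobolev step in the De Giorgi iteration. -/
lemma IsJet.level_decay (h : IsJet O u p A T U) (hn : 2 ≤ n) (hO : IsOpen O)
    {Ω S : Set (Fin n → ℝ)} (hΩ : IsOpen Ω) (hΩO : Ω ⊆ O) (hS : IsCompact S) (hSΩ : S ⊆ Ω)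
    {f P : (Fin n → ℝ) → ℝ} {q : Fin n → (Fin n → ℝ) → ℝ} {k K C ℓ : ℝ}
    (hσ : ∀ x ∈ O, SigmaTwoPos (fun i j => A i j x) (∑ i, A i i x) (f x) K)
    (hP : ContDiffOn ℝ 1 P Ω) (hq : ∀ x ∈ Ω, HasGrad P (fun i => q i x) x)
    (hqc : ∀ i, ContinuousOn (q i) Ω)
    (hk : ∀ x ∈ Ω, x ∉ S → P x ≤ k) (hkS : ∀ x ∈ S, k ≤ P x)
    (hen : ∫ x in S, ((P x - k) ^ 2 * (∑ i, A i i x)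
        + (P x - k) * linForm (fun i j => A i j x) (fun i => q i x) (fun i => q i x))
      ≤ C * ∫ x in S, ∑ i, A i i x)
    (hℓ : 0 < ℓ) (hmass : ∫ x in S, ∑ i, A i i x < ℓ ^ n) :
    ∫ x in S, (P x - k) ^ 2 * (∑ i, A i i x)
      ≤ ((n * (√K + n * √2) * 8) * (1 + C)) * ℓ * ∫ x in S, ∑ i, A i i x := by
  obtain ⟨g1, g2, g3⟩ := contDiff_truncation hΩ hS hSΩ hP hq hk hasDerivAt_max_sq
    (by fun_prop) (fun s hs => by simp [max_eq_right hs])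
  set G := Ω.indicator fun x => (max (P x - k) 0) ^ 2 with hG
  have hsob := h.integral_mul_trace_le hn hO hσ hS (hSΩ.trans hΩO) hℓ hmass g1 g2
  have hms := hS.measurableSet
  have hPc : ContinuousOn P S := hP.continuousOn.mono hSΩ
  have hA : ∀ i j, ContinuousOn (A i j) S := fun i j =>
    (h.contDiff_A i j).continuousOn.mono (hSΩ.trans hΩO)
  have hAc : ContinuousOn (fun x => ∑ i, A i i x) S :=
    continuousOn_finsetSum _ fun i _ => hA i i
  have hFc : ContinuousOn (fun x => linForm (fun i j => A i j x) (fun i => q i x)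
      (fun i => q i x)) S :=
    ContinuousOn.linForm hA (fun i => (hqc i).mono hSΩ) (fun i => (hqc i).mono hSΩ)
  have hsc : ContinuousOn (fun x => P x - k) S := hPc.sub continuousOn_const
  have r1 := setIntegral_eq_integral_of_forall_compl_eq_zero (μ := volume) (s := S)
    (f := fun x => G x * ∑ i, A i i x) fun x hx => by simp only [g2 x hx, zero_mul]
  have r2 := setIntegral_eq_integral_of_forall_compl_eq_zero (μ := volume) (s := S)
    (f := fun x => √((∑ i, A i i x) * linForm (fun i j => A i j x)
      (fun i => fderiv ℝ G x (Pi.single i 1)) (fun i => fderiv ℝ G x (Pi.single i 1))))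
    fun x hx => by simp [fderiv_eq_zero_of_eq_zero hS.isClosed g2 x hx, linForm]
  rw [← r1, ← r2] at hsob
  have e1 : ∫ x in S, G x * ∑ i, A i i x = ∫ x in S, (P x - k) ^ 2 * ∑ i, A i i x :=
    setIntegral_congr_fun hms fun x hx => by
      have : G x = (max (P x - k) 0) ^ 2 := indicator_of_mem (hSΩ hx) _
      simp only [this]
      rw [max_eq_left (by linarith [hkS x hx])]
  rw [e1] at hsob
  refine hsob.trans ?_
  have i3 : IntegrableOn (fun x => ((P x - k) ^ 2 * (∑ i, A i i x)
        + (P x - k) * linForm (fun i j => A i j x) (fun i => q i x) (fun i => q i x))) S :=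
    (((hsc.pow 2).mul hAc).add (hsc.mul hFc)).integrableOn_compact hS
  have i4 : IntegrableOn (fun x => ∑ i, A i i x) S := hAc.integrableOn_compact hS
  have e2 : ∫ x in S, √((∑ i, A i i x) * linForm (fun i j => A i j x)
        (fun i => fderiv ℝ G x (Pi.single i 1)) (fun i => fderiv ℝ G x (Pi.single i 1)))
      ≤ ∫ x in S, ((∑ i, A i i x) + ((P x - k) ^ 2 * (∑ i, A i i x)
        + (P x - k) * linForm (fun i j => A i j x) (fun i => q i x) (fun i => q i x))) := by
    refine integral_mono_of_nonneg (Filter.Eventually.of_forall fun x => Real.sqrt_nonneg _)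
      (i4.add i3) ?_
    refine (ae_restrict_iff' hms).2 (Filter.Eventually.of_forall fun x hx => ?_)
    have hs : 0 ≤ P x - k := by linarith [hkS x hx]
    have hσx := hσ x (hΩO (hSΩ hx))
    have e3 : (fun i => fderiv ℝ G x (Pi.single i 1)) = fun i => (2 * (P x - k)) * q i x :=
      funext fun i => by rw [g3 x (hSΩ hx) i, max_eq_left hs]
    simp only [e3]
    rw [SigmaTwoPos.linForm_smul]
    have hF := hσx.linForm_self_nonneg (fun i => q i x)
    have hL := hσx.posL
    generalize linForm (fun i j => A i j x) (fun i => q i x) (fun i => q i x) = F at *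
    generalize (∑ i, A i i x) = Λ at *
    generalize P x - k = s at *
    have t0 : 0 ≤ s * F := mul_nonneg hs hF
    have t1 : s * Λ ≤ Λ + s ^ 2 * Λ := by nlinarith [sq_nonneg (s - 1), sq_nonneg s]
    have t2 : √(Λ * ((2 * s) ^ 2 * F)) ≤ s * (Λ + F) := by
      rw [show Λ * ((2 * s) ^ 2 * F) = s ^ 2 * (4 * (Λ * F)) by ring]
      refine Real.sqrt_le_iff.2 ⟨by positivity, ?_⟩
      rw [mul_pow]
      exact mul_le_mul_of_nonneg_left (by nlinarith [sq_nonneg (Λ - F)]) (sq_nonneg s)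
    linarith
  rw [integral_add i4 i3] at e2
  have hc : 0 ≤ (n * (√K + n * √2) * 8) * ℓ := by positivity
  refine (mul_le_mul_of_nonneg_left (e2.trans (add_le_add le_rfl hen)) hc).trans (le_of_eq ?_)
  ring

end energy

/-- De Giorgi iteration. -/
lemma deGiorgi_iteration {n : ℕ} (hn : 1 ≤ n) {a : ℝ → ℝ} {B a0 k0 : ℝ} (hB : 0 ≤ B)
    (ha0 : 0 ≤ a0) (hle : a k0 ≤ a0) (hnonneg : ∀ k, 0 ≤ a k)
    (hanti : ∀ k h, k0 ≤ k → k ≤ h → a h ≤ a k)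
    (hstep : ∀ k h ℓ, k0 ≤ k → k ≤ h → 0 < ℓ → a k < ℓ ^ n →
      (h - k) ^ 2 * a h ≤ B * ℓ * a k) :
    a (k0 + (4 ^ (n + 1) * B * (1 + a0) + 1)) = 0 := by
  set d := 4 ^ (n + 1) * B * (1 + a0) + 1 with hd
  have hd1 : 1 ≤ d := by
    have : 0 ≤ 4 ^ (n + 1) * B * (1 + a0) := by positivity
    linarith
  have hd2 : 4 ^ (n + 1) * B * (1 + a0) ≤ d ^ 2 := by nlinarith
  clear_value d
  have hind : ∀ i : ℕ, a (k0 + d * (1 - (1 / 2) ^ i)) < ((1 + a0) * (1 / 4) ^ i) ^ n := by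
    intro i
    induction i with
    | zero =>
      simp only [pow_zero, sub_self, mul_zero, add_zero, mul_one]
      have : (1 + a0) ^ 1 ≤ (1 + a0) ^ n := pow_le_pow_right₀ (by linarith) hn
      linarith
    | succ i ih =>
      have p1 : (0 : ℝ) < (1 / 2) ^ i := by positivity
      have p2 : ((1 / 2 : ℝ)) ^ i ≤ 1 := pow_le_one₀ (by norm_num) (by norm_num)
      have p4 : ((1 / 4 : ℝ)) ^ i = ((1 / 2) ^ i) ^ 2 := by
        rw [← pow_mul, mul_comm, pow_mul]
        norm_num
      have hst := hstep (k0 + d * (1 - (1 / 2) ^ i)) (k0 + d * (1 - (1 / 2) ^ (i + 1)))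
        ((1 + a0) * (1 / 4) ^ i)
        (by nlinarith) (by rw [pow_succ]; nlinarith) (by positivity) ih
      have h0 := hnonneg (k0 + d * (1 - (1 / 2) ^ i))
      have h1 := hnonneg (k0 + d * (1 - (1 / 2) ^ (i + 1)))
      generalize a (k0 + d * (1 - (1 / 2) ^ i)) = x at *
      generalize a (k0 + d * (1 - (1 / 2) ^ (i + 1))) = y at *
      rw [pow_succ (1 / 2 : ℝ) i, p4] at hst
      rw [pow_succ (1 / 4 : ℝ) i, p4]
      rw [p4] at ih
      clear p4
      generalize ((1 / 2 : ℝ)) ^ i = r at *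
      have h2 : r ^ 2 * (d ^ 2 * y) ≤ r ^ 2 * (4 * B * (1 + a0) * x) := by nlinarith
      have h3 : d ^ 2 * y ≤ 4 * B * (1 + a0) * x := le_of_mul_le_mul_left h2 (by positivity)
      have h4 : 4 ^ n * y ≤ x := by
        have h5 : (4 ^ n * (4 * B * (1 + a0))) * x ≤ d ^ 2 * x := by
          refine mul_le_mul_of_nonneg_right (le_trans (le_of_eq ?_) hd2) h0
          ring
        have h6 : d ^ 2 * (4 ^ n * y) ≤ d ^ 2 * x := by
          have := mul_le_mul_of_nonneg_left h3 (show (0 : ℝ) ≤ 4 ^ n by positivity)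
          nlinarith
        exact le_of_mul_le_mul_left h6 (by positivity)
      have h7 : ((1 + a0) * (r ^ 2 * (1 / 4))) ^ n * 4 ^ n = ((1 + a0) * r ^ 2) ^ n := by
        rw [← mul_pow]
        congr 1
        ring
      have h8 : (4 : ℝ) ^ n * y < 4 ^ n * ((1 + a0) * (r ^ 2 * (1 / 4))) ^ n := by
        linarith
      exact lt_of_mul_lt_mul_left h8 (by positivity)
  have hlim : Filter.Tendsto (fun i : ℕ => ((1 + a0) * (1 / 4) ^ i) ^ n) Filter.atTop (nhds 0) := by
    have h1 : Filter.Tendsto (fun i : ℕ => (1 + a0) * (1 / 4 : ℝ) ^ i) Filter.atTop (nhds 0) := by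
      simpa using (tendsto_pow_atTop_nhds_zero_of_lt_one (by norm_num : (0 : ℝ) ≤ 1 / 4)
        (by norm_num)).const_mul (1 + a0)
    have := h1.pow n
    rwa [zero_pow (by omega)] at this
  refine le_antisymm (ge_of_tendsto' hlim fun i => ?_) (hnonneg _)
  refine le_trans (hanti _ _ ?_ ?_) (hind i).le
  · have : ((1 / 2 : ℝ)) ^ i ≤ 1 := pow_le_one₀ (by norm_num) (by norm_num)
    nlinarith
  · have : (0 : ℝ) < (1 / 2) ^ i := by positivity
    nlinarith

section supremum

open MeasureTheory

variable {n : ℕ} {O : Set (Fin n → ℝ)} {u : (Fin n → ℝ) → ℝ} {p : Fin n → (Fin n → ℝ) → ℝ}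
  {A : Fin n → Fin n → (Fin n → ℝ) → ℝ} {T : Fin n → Fin n → Fin n → (Fin n → ℝ) → ℝ}
  {U : Fin n → Fin n → Fin n → Fin n → (Fin n → ℝ) → ℝ}

/-- Local boundedness from the divergence inequality on superlevel sets. -/
lemma IsJet.le_of_divergence_le (h : IsJet O u p A T U) (hn : 2 ≤ n) (hO : IsOpen O)
    {Ω : Set (Fin n → ℝ)} (hΩ : IsOpen Ω) (hΩO : Ω ⊆ O)
    {f P : (Fin n → ℝ) → ℝ} {q X Y : Fin n → (Fin n → ℝ) → ℝ} {k0 K Cf N a0 : ℝ} (hK : 0 < K)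
    (hσ : ∀ x ∈ O, SigmaTwoPos (fun i j => A i j x) (∑ i, A i i x) (f x) K)
    (hP : ContDiffOn ℝ 1 P Ω) (hq : ∀ x ∈ Ω, HasGrad P (fun i => q i x) x)
    (hqc : ∀ i, ContinuousOn (q i) Ω)
    (hcpt : ∀ k, k0 ≤ k → IsCompact {x ∈ Ω | k ≤ P x})
    (hY1 : ∀ i, ContDiffOn ℝ 1 (Y i) Ω)
    (hY : ∀ x ∈ Ω, ∀ i, Y i x = (∑ l, A l l x) * q i x - ∑ j, A i j x * q j x - X i x)
    (hX : ∀ x ∈ Ω, ∑ i, X i x ^ 2 ≤ Cf ^ 2) (hN : 3 * (K * Cf ^ 2) + 1 ≤ N)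
    (hdiv : ∀ x ∈ Ω, k0 ≤ P x → N * ∑ i, A i i x ≤ ∑ i, fderiv ℝ (Y i) x (Pi.single i 1)
      + 1 / 4 * linForm (fun i j => A i j x) (fun i => q i x) (fun i => q i x))
    (ha0 : 0 ≤ a0) (hmass : ∫ x in {x ∈ Ω | k0 ≤ P x}, ∑ i, A i i x ≤ a0) :
    ∀ x ∈ Ω, P x ≤ k0 + (4 ^ (n + 1) *
      ((n * (√K + n * √2) * 8) * (1 + 6 * (K * Cf ^ 2))) * (1 + a0) + 1) := by
  set S : ℝ → Set (Fin n → ℝ) := fun k => {x ∈ Ω | k ≤ P x} with hS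
  have hSΩ : ∀ k, S k ⊆ Ω := fun k x hx => hx.1
  have hAc : ContinuousOn (fun x => ∑ i, A i i x) Ω :=
    continuousOn_finsetSum _ fun i _ => (h.contDiff_A i i).continuousOn.mono hΩO
  have hpos : ∀ x ∈ Ω, 0 < ∑ i, A i i x := fun x hx => (hσ x (hΩO hx)).posL
  have hms : ∀ k, MeasurableSet (S k) := fun k => by
    have h1 : S k = Ω ∩ P ⁻¹' (Ici k) := rfl
    rw [h1]
    have h2 : S k = Ω \ (Ω ∩ P ⁻¹' (Iio k)) := by
      ext x
      simp only [hS, mem_ofPred_eq, mem_sdiff, mem_inter_iff, mem_preimage, mem_Iio, not_and,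
        not_lt]
      tauto
    rw [← h1, h2]
    exact hΩ.measurableSet.diff
      (hP.continuousOn.isOpen_inter_preimage hΩ isOpen_Iio).measurableSet
  have hSint : ∀ k, k0 ≤ k → IntegrableOn (fun x => ∑ i, A i i x) (S k) := fun k hk =>
    (hAc.mono (hSΩ k)).integrableOn_compact (hcpt k hk)
  have hnn : ∀ k, 0 ≤ ∫ x in S k, ∑ i, A i i x := fun k =>
    setIntegral_nonneg (hms k) fun x hx => (hpos x hx.1).le
  have hsub : ∀ k l, k ≤ l → S l ⊆ S k := fun k l hkl x hx => ⟨hx.1, hkl.trans hx.2⟩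
  have hzero := deGiorgi_iteration (n := n) (by omega) (a := fun k => ∫ x in S k, ∑ i, A i i x)
    (B := (n * (√K + n * √2) * 8) * (1 + 6 * (K * Cf ^ 2))) (k0 := k0) (by positivity) ha0 hmass hnn
    (fun k l hk hkl => setIntegral_mono_set (hSint k hk)
      ((ae_restrict_iff' (hms k)).2 (Filter.Eventually.of_forall fun x hx => (hpos x hx.1).le))
      (hsub k l hkl).eventuallyLE)
    (fun k l ℓ hk hkl hℓ ha => by
      have h1 : ∀ x ∈ Ω, x ∉ S k → P x ≤ k := fun x hx hxS => by
        by_contra hc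
        exact hxS ⟨hx, (not_le.1 hc).le⟩
      have h2 : ∀ x ∈ S k, k ≤ P x := fun x hx => hx.2
      have hen := energy_le hΩ (hcpt k hk) (hSΩ k)
        (fun i j => (h.contDiff_A i j).continuousOn.mono hΩO) (fun x hx => hσ x (hΩO hx))
        hP hq hqc h1 h2 hY1 hY hX hN (fun x hx => hdiv x hx.1 (hk.trans hx.2))
      have hdec := h.level_decay hn hO hΩ hΩO (hcpt k hk) (hSΩ k) hσ hP hq hqc h1 h2 hen hℓ ha
      refine le_trans ?_ hdec
      have hsc : ContinuousOn (fun x => (P x - k) ^ 2 * ∑ i, A i i x) Ω :=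
        ((hP.continuousOn.sub continuousOn_const).pow 2).mul hAc
      have i1 : IntegrableOn (fun x => (P x - k) ^ 2 * ∑ i, A i i x) (S k) :=
        (hsc.mono (hSΩ k)).integrableOn_compact (hcpt k hk)
      rw [← integral_const_mul]
      refine le_trans ?_ (setIntegral_mono_set i1 ((ae_restrict_iff' (hms k)).2
        (Filter.Eventually.of_forall fun x hx => mul_nonneg (sq_nonneg _) (hpos x hx.1).le))
        (hsub k l hkl).eventuallyLE)
      refine setIntegral_mono_on ((hSint l (hk.trans hkl)).const_mul _)
        (i1.mono_set (hsub k l hkl)) (hms l) fun x hx => ?_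
      refine mul_le_mul_of_nonneg_right ?_ (hpos x hx.1).le
      have : l ≤ P x := hx.2
      exact pow_le_pow_left₀ (by linarith) (by linarith) 2)
  set k1 := k0 + (4 ^ (n + 1) *
      ((n * (√K + n * √2) * 8) * (1 + 6 * (K * Cf ^ 2))) * (1 + a0) + 1) with hk1
  have hk01 : k0 ≤ k1 := by
    have : 0 ≤ 4 ^ (n + 1) * ((n * (√K + n * √2) * 8) * (1 + 6 * (K * Cf ^ 2))) * (1 + a0) := by
      positivity
    linarith
  intro x hx
  by_contra hc
  rw [not_le] at hc
  have hV : IsOpen (Ω ∩ P ⁻¹' (Ioi k1)) :=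
    hP.continuousOn.isOpen_inter_preimage hΩ isOpen_Ioi
  have hVpos : 0 < volume (Ω ∩ P ⁻¹' (Ioi k1)) := hV.measure_pos volume ⟨x, hx, hc⟩
  have := (setIntegral_pos_iff_support_of_nonneg_ae
    ((ae_restrict_iff' (hms k1)).2 (Filter.Eventually.of_forall fun x hx => (hpos x hx.1).le))
    (hSint k1 hk01)).2 (lt_of_lt_of_le hVpos (measure_mono fun y hy =>
      ⟨(hpos y hy.1).ne', hy.1, le_of_lt hy.2⟩))
  exact this.ne' hzero

end supremum

section regularity

variable {n : ℕ} {O Ω : Set (Fin n → ℝ)} {u : (Fin n → ℝ) → ℝ} {p : Fin n → (Fin n → ℝ) → ℝ}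
  {A : Fin n → Fin n → (Fin n → ℝ) → ℝ} {T : Fin n → Fin n → Fin n → (Fin n → ℝ) → ℝ}
  {U : Fin n → Fin n → Fin n → Fin n → (Fin n → ℝ) → ℝ}

lemma contDiff_cutoff (y : Fin n → ℝ) : ContDiff ℝ 1 (cutoff y) := by
  unfold cutoff
  fun_prop

lemma IsJet.contDiffOn_trace (h : IsJet O u p A T U) (hΩO : Ω ⊆ O) :
    ContDiffOn ℝ 1 (fun x => ∑ k, A k k x) Ω :=
  ContDiffOn.sum fun i _ => (h.contDiff_A i i).mono hΩO

lemma IsJet.contDiffOn_tilt (h : IsJet O u p A T U) (hΩO : Ω ⊆ O) (α β : ℝ) (y : Fin n → ℝ) :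
    ContDiffOn ℝ 1 (tilt α β y u p) Ω := by
  have hp : ∀ j, ContDiffOn ℝ 1 (p j) Ω := fun j => (h.contDiff_p j).mono hΩO
  have hc : ∀ j, ContDiffOn ℝ 1 (fun x : Fin n → ℝ => x j - y j) Ω := fun j => by fun_prop
  exact (contDiffOn_const.mul ((ContDiffOn.sum fun j _ => (hc j).mul (hp j)).sub
    (h.contDiff_u.mono hΩO))).add (contDiffOn_const.mul (ContDiffOn.sum fun j _ => (hp j).pow 2))

lemma contDiffOn_inv_cutoff {y : Fin n → ℝ} (h0 : ∀ x ∈ Ω, cutoff y x ≠ 0) :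
    ContDiffOn ℝ 1 (fun x => (cutoff y x)⁻¹) Ω :=
  (contDiff_cutoff y).contDiffOn.inv h0

lemma IsJet.contDiffOn_auxFun (h : IsJet O u p A T U) (hΩO : Ω ⊆ O) (α β N : ℝ)
    {y : Fin n → ℝ} (h0 : ∀ x ∈ Ω, cutoff y x ≠ 0) (hΛ : ∀ x ∈ Ω, ∑ k, A k k x ≠ 0) :
    ContDiffOn ℝ 1 (auxFun α β N y u p A) Ω :=
  ((h.contDiffOn_trace hΩO).log hΛ).sub (contDiffOn_const.mul
    (((contDiffOn_inv_cutoff h0).pow 2).mul (contDiffOn_const.sub (h.contDiffOn_tilt hΩO α β y))))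

lemma IsJet.contDiffOn_barrierGrad (h : IsJet O u p A T U) (hΩO : Ω ⊆ O) (α β : ℝ)
    {y : Fin n → ℝ} (h0 : ∀ x ∈ Ω, cutoff y x ≠ 0) (i : Fin n) :
    ContDiffOn ℝ 1 (fun x => (cutoff y x)⁻¹ ^ 3 * barrierGrad α β y u p A i x) Ω := by
  have hp : ∀ j, ContDiffOn ℝ 1 (p j) Ω := fun j => (h.contDiff_p j).mono hΩO
  have hc : ∀ j, ContDiffOn ℝ 1 (fun x : Fin n → ℝ => x j - y j) Ω := fun j => by fun_prop
  exact ((contDiffOn_inv_cutoff h0).pow 3).mul (((contDiffOn_const.mul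
    (contDiffOn_const.sub (h.contDiffOn_tilt hΩO α β y))).mul (hc i)).add
      ((contDiff_cutoff y).contDiffOn.mul (ContDiffOn.sum fun j _ =>
        ((h.contDiff_A i j).mono hΩO).mul ((contDiffOn_const.mul (hc j)).add
          (contDiffOn_const.mul (hp j))))))

lemma IsJet.contDiffOn_auxGrad (h : IsJet O u p A T U) (hΩO : Ω ⊆ O) (α β N : ℝ)
    {y : Fin n → ℝ} (h0 : ∀ x ∈ Ω, cutoff y x ≠ 0) (hΛ : ∀ x ∈ Ω, ∑ k, A k k x ≠ 0)
    (i : Fin n) : ContDiffOn ℝ 1 (auxGrad α β N y u p A T i) Ω :=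
  (ContDiffOn.div (ContDiffOn.sum fun k _ => (h.contDiff_T k k i).mono hΩO)
    (h.contDiffOn_trace hΩO) hΛ).add (contDiffOn_const.mul
      (h.contDiffOn_barrierGrad hΩO α β h0 i))

lemma IsJet.contDiffOn_auxFlux (h : IsJet O u p A T U) (hΩO : Ω ⊆ O) (α β N : ℝ)
    {y : Fin n → ℝ} (h0 : ∀ x ∈ Ω, cutoff y x ≠ 0) (hΛ : ∀ x ∈ Ω, ∑ k, A k k x ≠ 0)
    (i : Fin n) : ContDiffOn ℝ 1 (auxFlux α β N y u p A T i) Ω := by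
  have hA : ∀ i j, ContDiffOn ℝ 1 (A i j) Ω := fun i j => (h.contDiff_A i j).mono hΩO
  have hT : ∀ i j k, ContDiffOn ℝ 1 (T i j k) Ω := fun i j k => (h.contDiff_T i j k).mono hΩO
  exact (((h.contDiffOn_trace hΩO).inv hΛ).mul
    ((ContDiffOn.sum fun j _ => ContDiffOn.sum fun k _ => (hA j k).mul (hT i j k)).sub
      (ContDiffOn.sum fun j _ => (hA i j).mul (ContDiffOn.sum fun k _ => hT k k j)))).add
    (contDiffOn_const.mul (((h.contDiffOn_trace hΩO).mul
      (h.contDiffOn_barrierGrad hΩO α β h0 i)).sub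
      (ContDiffOn.sum fun j _ => (hA i j).mul (h.contDiffOn_barrierGrad hΩO α β h0 j))))

end regularity

section integralBound

open MeasureTheory

/-- The integral of the Laplacian over a ball is controlled by the gradient. -/
lemma exists_integral_trace_le (n : ℕ) : ∃ B : ℝ, 0 ≤ B ∧
    ∀ {O : Set (Fin n → ℝ)} {u : (Fin n → ℝ) → ℝ} {p : Fin n → (Fin n → ℝ) → ℝ}
      {A : Fin n → Fin n → (Fin n → ℝ) → ℝ} {T : Fin n → Fin n → Fin n → (Fin n → ℝ) → ℝ}
      {U : Fin n → Fin n → Fin n → Fin n → (Fin n → ℝ) → ℝ} {M : ℝ} {y : Fin n → ℝ},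
      IsJet O u p A T U → IsOpen O → (∀ x ∈ O, 0 ≤ ∑ i, A i i x) →
      (∀ x ∈ O, ∀ i, |p i x| ≤ M) → closedBall y 1 ⊆ O →
      ∫ x in closedBall y (1 / 2), ∑ i, A i i x ≤ M * B := by
  let b : ContDiffBump (0 : Fin n → ℝ) := ⟨1 / 2, 1, by norm_num, by norm_num⟩
  refine ⟨∫ x, ∑ i, |fderiv ℝ b x (Pi.single i 1)|,
    integral_nonneg fun x => Finset.sum_nonneg fun i _ => abs_nonneg _, ?_⟩
  intro O u p A T U M y h hO hΛ hp hy
  set φ : (Fin n → ℝ) → ℝ := fun x => b (x - y) with hφ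
  have hφ1 : ContDiff ℝ 1 φ := b.contDiff.comp (contDiff_id.sub contDiff_const)
  have hφ0 : ∀ x ∉ closedBall y 1, φ x = 0 := fun x hx => by
    refine b.zero_of_le_dist ?_
    rw [mem_closedBall, not_le, dist_eq_norm] at hx
    rw [dist_eq_norm, sub_zero]
    exact hx.le
  have hcpt : IsCompact (closedBall y (1 : ℝ)) := isCompact_closedBall y 1
  have hAc : ContinuousOn (fun x => ∑ i, A i i x) O :=
    continuousOn_finsetSum _ fun i _ => (h.contDiff_A i i).continuousOn
  have hsub : closedBall y (1 / 2 : ℝ) ⊆ closedBall y 1 :=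
    closedBall_subset_closedBall (by norm_num)
  have iφ : Integrable fun x => φ x * ∑ i, A i i x :=
    (hφ1.continuous.continuousOn.mul hAc).integrable_of_eq_zero hO hcpt hy
      fun x hx => by simp [hφ0 x hx]
  have s1 : ∫ x in closedBall y (1 / 2), ∑ i, A i i x ≤ ∫ x, φ x * ∑ i, A i i x := by
    have e : ∫ x in closedBall y (1 / 2), ∑ i, A i i x
        = ∫ x in closedBall y (1 / 2), φ x * ∑ i, A i i x :=
      setIntegral_congr_fun measurableSet_closedBall fun x hx => by
        have : φ x = 1 := b.one_of_mem_closedBall (by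
          rw [mem_closedBall, dist_eq_norm] at hx ⊢
          rw [sub_zero]
          exact hx)
        simp only [this, one_mul]
    rw [e]
    refine setIntegral_le_integral iφ (Filter.Eventually.of_forall fun x => ?_)
    by_cases hx : x ∈ closedBall y 1
    · exact mul_nonneg b.nonneg (hΛ x (hy hx))
    · simp [hφ0 x hx]
  have hibp := integral_mul_divergence hO hcpt hy hφ1 hφ0 h.contDiff_p
  have e2 : ∫ x, φ x * ∑ i, fderiv ℝ (p i) x (Pi.single i 1) = ∫ x, φ x * ∑ i, A i i x := by
    refine integral_congr_ae (Filter.Eventually.of_forall fun x => ?_)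
    by_cases hx : x ∈ closedBall y 1
    · simp only
      congr 1
      exact Finset.sum_congr rfl fun i _ => (h.grad_p x (hy hx) i).fderiv_apply i
    · simp [hφ0 x hx]
  rw [e2] at hibp
  refine s1.trans ?_
  rw [hibp, ← integral_neg]
  have hd : ∀ x, ∀ i : Fin n, fderiv ℝ φ x (Pi.single i 1) = fderiv ℝ b (x - y) (Pi.single i 1) :=
    fun x i => by rw [hφ, fderiv_comp_sub]
  have hb1 : ContDiff ℝ 1 (b : (Fin n → ℝ) → ℝ) := b.contDiff
  have hbc : Continuous fun x => ∑ i, |fderiv ℝ b x (Pi.single i 1)| :=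
    continuous_finsetSum _ fun i _ =>
      ((hb1.continuous_fderiv one_ne_zero).clm_apply continuous_const).abs
  have ib : Integrable fun x => ∑ i, |fderiv ℝ b x (Pi.single i 1)| := by
    refine hbc.integrable_of_hasCompactSupport (μ := volume) (HasCompactSupport.intro
      (isCompact_closedBall (0 : Fin n → ℝ) 1) fun x hx => ?_)
    have hb0 : ∀ x ∉ closedBall (0 : Fin n → ℝ) 1, b x = 0 := fun x hx => by
      refine b.zero_of_le_dist ?_
      rw [mem_closedBall, not_le] at hx
      exact hx.le
    simp [fderiv_eq_zero_of_eq_zero (isClosed_closedBall) hb0 x hx]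
  rw [← integral_sub_right_eq_self (fun x => ∑ i, |fderiv ℝ b x (Pi.single i 1)|) y,
    ← integral_const_mul]
  have hz : ∀ x ∉ closedBall y 1, ∀ i : Fin n, fderiv ℝ φ x (Pi.single i 1) = 0 := fun x hx i => by
    simp [fderiv_eq_zero_of_eq_zero isClosed_closedBall hφ0 x hx]
  have iL : Integrable fun x => ∑ i, fderiv ℝ φ x (Pi.single i 1) * p i x := by
    refine ContinuousOn.integrable_of_eq_zero hO hcpt hy (continuousOn_finsetSum _ fun i _ =>
      ContinuousOn.mul ((hφ1.continuous_fderiv one_ne_zero).clm_apply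
        continuous_const).continuousOn (h.contDiff_p i).continuousOn) fun x hx => ?_
    simp [hz x hx]
  refine integral_mono iL.neg ((ib.comp_sub_right y).const_mul M) fun x => ?_
  simp only
  rw [← Finset.sum_neg_distrib, Finset.mul_sum]
  refine Finset.sum_le_sum fun i _ => ?_
  rw [← hd x i]
  by_cases hx : x ∈ closedBall y 1
  · refine (neg_le_abs _).trans ?_
    rw [abs_mul, mul_comm]
    exact mul_le_mul_of_nonneg_right (hp x (hy hx) i) (abs_nonneg _)
  · simp [hz x hx i]

end integralBound

section localDoubling

open MeasureTheory

variable {n : ℕ}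

lemma isOpen_setOf_cutoff_pos (y : Fin n → ℝ) : IsOpen {x | 0 < cutoff y x} :=
  isOpen_lt continuous_const (contDiff_cutoff y).continuous

lemma mem_closedBall_of_cutoff_nonneg {x y : Fin n → ℝ} (h : 0 ≤ cutoff y x) :
    x ∈ closedBall y (1 / 2) := by
  rw [mem_closedBall, dist_pi_le_iff (by norm_num)]
  intro j
  have h1 : (x j - y j) ^ 2 ≤ ∑ j, (x j - y j) ^ 2 :=
    Finset.single_le_sum (f := fun j => (x j - y j) ^ 2) (fun j _ => sq_nonneg _)
      (Finset.mem_univ j)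
  rw [cutoff] at h
  rw [Real.dist_eq]
  exact abs_le_of_sq_le_sq (by linarith) (by norm_num)

lemma abs_tilt_le {α β M : ℝ} (hα : 0 ≤ α) (hβ : 0 ≤ β) (hM : 0 ≤ M)
    {u : (Fin n → ℝ) → ℝ} {p : Fin n → (Fin n → ℝ) → ℝ} {x y : Fin n → ℝ}
    (hu : |u x| ≤ M) (hp : ∑ i, p i x ^ 2 ≤ M ^ 2) (hz : ∑ j, (x j - y j) ^ 2 ≤ 1 / 4) :
    |tilt α β y u p x| ≤ α * (3 / 2 * M) + β * M ^ 2 / 2 := by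
  have h1 : (∑ j, (x j - y j) * p j x) ^ 2 ≤ (1 / 2 * M) ^ 2 := by
    refine (Finset.sum_mul_sq_le_sq_mul_sq _ _ _).trans ?_
    calc _ ≤ 1 / 4 * M ^ 2 :=
          mul_le_mul hz hp (Finset.sum_nonneg fun i _ => sq_nonneg _) (by norm_num)
      _ = _ := by ring
  have h2 := abs_le_of_sq_le_sq h1 (by positivity)
  have h3 : |∑ j, (x j - y j) * p j x - u x| ≤ 3 / 2 * M :=
    (abs_sub _ _).trans (by linarith)
  have h4 : 0 ≤ ∑ j, p j x ^ 2 := Finset.sum_nonneg fun i _ => sq_nonneg _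
  rw [tilt]
  refine (abs_add_le _ _).trans (add_le_add ?_ ?_)
  · rw [abs_mul, abs_of_nonneg hα]
    exact mul_le_mul_of_nonneg_left h3 hα
  · rw [abs_of_nonneg (by positivity)]
    nlinarith

lemma log_add_inv_sq_nonneg {ρ : ℝ} (h0 : 0 < ρ) (h1 : ρ ≤ 1 / 4) :
    0 ≤ Real.log ρ + ρ⁻¹ ^ 2 / 2 := by
  have h2 := Real.log_le_sub_one_of_pos (inv_pos.2 h0)
  rw [Real.log_inv] at h2
  have h3 : 4 ≤ ρ⁻¹ := by
    rw [le_inv_comm₀ (by norm_num) h0]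
    linarith
  nlinarith

/-- Local doubling: the trace at scale `1 / 4` is controlled by the trace at scale `1 / 8`. -/
lemma exists_local_doubling (hn : 2 ≤ n) {K M Cf : ℝ} (hK : 0 < K) (hM : 0 ≤ M) (hCf : 0 ≤ Cf) :
    ∃ C : ℝ, 0 ≤ C ∧
    ∀ {O : Set (Fin n → ℝ)} {u : (Fin n → ℝ) → ℝ} {p : Fin n → (Fin n → ℝ) → ℝ}
      {A : Fin n → Fin n → (Fin n → ℝ) → ℝ} {T : Fin n → Fin n → Fin n → (Fin n → ℝ) → ℝ}
      {U : Fin n → Fin n → Fin n → Fin n → (Fin n → ℝ) → ℝ} {f : (Fin n → ℝ) → ℝ},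
      IsJet O u p A T U → IsOpen O →
      (∀ x ∈ O, SigmaTwoPos (fun i j => A i j x) (∑ i, A i i x) (f x) K) →
      (∀ x ∈ O, ∀ v : Fin n → ℝ, -((Real.sqrt (3 * (n : ℝ) ^ 2 + 1) - n + 1) / (2 * n))
        * (∑ i, A i i x) * ∑ i, v i ^ 2 ≤ ∑ i, ∑ j, v i * A i j x * v j) →
      (∀ x ∈ O, ∑ k, ((∑ i, A i i x) * (∑ i, T i i k x) - ∑ i, ∑ j, A i j x * T i j k x) ^ 2
        ≤ Cf ^ 2 * (∑ i, A i i x) ^ 2) →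
      (∀ x ∈ O, |u x| ≤ M) → (∀ x ∈ O, ∑ i, p i x ^ 2 ≤ M ^ 2) →
      ∀ {y : Fin n → ℝ} {m : ℝ}, closedBall y 1 ⊆ O → 0 ≤ m →
      (∀ x, ∑ j, (x j - y j) ^ 2 < (1 / 8) ^ 2 → ∑ i, A i i x ≤ m) →
      ∀ x, ∑ j, (x j - y j) ^ 2 ≤ 1 / 16 → ∑ i, A i i x ≤ C * (1 + m) := by
  obtain ⟨α, β, L0, N1, hα, hβ, hL0, hN1, hαβ, hpt⟩ := exists_pointwise_bound hn hK hM hCf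
  obtain ⟨B, hB, hmass⟩ := exists_integral_trace_le n
  set N : ℝ := max N1 (3 * (K * Cf ^ 2) + 1) with hN
  have hNN1 : N1 ≤ N := le_max_left _ _
  have hNC : 3 * (K * Cf ^ 2) + 1 ≤ N := le_max_right _ _
  have hN1' : 1 ≤ N := hN1.trans hNN1
  set d : ℝ := 4 ^ (n + 1) *
      ((n * (√K + n * √2) * 8) * (1 + 6 * (K * Cf ^ 2))) * (1 + M * B) + 1 with hd
  clear_value d N
  refine ⟨Real.exp (|Real.log L0| + d + N * 44), (Real.exp_pos _).le, ?_⟩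
  intro O u p A T U f h hO hσ hlow hdf hu hp y m hy hm hΛm
  set Ω : Set (Fin n → ℝ) := {x | 0 < cutoff y x} with hΩdef
  have hΩ : IsOpen Ω := isOpen_setOf_cutoff_pos y
  have hball : closedBall y (1 / 2 : ℝ) ⊆ O :=
    (closedBall_subset_closedBall (by norm_num)).trans hy
  have hΩO : Ω ⊆ O := fun x hx => hball (mem_closedBall_of_cutoff_nonneg (le_of_lt hx))
  have hz : ∀ x ∈ Ω, ∑ j, (x j - y j) ^ 2 ≤ 1 / 4 := fun x hx => by
    have : 0 < cutoff y x := hx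
    rw [cutoff] at this
    linarith
  have hρ4 : ∀ x, cutoff y x ≤ 1 / 4 := fun x => by
    rw [cutoff]
    linarith [show 0 ≤ ∑ j, (x j - y j) ^ 2 from Finset.sum_nonneg fun i _ => sq_nonneg _]
  have hg : ∀ x ∈ Ω, |tilt α β y u p x| ≤ 1 / 2 := fun x hx =>
    (abs_tilt_le hα.le hβ.le hM (hu x (hΩO hx)) (hp x (hΩO hx)) (hz x hx)).trans hαβ
  have hpos : ∀ x ∈ O, 0 < ∑ i, A i i x := fun x hx => (hσ x hx).posL
  have h0 : ∀ x ∈ Ω, cutoff y x ≠ 0 := fun x hx => ne_of_gt hx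
  have hΛ0 : ∀ x ∈ Ω, ∑ k, A k k x ≠ 0 := fun x hx => (hpos x (hΩO hx)).ne'
  have hPle : ∀ x ∈ Ω, auxFun α β N y u p A x
      ≤ Real.log (∑ i, A i i x) - N * ((cutoff y x)⁻¹ ^ 2 / 2) := fun x hx => by
    have h1 := (abs_le.1 (hg x hx)).2
    have h2 : (cutoff y x)⁻¹ ^ 2 * (1 / 2) ≤ (cutoff y x)⁻¹ ^ 2 * (1 - tilt α β y u p x) :=
      mul_le_mul_of_nonneg_left (by linarith) (sq_nonneg _)
    rw [auxFun]
    have := mul_le_mul_of_nonneg_left h2 (zero_le_one.trans hN1')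
    linarith
  set k0 : ℝ := Real.log (1 + m) + |Real.log L0| with hk0
  have hlogm : 0 ≤ Real.log (1 + m) := Real.log_nonneg (by linarith)
  have hPc : ContDiffOn ℝ 1 (auxFun α β N y u p A) Ω := h.contDiffOn_auxFun hΩO α β N h0 hΛ0
  have hqc : ∀ i, ContinuousOn (auxGrad α β N y u p A T i) Ω := fun i =>
    (h.contDiffOn_auxGrad hΩO α β N h0 hΛ0 i).continuousOn
  have hlarge : ∀ x ∈ Ω, k0 ≤ auxFun α β N y u p A x → L0 ≤ (∑ i, A i i x) * cutoff y x := by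
    intro x hx hk
    have hρ : 0 < cutoff y x := hx
    have h1 := hPle x hx
    have h2 := log_add_inv_sq_nonneg hρ (hρ4 x)
    have h3 : (cutoff y x)⁻¹ ^ 2 / 2 ≤ N * ((cutoff y x)⁻¹ ^ 2 / 2) :=
      le_mul_of_one_le_left (by positivity) hN1'
    rw [← Real.log_le_log_iff hL0 (mul_pos (hpos x (hΩO hx)) hρ),
      Real.log_mul (hΛ0 x hx) hρ.ne']
    linarith [le_abs_self (Real.log L0)]
  have hfar : ∀ x ∈ Ω, k0 ≤ auxFun α β N y u p A x → (1 / 8) ^ 2 ≤ ∑ j, (x j - y j) ^ 2 := by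
    intro x hx hk
    by_contra hc
    have hρ : 0 < cutoff y x := hx
    have h1 := hPle x hx
    have h2 := hΛm x (not_le.1 hc)
    have h3 : Real.log (∑ i, A i i x) ≤ Real.log (1 + m) :=
      Real.log_le_log (hpos x (hΩO hx)) (by linarith)
    have h4 : 0 < N * ((cutoff y x)⁻¹ ^ 2 / 2) := by positivity
    linarith [abs_nonneg (Real.log L0)]
  have hcpt : ∀ k, k0 ≤ k → IsCompact {x ∈ Ω | k ≤ auxFun α β N y u p A x} := by
    intro k hk
    have hAc : ContinuousOn (fun x => ∑ i, A i i x) (closedBall y (1 / 2)) :=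
      (h.contDiffOn_trace hball).continuousOn
    obtain ⟨R, hR⟩ := (isCompact_closedBall y (1 / 2 : ℝ)).bddAbove_image hAc
    set Q : ℝ := 2 * |Real.log R - k| + 1 with hQ
    have hQ0 : 0 < Q := by positivity
    set D : Set (Fin n → ℝ) := {x | Q⁻¹ ≤ cutoff y x} with hD
    have hDΩ : D ⊆ Ω := fun x hx => lt_of_lt_of_le (inv_pos.2 hQ0) hx
    have hDc : IsClosed D := isClosed_le continuous_const (contDiff_cutoff y).continuous
    have hDcpt : IsCompact D := (isCompact_closedBall y (1 / 2 : ℝ)).of_isClosed_subset hDc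
      fun x hx => mem_closedBall_of_cutoff_nonneg (le_of_lt (hDΩ hx))
    have heq : {x ∈ Ω | k ≤ auxFun α β N y u p A x} = D ∩ auxFun α β N y u p A ⁻¹' Ici k := by
      ext x
      constructor
      · rintro ⟨hx, hkx⟩
        refine ⟨?_, hkx⟩
        have hρ : 0 < cutoff y x := hx
        have hxb := mem_closedBall_of_cutoff_nonneg hρ.le
        have h1 := hPle x hx
        have h2 : Real.log (∑ i, A i i x) ≤ Real.log R :=
          Real.log_le_log (hpos x (hΩO hx)) (hR ⟨x, hxb, rfl⟩)
        have h3 : (cutoff y x)⁻¹ ^ 2 / 2 ≤ N * ((cutoff y x)⁻¹ ^ 2 / 2) :=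
          le_mul_of_one_le_left (by positivity) hN1'
        have h4 : 4 ≤ (cutoff y x)⁻¹ := by
          rw [le_inv_comm₀ (by norm_num) hρ]
          linarith [hρ4 x]
        have h5 : (cutoff y x)⁻¹ ≤ Q := by
          nlinarith [le_abs_self (Real.log R - k)]
        exact inv_le_of_inv_le₀ hρ h5
      · rintro ⟨hx, hkx⟩
        exact ⟨hDΩ hx, hkx⟩
    rw [heq]
    exact hDcpt.of_isClosed_subset
      ((hPc.continuousOn.mono hDΩ).preimage_isClosed_of_isClosed hDc isClosed_Ici)
      inter_subset_left
  have ha0 : ∫ x in {x ∈ Ω | k0 ≤ auxFun α β N y u p A x}, ∑ i, A i i x ≤ M * B := by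
    refine le_trans (setIntegral_mono_set ?_ ?_ ?_) (hmass h hO (fun x hx => (hpos x hx).le)
      (fun x hx i => abs_le_of_sq_le_sq ((Finset.single_le_sum (f := fun i => p i x ^ 2)
        (fun j _ => sq_nonneg _) (Finset.mem_univ i)).trans (hp x hx)) hM) hy)
    · exact (h.contDiffOn_trace hball).continuousOn.integrableOn_compact
        (isCompact_closedBall y _)
    · exact (ae_restrict_iff' measurableSet_closedBall).2
        (Filter.Eventually.of_forall fun x hx => (hpos x (hball hx)).le)
    · have hsub : {x ∈ Ω | k0 ≤ auxFun α β N y u p A x} ⊆ closedBall y (1 / 2) :=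
        fun x hx => mem_closedBall_of_cutoff_nonneg (le_of_lt hx.1)
      exact hsub.eventuallyLE
  have hmain := h.le_of_divergence_le hn hO hΩ hΩO (k0 := k0) (Cf := Cf) (N := N) (a0 := M * B)
    (P := auxFun α β N y u p A) (q := auxGrad α β N y u p A T) (Y := auxFlux α β N y u p A T)
    (X := fun i x => ((∑ k, A k k x) * (∑ k, T k k i x) - ∑ j, ∑ k, A j k x * T j k i x)
        / ∑ k, A k k x) hK hσ hPc
    (fun x hx => h.hasGrad_auxFun α β N y (hΩO hx) (h0 x hx) (hΛ0 x hx)) hqc hcpt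
    (fun i => h.contDiffOn_auxFlux hΩO α β N h0 hΛ0 i)
    (fun x hx i => h.auxFlux_eq α β N y (hΩO hx) (hΛ0 x hx) i)
    (fun x hx => by
      simp only [div_pow]
      rw [← Finset.sum_div, div_le_iff₀ (pow_pos (hpos x (hΩO hx)) 2)]
      exact hdf x (hΩO hx)) hNC
    (fun x hx hk => by
      obtain ⟨D, hD, hDs⟩ := h.exists_grad_auxFlux α β N y (hΩO hx) (h0 x hx) (hΛ0 x hx)
        (z := fun i => x i - y i) (w := fun i => α * (x i - y i) + β * p i x)
        (τ := fun k => ∑ i, T i i k x)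
        (df := fun k => (∑ i, A i i x) * (∑ i, T i i k x) - ∑ i, ∑ j, A i j x * T i j k x)
        rfl (hσ x (hΩO hx)).sigma rfl rfl (fun i => rfl) (fun i => rfl) (fun i => rfl)
        (fun i => rfl)
      have hsum : ∑ i, fderiv ℝ (auxFlux α β N y u p A T i) x (Pi.single i 1) = ∑ i, D i i :=
        Finset.sum_congr rfl fun i _ => (hD i).fderiv_apply i
      rw [hsum, hDs]
      exact hpt N hNN1 (fun i j => A i j x) (∑ i, A i i x) (f x) (hσ x (hΩO hx))
        (fun i j k => T i j k x) (h.symm_T x (hΩO hx)) (h.symm_T' x (hΩO hx))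
        (fun i => x i - y i) (fun i => p i x) (fun i => α * (x i - y i) + β * p i x)
        (fun k => ∑ i, T i i k x)
        (fun k => (∑ i, A i i x) * (∑ i, T i i k x) - ∑ i, ∑ j, A i j x * T i j k x)
        (fun i => barrierGrad α β y u p A i x) (tilt α β y u p x) (cutoff y x)
        (hlow x (hΩO hx)) (fun i => rfl) (fun i => rfl) (hdf x (hΩO hx)) (fun i => rfl)
        (fun i => rfl) (hg x hx) (hp x (hΩO hx)) (hfar x hx hk) (hz x hx) hx (hρ4 x)
        (hlarge x hx hk)) (by positivity) ha0
  intro x hx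
  have hρ : 3 / 16 ≤ cutoff y x := by
    rw [cutoff]
    linarith
  have hxΩ : x ∈ Ω := lt_of_lt_of_le (by norm_num) hρ
  have h1 := hmain x hxΩ
  rw [← hd, auxFun] at h1
  have h2 := (abs_le.1 (hg x hxΩ)).1
  have h3 : (cutoff y x)⁻¹ ≤ 16 / 3 := by
    rw [inv_le_comm₀ (by linarith) (by norm_num)]
    linarith
  have h4 : (cutoff y x)⁻¹ ^ 2 * (1 - tilt α β y u p x) ≤ 44 := by
    have h5 : (cutoff y x)⁻¹ ^ 2 ≤ (16 / 3) ^ 2 :=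
      pow_le_pow_left₀ (inv_nonneg.2 (by linarith)) h3 2
    calc _ ≤ (cutoff y x)⁻¹ ^ 2 * (3 / 2) :=
          mul_le_mul_of_nonneg_left (by linarith) (sq_nonneg _)
      _ ≤ 44 := by linarith
  have h6 := mul_le_mul_of_nonneg_left h4 (zero_le_one.trans hN1')
  have h7 : Real.log (∑ i, A i i x) ≤ (|Real.log L0| + d + N * 44) + Real.log (1 + m) := by
    linarith
  rw [Real.log_le_iff_le_exp (hpos x (hΩO hxΩ)), Real.exp_add, Real.exp_log (by linarith)] at h7
  exact h7

end localDoubling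

/-- Iteration of a local doubling estimate along a segment. -/
lemma le_of_local_doubling {n : ℕ} {Λ : (Fin n → ℝ) → ℝ} {C m : ℝ} (hn : 1 ≤ n) (hC : 0 ≤ C)
    (hm : 0 ≤ m)
    (hstep : ∀ y ∈ ball (0 : Fin n → ℝ) 2, ∀ m : ℝ, 0 ≤ m →
      (∀ x, ∑ j, (x j - y j) ^ 2 < (1 / 8) ^ 2 → Λ x ≤ m) →
      ∀ x, ∑ j, (x j - y j) ^ 2 ≤ 1 / 16 → Λ x ≤ C * (1 + m))
    (h0 : ∀ x ∈ ball (0 : Fin n → ℝ) 1, Λ x ≤ m) :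
    ∀ x ∈ ball (0 : Fin n → ℝ) 2, Λ x ≤ (C + 1) ^ (16 * n) * (1 + m) := by
  intro x hx
  have hn0 : (1 : ℝ) ≤ n := by exact_mod_cast hn
  have hx2 : ∀ j, |x j| ≤ 2 := fun j => by
    rw [mem_ball_zero_iff] at hx
    exact (norm_le_pi_norm x j).trans hx.le
  have hind : ∀ k : ℕ, k ≤ 16 * n → ∀ z : Fin n → ℝ,
      ∑ j, (z j - (k / (16 * n) : ℝ) * x j) ^ 2 < (1 / 8) ^ 2 →
      Λ z ≤ (C + 1) ^ k * (1 + m) - 1 := by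
    intro k
    induction k with
    | zero =>
      intro _ z hz
      rw [pow_zero, one_mul, add_sub_cancel_left]
      refine h0 z ?_
      rw [mem_ball_zero_iff, pi_norm_lt_iff one_pos]
      intro j
      have h1 : (z j) ^ 2 ≤ ∑ j, (z j - ((0 : ℕ) / (16 * n) : ℝ) * x j) ^ 2 := by
        simpa using Finset.single_le_sum (f := fun j => z j ^ 2) (fun j _ => sq_nonneg _)
          (Finset.mem_univ j)
      have h2 : |z j| ≤ 1 / 8 := abs_le_of_sq_le_sq (h1.trans hz.le) (by norm_num)
      rw [Real.norm_eq_abs]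
      linarith
    | succ k ih =>
      intro hk z hz
      have hk' : ((k : ℝ) + 1) ≤ 16 * n := by exact_mod_cast hk
      have hy : (fun j => (k / (16 * n) : ℝ) * x j) ∈ ball (0 : Fin n → ℝ) 2 := by
        rw [mem_ball_zero_iff] at hx ⊢
        have e : (fun j => (k / (16 * n) : ℝ) * x j) = (k / (16 * n) : ℝ) • x := rfl
        rw [e, norm_smul, Real.norm_eq_abs, abs_of_nonneg (by positivity)]
        have h1 : (k / (16 * n) : ℝ) ≤ 1 := by
          rw [div_le_one (by positivity)]
          linarith
        exact lt_of_le_of_lt (mul_le_of_le_one_left (norm_nonneg _) h1) hx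
      have hpow : 1 ≤ (C + 1) ^ k := one_le_pow₀ (by linarith)
      have hmk : 1 ≤ (C + 1) ^ k * (1 + m) := by nlinarith
      have hdist : ∑ j, (z j - (k / (16 * n) : ℝ) * x j) ^ 2 ≤ 1 / 16 := by
        have h1 : ∀ j, (z j - (k / (16 * n) : ℝ) * x j) ^ 2
            ≤ 2 * (z j - (((k + 1 : ℕ) : ℝ) / (16 * n) : ℝ) * x j) ^ 2 + 2 * (1 / (8 * n)) ^ 2 := by
          intro j
          have e1 : z j - (k / (16 * n) : ℝ) * x j
              = (z j - (((k + 1 : ℕ) : ℝ) / (16 * n) : ℝ) * x j) + x j / (16 * n) := by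
            push_cast
            field_simp
            ring
          have e2 : (x j / (16 * n)) ^ 2 ≤ (1 / (8 * n)) ^ 2 := by
            rw [sq_le_sq, abs_div, abs_of_pos (show (0 : ℝ) < 16 * n by positivity),
              abs_of_pos (show (0 : ℝ) < 1 / (8 * n) by positivity), div_le_div_iff₀
              (by positivity) (by positivity)]
            nlinarith [hx2 j]
          rw [e1]
          nlinarith [sq_nonneg ((z j - (((k + 1 : ℕ) : ℝ) / (16 * n) : ℝ) * x j)
            - x j / (16 * n))]
        have h2 : (n : ℝ) * (2 * (1 / (8 * n)) ^ 2) ≤ 1 / 32 := by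
          rw [div_pow, mul_pow, ← mul_div_assoc, ← mul_div_assoc, div_le_div_iff₀ (by positivity)
            (by norm_num)]
          nlinarith
        calc _ ≤ ∑ j, (2 * (z j - (((k + 1 : ℕ) : ℝ) / (16 * n) : ℝ) * x j) ^ 2
              + 2 * (1 / (8 * n)) ^ 2) := Finset.sum_le_sum fun j _ => h1 j
          _ = 2 * (∑ j, (z j - (((k + 1 : ℕ) : ℝ) / (16 * n) : ℝ) * x j) ^ 2)
              + n * (2 * (1 / (8 * n)) ^ 2) := by
            rw [Finset.sum_add_distrib, ← Finset.mul_sum]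
            simp
          _ ≤ 1 / 16 := by linarith
      have := hstep _ hy _ (by linarith) (ih (by omega)) z hdist
      rw [pow_succ]
      nlinarith
  have hfin := hind (16 * n) le_rfl x (by
    have : (((16 * n : ℕ) : ℝ) / (16 * n) : ℝ) = 1 := by
      push_cast
      exact div_self (by positivity)
    rw [this]
    norm_num)
  linarith

lemma hessian_eq {n : ℕ} {O : Set (Fin n → ℝ)} (hO : IsOpen O) {u : (Fin n → ℝ) → ℝ}
    (hu : ContDiffOn ℝ 4 u O) {x : Fin n → ℝ} (hx : x ∈ O) (i j : Fin n) :
    hessian n u x i j = partialDeriv j (partialDeriv i u) x := by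
  rw [(hu.of_le (by norm_num)).partialDeriv_comm hO hx j i, hessian, iteratedFDeriv_two_apply]
  unfold partialDeriv
  have hd : DifferentiableAt ℝ (fderiv ℝ u) x :=
    ((hu.fderiv_of_isOpen (m := 1) hO (by norm_num)).differentiableOn one_ne_zero).differentiableAt
      (hO.mem_nhds hx)
  rw [fderiv_clm_apply hd (differentiableAt_const _)]
  simp

namespace IsJet

variable {n : ℕ} {O : Set (Fin n → ℝ)} {u : (Fin n → ℝ) → ℝ} {p : Fin n → (Fin n → ℝ) → ℝ}
  {A : Fin n → Fin n → (Fin n → ℝ) → ℝ} {T : Fin n → Fin n → Fin n → (Fin n → ℝ) → ℝ}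
  {U : Fin n → Fin n → Fin n → Fin n → (Fin n → ℝ) → ℝ}

lemma exists_grad_comp (h : IsJet O u p A T U) {x : Fin n → ℝ} (hx : x ∈ O)
    {F : (Fin n → ℝ) × ℝ × (Fin n → ℝ) → ℝ} {K R : ℝ}
    (hF : DifferentiableAt ℝ F (x, u x, fun i => p i x))
    (hK : ‖fderiv ℝ F (x, u x, fun i => p i x)‖ ≤ K) (hR : 1 ≤ R)
    (hp : ∀ k, |p k x| ≤ R) (hA : ∀ i j, |A i j x| ≤ R) :
    ∃ c, HasGrad (fun x => F (x, u x, fun i => p i x)) c x ∧ ∀ k, |c k| ≤ K * R := by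
  obtain ⟨u', hu', hu⟩ := h.grad_u x hx
  choose p' hp' hpc using h.grad_p x hx
  have hcomp := hF.hasFDerivAt.comp x
    ((hasFDerivAt_id x).prodMk (hu'.prodMk (hasFDerivAt_pi.2 hp')))
  refine ⟨_, ⟨_, hcomp, fun k => rfl⟩, fun k => ?_⟩
  rw [← Real.norm_eq_abs, ContinuousLinearMap.comp_apply]
  refine (ContinuousLinearMap.le_opNorm _ _).trans (mul_le_mul hK ?_ (norm_nonneg _)
    ((norm_nonneg _).trans hK))
  refine norm_prod_le_iff.2 ⟨?_, norm_prod_le_iff.2 ⟨?_, ?_⟩⟩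
  · simpa [Pi.norm_single] using hR
  · simpa [hu] using hp k
  · refine (pi_norm_le_iff_of_nonneg (by linarith)).2 fun i => ?_
    simpa [hpc] using hA i k

end IsJet

/-- For a solution of a `σ₂` equation with `C¹` right-hand side, the gradient of `σ₂(D²u)` is
bounded by a multiple of the Laplacian. -/
lemma sum_sq_grad_sigma_le {n : ℕ} (hn : 1 ≤ n) {O : Set (Fin n → ℝ)} (hO : IsOpen O)
    {u : (Fin n → ℝ) → ℝ} {p : Fin n → (Fin n → ℝ) → ℝ}
    {A : Fin n → Fin n → (Fin n → ℝ) → ℝ} {T : Fin n → Fin n → Fin n → (Fin n → ℝ) → ℝ}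
    {U : Fin n → Fin n → Fin n → Fin n → (Fin n → ℝ) → ℝ} (h : IsJet O u p A T U)
    {F : (Fin n → ℝ) × ℝ × (Fin n → ℝ) → ℝ} {K M : ℝ} (hM : 0 ≤ M)
    (hσ : ∀ x ∈ O, SigmaTwoPos (fun i j => A i j x) (∑ i, A i i x)
      (F (x, u x, fun i => p i x)) K)
    (hp : ∀ x ∈ O, ∀ k, |p k x| ≤ M) {x : Fin n → ℝ} (hx : x ∈ O)
    (hF : DifferentiableAt ℝ F (x, u x, fun i => p i x))
    (hK : ‖fderiv ℝ F (x, u x, fun i => p i x)‖ ≤ K) :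
    ∑ k, ((∑ i, A i i x) * (∑ i, T i i k x) - ∑ i, ∑ j, A i j x * T i j k x) ^ 2
      ≤ (n * (K * ((1 + K) * (1 + M) + 1))) ^ 2 * (∑ i, A i i x) ^ 2 := by
  have hs := hσ x hx
  have hn0 : (1 : ℝ) ≤ n := by exact_mod_cast hn
  have hKp := hs.posK
  have hL := hs.posL
  set L := ∑ i, A i i x with hLdef
  have hone : 1 ≤ (1 + K) * L := by
    have h1 : 2 * (1 / K) ≤ L ^ 2 := by
      have h2 : 0 ≤ ∑ i, ∑ j, A i j x ^ 2 :=
        Finset.sum_nonneg fun _ _ => Finset.sum_nonneg fun _ _ => sq_nonneg _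
      have := hs.sigma
      have := hs.lower
      linarith
    have h3 : 2 ≤ K * L ^ 2 := by
      have := mul_le_mul_of_nonneg_left h1 hKp.le
      have e : K * (2 * (1 / K)) = 2 := by field_simp
      linarith
    by_contra! hc
    have h4 : ((1 + K) * L) ^ 2 < 1 := by
      have : 0 ≤ (1 + K) * L := by positivity
      nlinarith
    nlinarith [sq_nonneg L, sq_nonneg (K * L)]
  set R := ((1 + K) * (1 + M) + 1) * L with hR
  have hR1 : (1 + M) + L ≤ R := by
    rw [hR]
    nlinarith
  obtain ⟨c, hc, hcb⟩ := h.exists_grad_comp hx hF hK (R := R) (by linarith)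
    (fun k => (hp x hx k).trans (by linarith))
    (fun i j => (hs.abs_entry_le i j).trans (by linarith))
  have heq : (fun x => F (x, u x, fun i => p i x)) =ᶠ[nhds x]
      fun x => ((∑ i, A i i x) ^ 2 - ∑ i, ∑ j, A i j x ^ 2) / 2 := by
    filter_upwards [hO.mem_nhds hx] with y hy
    have := (hσ y hy).sigma
    linarith
  have hgrad : ∀ k, L * (∑ i, T i i k x) - ∑ i, ∑ j, A i j x * T i j k x = c k := by
    intro k
    rw [← hc.fderiv_apply k, heq.fderiv_eq, (h.grad_sigma hx).fderiv_apply k]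
  calc _ = ∑ k, c k ^ 2 := Finset.sum_congr rfl fun k _ => by rw [hgrad k]
    _ ≤ ∑ _k : Fin n, (K * R) ^ 2 := Finset.sum_le_sum fun k _ =>
        sq_le_sq.2 ((hcb k).trans (le_abs_self _))
    _ = n * (K * R) ^ 2 := by simp
    _ ≤ n ^ 2 * (K * R) ^ 2 := mul_le_mul_of_nonneg_right (by nlinarith) (sq_nonneg _)
    _ = _ := by rw [hR]; ring

/-- doubling inequality for the σ₂ equation: if `u ∈ C⁴(B₄)` is a 2-convex
solution of `σ₂(λ(D²u)) = ψ(x,u,∇u)` in `B₄(0) ⊂ ℝⁿ` with `ψ` positive of class `C¹`, and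
`λ_min(D²u)/Δu ≥ −c_n` everywhere with `c_n = (√(3n²+1) − n + 1)/(2n)`, then
`sup_{B₂} Δu ≤ C(1 + sup_{B₁} Δu)` with `C` depending only on `n`, `‖ψ‖_{C¹} ≤ K`,
`‖1/ψ‖_{L^∞} ≤ K` and `‖u‖_{C¹(B₃)} ≤ M`. -/
theorem stmt4 (n : ℕ) (hn : 2 ≤ n) (M K : ℝ) (hM : 0 < M) (hK : 0 < K) :
    ∃ C : ℝ, 0 < C ∧
      ∀ (u : (Fin n → ℝ) → ℝ) (ψ : (Fin n → ℝ) → ℝ → (Fin n → ℝ) → ℝ),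
        -- u ∈ C⁴(B₄)
        ContDiffOn ℝ 4 u (ball 0 4) →
        -- ψ positive and of class C¹
        (∀ x ∈ ball (0 : Fin n → ℝ) 4, ∀ s : ℝ, ∀ p : Fin n → ℝ, 0 < ψ x s p) →
        ContDiffOn ℝ 1 (fun q : (Fin n → ℝ) × ℝ × (Fin n → ℝ) => ψ q.1 q.2.1 q.2.2)
          (ball (0 : Fin n → ℝ) 4 ×ˢ (univ : Set (ℝ × (Fin n → ℝ)))) →
        -- ‖ψ‖_{C¹} ≤ K and ‖1/ψ‖_{L^∞} ≤ K
        (∀ q ∈ ball (0 : Fin n → ℝ) 4 ×ˢ (univ : Set (ℝ × (Fin n → ℝ))),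
          |ψ q.1 q.2.1 q.2.2| ≤ K ∧
          ‖fderivWithin ℝ (fun q : (Fin n → ℝ) × ℝ × (Fin n → ℝ) => ψ q.1 q.2.1 q.2.2)
              (ball (0 : Fin n → ℝ) 4 ×ˢ (univ : Set (ℝ × (Fin n → ℝ)))) q‖ ≤ K) →
        (∀ x ∈ ball (0 : Fin n → ℝ) 4, ∀ s : ℝ, ∀ p : Fin n → ℝ, 1 / ψ x s p ≤ K) →
        -- ‖u‖_{C¹(B₃)} ≤ M
        (∀ x ∈ ball (0 : Fin n → ℝ) 3, |u x| + ‖fderiv ℝ u x‖ ≤ M) →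
        -- u is 2-convex and solves σ₂(λ(D²u)) = ψ(x,u,∇u) in B₄
        (∀ x ∈ ball (0 : Fin n → ℝ) 4,
          0 < lapl n u x ∧ 0 < sigma2 n u x ∧
            sigma2 n u x = ψ x (u x) (gradvec n u x)) →
        -- λ_min(D²u)/Δu ≥ −c_n, i.e. D²u ≥ −c_n Δu · Id as quadratic forms
        (∀ x ∈ ball (0 : Fin n → ℝ) 4, ∀ v : Fin n → ℝ,
          -((Real.sqrt (3 * (n : ℝ) ^ 2 + 1) - n + 1) / (2 * n)) * lapl n u x
              * ∑ i, (v i) ^ 2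
            ≤ ∑ i, ∑ j, v i * hessian n u x i j * v j) →
        -- doubling inequality: sup_{B₂} Δu ≤ C (1 + sup_{B₁} Δu)
        ∀ m : ℝ, (∀ y ∈ ball (0 : Fin n → ℝ) 1, lapl n u y ≤ m) →
          ∀ x ∈ ball (0 : Fin n → ℝ) 2, lapl n u x ≤ C * (1 + m) := by
  have hn1 : 1 ≤ n := by omega
  have hn0 : (1 : ℝ) ≤ n := by exact_mod_cast hn1
  have hMn : M ≤ n * M := by nlinarith
  obtain ⟨C, hC, hloc⟩ := exists_local_doubling hn (K := K) (M := n * M)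
    (Cf := n * (K * ((1 + K) * (1 + M) + 1))) hK (by positivity) (by positivity)
  refine ⟨(C + 1) ^ (16 * n), by positivity, ?_⟩
  intro u ψ hu hψ hψC hψK hψl huM hsol hconv m hm
  have h34 : ball (0 : Fin n → ℝ) 3 ⊆ ball 0 4 := ball_subset_ball (by norm_num)
  have hjet := isJet_partialDeriv isOpen_ball hu
  have hjet3 := isJet_partialDeriv isOpen_ball (hu.mono h34)
  have hH : ∀ x ∈ ball (0 : Fin n → ℝ) 4, ∀ i j,
      hessian n u x i j = partialDeriv j (partialDeriv i u) x :=
    fun x hx i j => hessian_eq isOpen_ball hu hx i j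
  have hL : ∀ x ∈ ball (0 : Fin n → ℝ) 4,
      lapl n u x = ∑ i, partialDeriv i (partialDeriv i u) x :=
    fun x hx => Finset.sum_congr rfl fun i _ => hH x hx i i
  set F : (Fin n → ℝ) × ℝ × (Fin n → ℝ) → ℝ := fun q => ψ q.1 q.2.1 q.2.2 with hF
  have hopen : IsOpen (ball (0 : Fin n → ℝ) 4 ×ˢ (univ : Set (ℝ × (Fin n → ℝ)))) :=
    isOpen_ball.prod isOpen_univ
  have hmem : ∀ x ∈ ball (0 : Fin n → ℝ) 4, ((x, u x, fun i => partialDeriv i u x) :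
      (Fin n → ℝ) × ℝ × (Fin n → ℝ)) ∈ ball (0 : Fin n → ℝ) 4 ×ˢ
        (univ : Set (ℝ × (Fin n → ℝ))) := fun x hx => ⟨hx, mem_univ _⟩
  have hp : ∀ x ∈ ball (0 : Fin n → ℝ) 3, ∀ k, |partialDeriv k u x| ≤ M := by
    intro x hx k
    have h1 := (fderiv ℝ u x).le_opNorm (Pi.single k 1)
    rw [Pi.norm_single, norm_one, mul_one, Real.norm_eq_abs] at h1
    have h2 := huM x hx
    have h3 := abs_nonneg (u x)
    exact h1.trans (by linarith)
  have hσ : ∀ x ∈ ball (0 : Fin n → ℝ) 3, SigmaTwoPos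
      (fun i j => partialDeriv j (partialDeriv i u) x) (∑ i, partialDeriv i (partialDeriv i u) x)
      (F (x, u x, fun i => partialDeriv i u x)) K := by
    intro x hx
    have hx4 := h34 hx
    obtain ⟨s1, s2, s3⟩ := hsol x hx4
    refine ⟨fun i j => hjet3.symm_A x hx i j, rfl, ?_, hL x hx4 ▸ s1, hK, ?_⟩
    · have e : F (x, u x, fun i => partialDeriv i u x) = sigma2 n u x := s3.symm
      rw [e, sigma2, hL x hx4, mul_div_cancel₀ _ two_ne_zero]
      congr 1
      refine Finset.sum_congr rfl fun i _ => Finset.sum_congr rfl fun j _ => ?_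
      rw [hH x hx4, hH x hx4, sq]
      exact congrArg _ (hjet3.symm_A x hx j i)
    · exact (one_div_le hK (hψ x hx4 _ _)).2 (hψl x hx4 _ _)
  have h0 : 0 ≤ m := (hsol 0 (mem_ball_self (by norm_num))).1.le.trans
    (hm 0 (mem_ball_self one_pos))
  have key := le_of_local_doubling (Λ := fun x => ∑ i, partialDeriv i (partialDeriv i u) x)
    hn1 hC h0 (fun y hy m' hm' hb x hx => hloc hjet3 isOpen_ball hσ ?_ ?_ ?_ ?_ ?_ hm' hb x hx)
    (fun x hx => (hL x (ball_subset_ball (by norm_num) hx)).symm.le.trans (hm x hx))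
  · intro x hx
    rw [hL x (ball_subset_ball (by norm_num) hx)]
    exact key x hx
  · intro x hx v
    have := hconv x (h34 hx) v
    rw [hL x (h34 hx)] at this
    simpa only [hH x (h34 hx)] using this
  · intro x hx
    have hx4 := h34 hx
    have hd := (hψC.differentiableOn one_ne_zero).differentiableAt (hopen.mem_nhds (hmem x hx4))
    have hb := (hψK _ (hmem x hx4)).2
    rw [fderivWithin_of_isOpen hopen (hmem x hx4)] at hb
    exact sum_sq_grad_sigma_le hn1 isOpen_ball hjet3 hM.le hσ hp hx hd hb
  · intro x hx
    have h2 := huM x hx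
    have h3 := norm_nonneg (fderiv ℝ u x)
    linarith
  · intro x hx
    calc _ ≤ ∑ _i : Fin n, M ^ 2 := Finset.sum_le_sum fun i _ =>
          sq_le_sq.2 ((hp x hx i).trans (le_abs_self _))
      _ = n * M ^ 2 := by simp
      _ ≤ n ^ 2 * M ^ 2 := mul_le_mul_of_nonneg_right (by nlinarith) (sq_nonneg _)
      _ = _ := by ring
  · intro z hz
    rw [mem_ball_zero_iff] at hy ⊢
    rw [mem_closedBall, dist_eq_norm] at hz
    have := norm_add_le (z - y) y
    rw [sub_add_cancel] at this
    linarith
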